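/- (Marshall) Let f be a bounded holomorphic function on the open unit disc 𝔻 with ‖f‖_∞ ≤ 1, and let ε > 0. Then there exist inner functions ω₁, …, ω_n (which may be taken to be Blaschke products) and nonnegative reals λ₁, …, λ_n with λ₁ + ⋯ + λ_n = 1, such that sup_{z ∈ 𝔻} |λ₁ω₁(z) + ⋯ + λ_nω_n(z) − f(z)| < ε. Consequently, the closed convex hull of the inner functions (equivalently, of the Blaschke products) equals the closed unit ball of H^∞. -/

import Mathlib

open Complex Metric Set Filter MeasureTheory
open scoped Topology Real

/-- A (possibly infinite) Blaschke product
`c z^m ∏ᵢ (|aᵢ|/aᵢ)·(aᵢ - z)/(1 - conj aᵢ · z)`. -/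
noncomputable def blaschkeProd (m : ℕ) (c : ℂ) {ι : Type} (a : ι → ℂ) : ℂ → ℂ :=
  fun z => c * z ^ m *
    ∏' i, ((‖a i‖ : ℂ) / a i) * ((a i - z) / (1 - (starRingEnd ℂ) (a i) * z))

/-- `f` is a Blaschke product on the set `s`: it agrees there with
`c z^m ∏ᵢ (|aᵢ|/aᵢ)(aᵢ - z)/(1 - conj aᵢ z)` where `|c| = 1`, the `aᵢ` form a (finite or
countable) family of nonzero points of the open unit disc satisfying the Blaschke condition
`∑ᵢ (1 - |aᵢ|) < ∞`. -/
def IsBlaschkeProductOn (f : ℂ → ℂ) (s : Set ℂ) : Prop :=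
  ∃ (m : ℕ) (c : ℂ) (ι : Type) (_ : Countable ι) (a : ι → ℂ),
    ‖c‖ = 1 ∧ (∀ i, a i ≠ 0 ∧ ‖a i‖ < 1) ∧
    Summable (fun i => 1 - ‖a i‖) ∧
    Set.EqOn f (blaschkeProd m c a) s

/-- `φ` is an inner function: a bounded holomorphic function on the open unit disc whose radial
boundary values have modulus one almost everywhere. -/
def IsInner (φ : ℂ → ℂ) : Prop :=
  DifferentiableOn ℂ φ (ball (0:ℂ) 1) ∧
  (∃ C : ℝ, ∀ z ∈ ball (0:ℂ) 1, ‖φ z‖ ≤ C) ∧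
  ∀ᵐ (θ : ℝ) ∂(volume.restrict (Set.Ioc (0:ℝ) (2*π))),
    ∃ L : ℂ, ‖L‖ = 1 ∧
      Tendsto (fun r : ℝ => φ ((r : ℂ) * Complex.exp ((θ : ℂ) * Complex.I)))
        (𝓝[<] (1:ℝ)) (𝓝 L)

lemma poissonKernel_nonneg_of_circle {w ζ : ℂ} (hw : w ∈ ball (0:ℂ) 1) (hζ : ζ ∈ sphere (0:ℂ) 1) :
    0 ≤ poissonKernel 0 w ζ := by
  simp only [mem_ball_zero_iff, mem_sphere_zero_iff_norm] at hw hζ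
  rw [poissonKernel_def]
  simp only [sub_zero, hζ]
  have := norm_nonneg w
  have : ‖w‖ ^ 2 ≤ 1 := by nlinarith
  exact div_nonneg (by linarith) (by positivity)

lemma continuousOn_poissonKernel_sphere {w : ℂ} (hw : w ∈ ball (0:ℂ) 1) :
    ContinuousOn (poissonKernel 0 w) (sphere (0:ℂ) 1) := by
  rw [poissonKernel_eq_re_herglotzRieszKernel]
  exact continuous_re.comp_continuousOn (by simpa using continuousOn_herglotzRieszKernel_sphere hw)

lemma circleAverage_poissonKernel_mul_re {w : ℂ} (hw : w ∈ ball (0:ℂ) 1) {f : ℂ → ℂ}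
    (hf : DiffContOnCl ℂ f (ball 0 1)) :
    Real.circleAverage (fun ζ => poissonKernel 0 w ζ * (f ζ).re) 0 1 = (f w).re := by
  have h := hf.circleAverage_poissonKernel_smul hw
  have hi : CircleIntegrable (poissonKernel 0 w • f) 0 1 := by
    apply ContinuousOn.circleIntegrable zero_le_one
    refine (continuousOn_poissonKernel_sphere hw).smul (hf.continuousOn.mono ?_)
    rw [closure_ball _ one_ne_zero]
    exact sphere_subset_closedBall
  have h2 := Complex.reCLM.circleAverage_comp_comm (f := poissonKernel 0 w • f) hi
  rw [h] at h2
  simp only [reCLM_apply] at h2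
  rw [← h2]
  congr 1
  ext ζ
  simp

lemma circleAverage_poissonKernel {w : ℂ} (hw : w ∈ ball (0:ℂ) 1) :
    Real.circleAverage (poissonKernel 0 w) 0 1 = 1 := by
  simpa using circleAverage_poissonKernel_mul_re hw (f := fun _ => 1) diffContOnCl_const

lemma ofReal_mem_ball {r : ℝ} (h0 : 0 < r) (h1 : r < 1) : (r : ℂ) ∈ ball (0:ℂ) 1 := by
  simp [abs_of_pos h0, h1]

lemma eventually_pos_lt_one : ∀ᶠ r : ℝ in 𝓝[<] 1, 0 < r ∧ r < 1 :=
  Ioo_mem_nhdsLT zero_lt_one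

/-- The Poisson kernels `P_r` concentrate at the point `1` as `r → 1`. -/
lemma tendsto_circleAverage_poissonKernel_mul {h : ℂ → ℝ} {M : ℝ}
    (h0 : ∀ ζ ∈ sphere (0:ℂ) 1, 0 ≤ h ζ) (hM : ∀ ζ ∈ sphere (0:ℂ) 1, h ζ ≤ M)
    (hlim : ∀ ε > 0, ∃ η > 0, ∀ ζ ∈ sphere (0:ℂ) 1, ‖ζ - 1‖ < η → h ζ ≤ ε) :
    Tendsto (fun r : ℝ => Real.circleAverage (fun ζ => poissonKernel 0 r ζ * h ζ) 0 1)
      (𝓝[<] 1) (𝓝 0) := by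
  rw [Metric.tendsto_nhds]
  intro ε hε
  obtain ⟨η, hη, hh⟩ := hlim (ε / 2) (by positivity)
  have hM0 : 0 ≤ M := (h0 1 (by simp)).trans (hM 1 (by simp))
  set K := M / η ^ 2
  have hK : 0 ≤ K := by positivity
  have key : ∀ ζ ∈ sphere (0:ℂ) 1, h ζ ≤ ε / 2 + K * (2 - 2 * ζ.re) := by
    intro ζ hζ
    have e : ‖ζ - 1‖ ^ 2 = 2 - 2 * ζ.re := by
      have h1 : ‖ζ‖ ^ 2 = 1 := by simp_all
      rw [← normSq_eq_norm_sq, normSq_apply] at h1 ⊢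
      simp
      linarith
    rw [← e]
    by_cases hc : ‖ζ - 1‖ < η
    · have := hh ζ hζ hc
      have : 0 ≤ K * ‖ζ - 1‖ ^ 2 := by positivity
      linarith
    · push Not at hc
      have h2 : η ^ 2 ≤ ‖ζ - 1‖ ^ 2 := by gcongr
      have h3 : K * η ^ 2 ≤ K * ‖ζ - 1‖ ^ 2 := by gcongr
      have h4 : K * η ^ 2 = M := div_mul_cancel₀ _ (by positivity)
      linarith [hM ζ hζ]
  have hev : ∀ᶠ r : ℝ in 𝓝[<] 1, K * (2 - 2 * r) < ε / 2 := by
    have : Tendsto (fun r : ℝ => K * (2 - 2 * r)) (𝓝[<] 1) (𝓝 (K * (2 - 2 * 1))) :=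
      (Continuous.tendsto (by fun_prop) 1).mono_left nhdsWithin_le_nhds
    norm_num at this
    exact this.eventually (gt_mem_nhds (by positivity))
  filter_upwards [hev, eventually_pos_lt_one] with r hr hr1
  have hw := ofReal_mem_ball hr1.1 hr1.2
  rw [Real.dist_eq, sub_zero]
  by_cases hi : CircleIntegrable (fun ζ => poissonKernel 0 r ζ * h ζ) 0 1
  · rw [abs_of_nonneg (Real.circleAverage_nonneg_of_nonneg fun ζ hζ => by
      rw [abs_one] at hζ
      exact mul_nonneg (poissonKernel_nonneg_of_circle hw hζ) (h0 ζ hζ))]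
    have hg : DiffContOnCl ℂ (fun z : ℂ => ((ε / 2 : ℝ) : ℂ) + K * (2 - 2 * z)) (ball 0 1) :=
      Differentiable.diffContOnCl (by fun_prop)
    have e := circleAverage_poissonKernel_mul_re hw hg
    calc _ ≤ Real.circleAverage (fun ζ => poissonKernel 0 r ζ *
          (((ε / 2 : ℝ) : ℂ) + K * (2 - 2 * ζ)).re) 0 1 := by
          apply Real.circleAverage_mono hi
          · apply ContinuousOn.circleIntegrable zero_le_one
            exact (continuousOn_poissonKernel_sphere hw).mul (by fun_prop)
          · intro ζ hζ
            rw [abs_one] at hζ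
            apply mul_le_mul_of_nonneg_left _ (poissonKernel_nonneg_of_circle hw hζ)
            simpa using key ζ hζ
      _ = _ := e
      _ < ε := by
          simp
          linarith
  · rw [Real.circleAverage.integral_undef hi]
    simpa using hε

lemma norm_circleAverage_le {E : Type*} [NormedAddCommGroup E] [NormedSpace ℝ E] (f : ℂ → E)
    (c : ℂ) (R : ℝ) :
    ‖Real.circleAverage f c R‖ ≤ Real.circleAverage (fun ζ => ‖f ζ‖) c R := by
  simp only [Real.circleAverage_def, norm_smul]
  have h : (0:ℝ) < (2 * π)⁻¹ := by positivity
  rw [Real.norm_of_nonneg h.le, smul_eq_mul]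
  gcongr
  exact intervalIntegral.norm_integral_le_integral_norm (by positivity)

lemma norm_sub_real_eq {ζ : ℂ} (hζ : ‖ζ‖ = 1) (r : ℝ) : ‖r * ζ - 1‖ = ‖ζ - r‖ := by
  have h1 : ‖ζ‖ ^ 2 = 1 := by simp [hζ]
  rw [← sq_eq_sq₀ (norm_nonneg _) (norm_nonneg _)]
  rw [← normSq_eq_norm_sq, normSq_apply] at h1 ⊢
  rw [← normSq_eq_norm_sq, normSq_apply]
  simp
  linear_combination (r ^ 2 - 1) * h1

lemma one_sub_le_norm_sub {ζ : ℂ} (hζ : ‖ζ‖ = 1) {r : ℝ} (h0 : 0 < r) : 1 - r ≤ ‖ζ - r‖ := by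
  have := norm_sub_norm_le ζ (r : ℂ)
  rwa [hζ, norm_real, Real.norm_of_nonneg h0.le] at this

lemma norm_sub_one_le {ζ : ℂ} (hζ : ‖ζ‖ = 1) {r : ℝ} (h0 : 0 < r) (h1 : r < 1) :
    ‖ζ - 1‖ ≤ 2 * ‖ζ - r‖ := by
  have h := one_sub_le_norm_sub hζ h0
  have h2 : ‖(r : ℂ) - 1‖ = 1 - r := by
    rw [← norm_neg, neg_sub, ← ofReal_one, ← ofReal_sub, norm_real,
      Real.norm_of_nonneg (by linarith)]
  calc ‖ζ - 1‖ = ‖(ζ - r) + (r - 1)‖ := by ring_nf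
    _ ≤ ‖ζ - r‖ + ‖(r : ℂ) - 1‖ := norm_add_le _ _
    _ ≤ _ := by linarith

lemma norm_derivKernel_mul_le {ζ : ℂ} (hζ : ‖ζ‖ = 1) {r : ℝ} (h0 : 0 < r) (h1 : r < 1) :
    ‖ζ / (ζ - r) ^ 2 - r ^ 2 * ζ / (r * ζ - 1) ^ 2‖ * ‖ζ - 1‖ ≤ 10 * poissonKernel 0 r ζ := by
  have ha := one_sub_le_norm_sub hζ h0
  have hb := norm_sub_one_le hζ h0 h1
  have hc := norm_sub_real_eq hζ r
  have hpos : 0 < ‖ζ - r‖ := by linarith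
  have n1 : ζ - r ≠ 0 := norm_pos_iff.1 hpos
  have n2 : r * ζ - 1 ≠ 0 := norm_pos_iff.1 (hc ▸ hpos)
  have e : ζ / (ζ - r) ^ 2 - r ^ 2 * ζ / (r * ζ - 1) ^ 2
      = -(ζ * (1 - r ^ 2) * (2 * r * ζ - 1 - r ^ 2) / ((ζ - r) ^ 2 * (r * ζ - 1) ^ 2)) := by
    rw [div_sub_div _ _ (pow_ne_zero 2 n1) (pow_ne_zero 2 n2), ← neg_div]
    congr 1
    ring
  have hr2 : ‖(1 : ℂ) - r ^ 2‖ = 1 - r ^ 2 := by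
    rw [← ofReal_one, ← ofReal_pow, ← ofReal_sub, norm_real, Real.norm_of_nonneg (by nlinarith)]
  have hd : ‖2 * r * ζ - 1 - r ^ 2‖ ≤ 2 * ‖ζ - 1‖ + (1 - r) ^ 2 := by
    have h2 : ‖(((1 - r) ^ 2 : ℝ) : ℂ)‖ = (1 - r) ^ 2 := by
      rw [norm_real, Real.norm_of_nonneg (by positivity)]
    calc ‖2 * r * ζ - 1 - r ^ 2‖ = ‖2 * r * (ζ - 1) - (((1 - r) ^ 2 : ℝ) : ℂ)‖ := by
          push_cast; ring_nf
      _ ≤ ‖2 * r * (ζ - 1)‖ + ‖(((1 - r) ^ 2 : ℝ) : ℂ)‖ := norm_sub_le _ _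
      _ ≤ _ := by
          rw [h2, norm_mul, norm_mul, norm_real, Real.norm_of_nonneg h0.le, norm_ofNat]
          have := norm_nonneg (ζ - 1)
          nlinarith
  rw [e, norm_neg, norm_div, norm_mul, norm_mul, norm_mul, norm_pow, norm_pow, hc, hζ, hr2,
    poissonKernel_def]
  simp only [sub_zero, hζ, norm_real, Real.norm_of_nonneg h0.le]
  have h3 : ‖ζ - 1‖ ≤ 2 := by
    calc ‖ζ - 1‖ ≤ ‖ζ‖ + ‖(1:ℂ)‖ := norm_sub_le _ _
      _ = 2 := by rw [hζ, norm_one]; norm_num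
  have h4 : ‖2 * r * ζ - 1 - r ^ 2‖ * ‖ζ - 1‖ ≤ 10 * ‖ζ - r‖ ^ 2 := by
    have i1 : ‖ζ - 1‖ ^ 2 ≤ (2 * ‖ζ - r‖) ^ 2 := by gcongr
    have i2 : (1 - r) ^ 2 ≤ ‖ζ - r‖ ^ 2 := by
      have : 0 ≤ 1 - r := by linarith
      gcongr
    have := norm_nonneg (ζ - 1)
    calc _ ≤ (2 * ‖ζ - 1‖ + (1 - r) ^ 2) * ‖ζ - 1‖ := by gcongr
      _ = 2 * ‖ζ - 1‖ ^ 2 + (1 - r) ^ 2 * ‖ζ - 1‖ := by ring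
      _ ≤ 2 * (2 * ‖ζ - r‖) ^ 2 + ‖ζ - r‖ ^ 2 * 2 := by gcongr
      _ = _ := by ring
  calc _ = (1 - r ^ 2) * (‖2 * r * ζ - 1 - r ^ 2‖ * ‖ζ - 1‖) / (‖ζ - r‖ ^ 2 * ‖ζ - r‖ ^ 2) := by
        ring
    _ ≤ (1 - r ^ 2) * (10 * ‖ζ - r‖ ^ 2) / (‖ζ - r‖ ^ 2 * ‖ζ - r‖ ^ 2) := by
        have : 0 ≤ 1 - r ^ 2 := by nlinarith
        gcongr
    _ = _ := by
        field_simp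

lemma DiffContOnCl.continuousOn_sphere {F : ℂ → ℂ} (hF : DiffContOnCl ℂ F (ball 0 1)) :
    ContinuousOn F (sphere 0 1) := by
  refine hF.continuousOn.mono ?_
  rw [closure_ball _ one_ne_zero]
  exact sphere_subset_closedBall

/-- Cauchy's formula for the derivative with a symmetrised kernel. -/
lemma deriv_eq_circleAverage {F : ℂ → ℂ} (hF : DiffContOnCl ℂ F (ball 0 1)) {r : ℝ}
    (h0 : 0 < r) (h1 : r < 1) :
    deriv F r = Real.circleAverage
      (fun ζ => (ζ / (ζ - r) ^ 2 - r ^ 2 * ζ / (r * ζ - 1) ^ 2) * F ζ) 0 1 := by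
  have hcs := hF.continuousOn_sphere
  have hFint : CircleIntegrable F 0 1 := hcs.circleIntegrable zero_le_one
  have hr := ofReal_mem_ball h0 h1
  have hne : ∀ w ∈ ball (0:ℂ) 1, ∀ ζ ∈ sphere (0:ℂ) 1, ζ - w ≠ 0 := by
    intro w hw ζ hζ h
    rw [sub_eq_zero] at h
    subst h
    simp only [mem_ball_zero_iff, mem_sphere_zero_iff_norm] at hw hζ
    linarith
  have hne2 : ∀ z : ℂ, ‖z‖ ≤ 1 → (r * z - 1 : ℂ) ≠ 0 := by
    intro z hz h
    rw [sub_eq_zero] at h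
    have := congrArg norm h
    rw [norm_mul, norm_real, Real.norm_of_nonneg h0.le, norm_one] at this
    nlinarith
  have e1 : ∀ w ∈ ball (0:ℂ) 1,
      Real.circleAverage (fun ζ => herglotzRieszKernel 0 w ζ • F ζ) 0 1 = 2 * F w - F 0 := by
    intro w hw
    have c1 : CircleIntegrable (fun ζ => ((ζ - 0) / (ζ - w)) • F ζ) 0 1 := by
      apply ContinuousOn.circleIntegrable zero_le_one
      exact ((continuousOn_id.sub continuousOn_const).div
        (continuousOn_id.sub continuousOn_const) (hne w hw)).smul hcs
    have h := DiffContOnCl.circleAverage_smul_div (c := 0) (R := 1) (w := w) (f := F)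
      (by simpa using hF) (by simpa using hw)
    have h' := DiffContOnCl.circleAverage (c := 0) (R := 1) (f := F) (by simpa using hF)
    rw [← h, ← h', ← smul_eq_mul, ← Real.circleAverage_fun_smul, ← Real.circleAverage_fun_sub]
    · apply Real.circleAverage_congr_sphere
      intro ζ hζ
      rw [abs_one] at hζ
      have := hne w hw ζ hζ
      simp [herglotzRieszKernel_def]
      field_simp
      ring
    · exact c1.const_smul
    · exact hFint
  have e2 : deriv F r = Real.circleAverage (fun ζ => (ζ / (ζ - r) ^ 2) * F ζ) 0 1 := by
    have d1 := hasDerivAt_circleAverage_herglotzRieszKernel_smul hFint hr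
    have d2 : HasDerivAt (fun w => 2 * F w - F 0) (2 * deriv F r) r :=
      ((hF.differentiableAt isOpen_ball hr).hasDerivAt.const_mul 2).sub_const _
    have d3 := d1.congr_of_eventuallyEq (f₁ := fun w => 2 * F w - F 0) (by
      filter_upwards [isOpen_ball.mem_nhds hr] with w hw
      exact (e1 w hw).symm)
    have := d2.unique d3
    have h2 : Real.circleAverage (fun ζ => (2 * ζ / (ζ - r) ^ 2) • F ζ) 0 1
        = (2:ℂ) • Real.circleAverage (fun ζ => (ζ / (ζ - r) ^ 2) * F ζ) 0 1 := by
      rw [← Real.circleAverage_fun_smul]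
      congr 1
      ext ζ
      simp
      ring
    rw [h2, smul_eq_mul] at this
    exact mul_left_cancel₀ two_ne_zero this
  have e3 : Real.circleAverage (fun ζ => (r ^ 2 * ζ / (r * ζ - 1) ^ 2) * F ζ) 0 1 = 0 := by
    have hG : DiffContOnCl ℂ (fun z => (r ^ 2 * z / (r * z - 1) ^ 2) * F z) (ball 0 1) := by
      have : DiffContOnCl ℂ (fun z : ℂ => (r ^ 2 * z / (r * z - 1) ^ 2)) (ball 0 1) := by
        apply DifferentiableOn.diffContOnCl
        rw [closure_ball _ one_ne_zero]
        intro z hz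
        have := hne2 z (by simpa using hz)
        apply DifferentiableAt.differentiableWithinAt
        have : (r * z - 1) ^ 2 ≠ 0 := pow_ne_zero _ this
        fun_prop (disch := assumption)
      exact this.smul hF
    have h' := DiffContOnCl.circleAverage (c := 0) (R := 1) (f := _) (by simpa using hG)
    simpa using h'
  have e4 : deriv F r = Real.circleAverage (fun ζ => (ζ / (ζ - r) ^ 2) * F ζ) 0 1
      - Real.circleAverage (fun ζ => (r ^ 2 * ζ / (r * ζ - 1) ^ 2) * F ζ) 0 1 := by
    rw [e3, sub_zero, e2]
  rw [e4, ← Real.circleAverage_fun_sub]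
  · congr 1; ext ζ; ring
  · apply ContinuousOn.circleIntegrable zero_le_one
    refine ContinuousOn.mul (ContinuousOn.div (by fun_prop) (by fun_prop) ?_) hcs
    intro ζ hζ
    exact pow_ne_zero _ (hne _ hr ζ hζ)
  · apply ContinuousOn.circleIntegrable zero_le_one
    refine ContinuousOn.mul (ContinuousOn.div (by fun_prop) (by fun_prop) ?_) hcs
    intro ζ hζ
    exact pow_ne_zero _ (hne2 _ (by simp_all))

lemma circleIntegrable_of_bounded {E : Type*} [NormedAddCommGroup E] {g : ℂ → E} {C : ℝ}
    (hm : AEStronglyMeasurable (fun θ => g (circleMap 0 1 θ)) (volume.restrict (Ioc 0 (2 * π))))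
    (hC : ∀ ζ ∈ sphere (0:ℂ) 1, ‖g ζ‖ ≤ C) : CircleIntegrable g 0 1 := by
  rw [CircleIntegrable, intervalIntegrable_iff, uIoc_of_le (by positivity)]
  exact Integrable.of_bound hm C (Eventually.of_forall fun θ => hC _ (by simp))

lemma tendsto_deriv_zero_of_circle {F : ℂ → ℂ} (hF : DiffContOnCl ℂ F (ball 0 1)) {M : ℝ}
    (hM : ∀ ζ ∈ sphere (0:ℂ) 1, ‖F ζ‖ ≤ M * ‖ζ - 1‖)
    (hlim : ∀ ε > 0, ∃ η > 0, ∀ ζ ∈ sphere (0:ℂ) 1, ‖ζ - 1‖ < η → ‖F ζ‖ ≤ ε * ‖ζ - 1‖) :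
    Tendsto (fun r : ℝ => deriv F r) (𝓝[<] 1) (𝓝 0) := by
  set h : ℂ → ℝ := fun ζ => ‖F ζ‖ / ‖ζ - 1‖
  have hM' : ∀ ζ ∈ sphere (0:ℂ) 1, h ζ ≤ max M 0 := by
    intro ζ hζ
    rcases eq_or_ne ζ 1 with rfl | hne
    · simp [h]
    · have : 0 < ‖ζ - 1‖ := norm_pos_iff.2 (sub_ne_zero.2 hne)
      exact (div_le_of_le_mul₀ this.le (by positivity) ((hM ζ hζ).trans (by gcongr; simp)))
  have ht := tendsto_circleAverage_poissonKernel_mul (h := h) (M := max M 0)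
    (fun ζ _ => by positivity) hM' (by
      intro ε hε
      obtain ⟨η, hη, hh⟩ := hlim ε hε
      refine ⟨η, hη, fun ζ hζ hd => ?_⟩
      exact div_le_of_le_mul₀ (norm_nonneg _) hε.le (hh ζ hζ hd))
  have ht' := ht.const_mul 10
  rw [mul_zero] at ht'
  apply squeeze_zero_norm' _ ht'
  filter_upwards [eventually_pos_lt_one] with r hr
  rw [deriv_eq_circleAverage hF hr.1 hr.2]
  have hw := ofReal_mem_ball hr.1 hr.2
  refine (norm_circleAverage_le _ _ _).trans ?_
  rw [← smul_eq_mul, ← Real.circleAverage_fun_smul]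
  have hm : ∀ ζ ∈ sphere (0:ℂ) 1,
      ‖(ζ / (ζ - r) ^ 2 - r ^ 2 * ζ / (r * ζ - 1) ^ 2) * F ζ‖ ≤
          (10:ℝ) • (poissonKernel 0 r ζ * h ζ) := by
    intro ζ hζ
    rcases eq_or_ne ζ 1 with rfl | hne
    · have := hM 1 hζ
      simp at this
      simp [this, h]
    · have h1 : 0 < ‖ζ - 1‖ := norm_pos_iff.2 (sub_ne_zero.2 hne)
      have h2 := norm_derivKernel_mul_le (ζ := ζ) (by simpa using hζ) hr.1 hr.2
      have h3 : ‖F ζ‖ = ‖ζ - 1‖ * h ζ := by simp only [h]; field_simp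
      rw [norm_mul, h3, ← mul_assoc]
      have : 0 ≤ h ζ := by positivity
      calc _ ≤ 10 * poissonKernel 0 r ζ * h ζ := by gcongr
        _ = _ := by simp; ring
  have hcs := hF.continuousOn_sphere
  by_cases hi : CircleIntegrable (fun ζ => (10:ℝ) • (poissonKernel 0 r ζ * h ζ)) 0 1
  · refine (Real.circleAverage_mono ?_ hi fun ζ hζ => hm ζ (by simpa using hζ)).trans_eq ?_
    · apply ContinuousOn.circleIntegrable zero_le_one
      apply ContinuousOn.norm
      refine ContinuousOn.mul (ContinuousOn.sub (ContinuousOn.div (by fun_prop) (by fun_prop) ?_)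
        (ContinuousOn.div (by fun_prop) (by fun_prop) ?_)) hcs
      · intro ζ hζ
        have := one_sub_le_norm_sub (ζ := ζ) (by simpa using hζ) hr.1
        exact pow_ne_zero _ (norm_pos_iff.1 (by linarith [hr.2]))
      · intro ζ hζ
        have := one_sub_le_norm_sub (ζ := ζ) (by simpa using hζ) hr.1
        rw [← norm_sub_real_eq (by simpa using hζ)] at this
        exact pow_ne_zero _ (norm_pos_iff.1 (by linarith [hr.2]))
    · simp
  · exfalso
    apply hi
    have hh : CircleIntegrable h 0 1 := by
      refine circleIntegrable_of_bounded (C := max M 0) (Measurable.aestronglyMeasurable ?_) ?_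
      · apply Measurable.div
        · exact ((hcs.comp_continuous (continuous_circleMap 0 1) fun θ => by simp).norm).measurable
        · fun_prop
      · intro ζ hζ
        rw [Real.norm_of_nonneg (by positivity)]
        exact hM' ζ hζ
    have := (hh.continuousOn_smul
      (by simpa using continuousOn_poissonKernel_sphere hw)).const_smul (a := (10:ℝ))
    exact this

lemma tendsto_deriv_of_circle {F : ℂ → ℂ} (hF : DiffContOnCl ℂ F (ball 0 1)) {M : ℝ} {L : ℂ}
    (hM : ∀ ζ ∈ sphere (0:ℂ) 1, ‖F ζ - F 1 - L * (ζ - 1)‖ ≤ M * ‖ζ - 1‖)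
    (hlim : ∀ ε > 0, ∃ η > 0, ∀ ζ ∈ sphere (0:ℂ) 1, ‖ζ - 1‖ < η →
      ‖F ζ - F 1 - L * (ζ - 1)‖ ≤ ε * ‖ζ - 1‖) :
    Tendsto (fun r : ℝ => deriv F r) (𝓝[<] 1) (𝓝 L) := by
  have h1 : DiffContOnCl ℂ (fun z => F z - F 1 - L * (z - 1)) (ball 0 1) :=
    (hF.sub_const _).sub (Differentiable.diffContOnCl (by fun_prop))
  have h := (tendsto_deriv_zero_of_circle h1 hM hlim).add_const L
  rw [zero_add] at h
  refine h.congr' ?_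
  filter_upwards [eventually_pos_lt_one] with r hr
  have hw := ofReal_mem_ball hr.1 hr.2
  have d : HasDerivAt (fun z => F z - F 1 - L * (z - 1)) (deriv F r - L * 1) r :=
    ((hF.differentiableAt isOpen_ball hw).hasDerivAt.sub_const _).sub
      (((hasDerivAt_id _).sub_const _).const_mul L)
  rw [d.deriv]
  ring

/-- Bounded holomorphic functions on the unit disc. -/
def BddHol (f : ℂ → ℂ) : Prop :=
  DifferentiableOn ℂ f (ball (0:ℂ) 1) ∧ ∃ C : ℝ, ∀ z ∈ ball (0:ℂ) 1, ‖f z‖ ≤ C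

/-- `f` has radial limit `L` at `exp (iθ)`. -/
def HasRadialLim (f : ℂ → ℂ) (θ : ℝ) (L : ℂ) : Prop :=
  Tendsto (fun r : ℝ => f ((r : ℂ) * Complex.exp ((θ : ℂ) * Complex.I))) (𝓝[<] (1:ℝ)) (𝓝 L)

lemma arg_isBigO_sub_one : (fun ζ : ℂ => (arg ζ : ℝ)) =O[𝓝 1] fun ζ : ℂ => ζ - 1 := by
  have h := (Complex.hasDerivAt_log (z := 1) (by simp [slitPlane])).isBigO_sub
  rw [Complex.log_one] at h
  refine (Asymptotics.IsBigO.of_bound 1 (Eventually.of_forall fun ζ => ?_)).trans h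
  rw [one_mul, sub_zero, ← log_im]
  exact abs_im_le_norm _

lemma hasRadialLim_of_differentiableAt {f G : ℂ → ℂ} {M : NNReal} (hG : LipschitzWith M G)
    (hd : ∀ z ∈ ball (0:ℂ) 1, HasDerivAt G (f z) z) {θ : ℝ}
    (hθ : DifferentiableAt ℝ (fun t : ℝ => G (exp (t * I))) θ) :
    ∃ L, HasRadialLim f θ L := by
  set e := exp (θ * I)
  have he : ‖e‖ = 1 := norm_exp_ofReal_mul_I θ
  set F : ℂ → ℂ := fun z => G (z * e)
  have hmem : ∀ z ∈ ball (0:ℂ) 1, z * e ∈ ball (0:ℂ) 1 := by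
    intro z hz
    simpa [he] using hz
  have hFd : ∀ z ∈ ball (0:ℂ) 1, HasDerivAt F (f (z * e) * e) z := by
    intro z hz
    exact (hd _ (hmem z hz)).comp z (hasDerivAt_mul_const e)
  have hFc : Continuous F := hG.continuous.comp (by fun_prop)
  have hF : DiffContOnCl ℂ F (ball 0 1) :=
    ⟨fun z hz => (hFd z hz).differentiableAt.differentiableWithinAt, hFc.continuousOn⟩
  obtain ⟨D, hD⟩ : ∃ D, HasDerivAt (fun t : ℝ => G (exp (t * I))) D θ := ⟨_, hθ.hasDerivAt⟩
  have hD' : HasDerivAt (fun t : ℝ => F (exp (t * I))) D 0 := by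
    have h0 : HasDerivAt (fun t : ℝ => t + θ) 1 0 := (hasDerivAt_id _).add_const _
    have := HasDerivAt.scomp (g₁ := fun t : ℝ => G (exp (t * I))) (h := fun t : ℝ => t + θ) (0:ℝ)
      (by simpa using hD) h0
    rw [one_smul] at this
    refine this.congr_of_eventuallyEq (Eventually.of_forall fun t => ?_)
    simp only [F, e, Function.comp]
    rw [← exp_add]
    push_cast
    ring_nf
  set L := D / I
  have hq : HasDerivAt (fun t : ℝ => F (exp (t * I)) - F 1 - L * (exp (t * I) - 1)) 0 0 := by
    have h1 : HasDerivAt (fun t : ℝ => exp (t * I)) I 0 := by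
      have := ((Complex.ofRealCLM.hasDerivAt (x := (0:ℝ))).mul_const I).cexp
      simpa using this
    have := (hD'.sub_const (F 1)).sub ((h1.sub_const 1).const_mul L)
    have e0 : D - L * I = 0 := by rw [div_mul_cancel₀ _ I_ne_zero, sub_self]
    rw [e0] at this
    exact this
  have ho : (fun ζ : ℂ => F (exp (arg ζ * I)) - F 1 - L * (exp (arg ζ * I) - 1))
      =o[𝓝 1] fun ζ => ζ - 1 := by
    have h1 := hq.isLittleO
    simp only [ofReal_zero, zero_mul, exp_zero, sub_self, mul_zero, sub_zero, smul_zero] at h1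
    have hc : Tendsto arg (𝓝 1) (𝓝 0) := by
      have := (continuousAt_arg (x := 1) (by simp [slitPlane])).tendsto
      rwa [arg_one] at this
    exact (h1.comp_tendsto hc).trans_isBigO arg_isBigO_sub_one
  have hexp : ∀ ζ ∈ sphere (0:ℂ) 1, exp (arg ζ * I) = ζ := by
    intro ζ hζ
    have := norm_mul_exp_arg_mul_I ζ
    rwa [mem_sphere_zero_iff_norm.1 hζ, ofReal_one, one_mul] at this
  have hlim := tendsto_deriv_of_circle hF (M := M + ‖L‖) (L := L) (by
      intro ζ hζ
      calc ‖F ζ - F 1 - L * (ζ - 1)‖ ≤ ‖F ζ - F 1‖ + ‖L * (ζ - 1)‖ := norm_sub_le _ _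
        _ ≤ M * ‖ζ - 1‖ + ‖L‖ * ‖ζ - 1‖ := by
          rw [norm_mul]
          gcongr
          calc ‖F ζ - F 1‖ ≤ M * ‖ζ * e - 1 * e‖ := hG.norm_sub_le _ _
            _ = M * ‖ζ - 1‖ := by rw [← sub_mul, norm_mul, he, mul_one]
        _ = _ := by ring) (by
      intro ε hε
      have := ho.def hε
      rw [Metric.eventually_nhds_iff] at this
      obtain ⟨η, hη, h⟩ := this
      refine ⟨η, hη, fun ζ hζ hd => ?_⟩
      have := h (by rwa [dist_eq_norm] : dist ζ 1 < η)
      rwa [hexp ζ hζ] at this)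
  refine ⟨L / e, ?_⟩
  have he0 : e ≠ 0 := exp_ne_zero _
  refine (hlim.div_const e).congr' ?_
  filter_upwards [eventually_pos_lt_one] with r hr
  rw [(hFd _ (ofReal_mem_ball hr.1 hr.2)).deriv]
  field_simp
  rfl

/-- **Fatou's theorem** on radial limits. -/
theorem BddHol.ae_hasRadialLim {f : ℂ → ℂ} (hf : BddHol f) :
    ∀ᵐ θ : ℝ, ∃ L, HasRadialLim f θ L := by
  obtain ⟨hd, C, hC⟩ := hf
  obtain ⟨F, hF⟩ := hd.isExactOn_ball
  have hC0 : 0 ≤ C := (norm_nonneg _).trans (hC 0 (by simp))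
  have hL : LipschitzOnWith ⟨C, hC0⟩ F (ball 0 1) := by
    apply (convex_ball (0:ℂ) 1).lipschitzOnWith_of_nnnorm_hasDerivWithin_le (f' := f)
    · exact fun z hz => (hF z hz).hasDerivWithinAt
    · exact fun z hz => hC z hz
  obtain ⟨G, hG, hFG⟩ := hL.extend_finite_dimension
  have hGd : ∀ z ∈ ball (0:ℂ) 1, HasDerivAt G (f z) z := by
    intro z hz
    refine (hF z hz).congr_of_eventuallyEq ?_
    filter_upwards [isOpen_ball.mem_nhds hz] with w hw
    exact (hFG hw).symm
  have he : LipschitzWith 1 (fun t : ℝ => exp (t * I)) := by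
    apply lipschitzWith_of_nnnorm_deriv_le
    · fun_prop
    · intro t
      have h := ((Complex.ofRealCLM.hasDerivAt (x := t)).mul_const I).cexp
      simp only [ofRealCLM_apply] at h
      rw [h.deriv, ← NNReal.coe_le_coe]
      simp
  filter_upwards [(hG.comp he).ae_differentiableAt] with θ hθ
  exact hasRadialLim_of_differentiableAt hG hGd hθ

/-- Lebesgue measure on `(0, 2π]`, parametrising the unit circle. -/
noncomputable abbrev circMeas : Measure ℝ := volume.restrict (Ioc (0:ℝ) (2 * π))

/-- The radial boundary value of `f` at `exp (iθ)`. -/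
noncomputable def bv (f : ℂ → ℂ) (θ : ℝ) : ℂ :=
  limUnder (𝓝[<] (1:ℝ)) fun r : ℝ => f ((r : ℂ) * Complex.exp ((θ : ℂ) * Complex.I))

lemma HasRadialLim.bv_eq {f : ℂ → ℂ} {θ : ℝ} {L : ℂ} (h : HasRadialLim f θ L) : bv f θ = L :=
  Tendsto.limUnder_eq h

lemma mul_exp_mem_ball {r : ℝ} (hr : 0 < r ∧ r < 1) (θ : ℝ) :
    (r : ℂ) * exp (θ * I) ∈ ball (0:ℂ) 1 := by
  simp [abs_of_pos hr.1, hr.2]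

lemma eventually_mul_exp_mem_ball (θ : ℝ) :
    ∀ᶠ r : ℝ in 𝓝[<] 1, (r : ℂ) * exp (θ * I) ∈ ball (0:ℂ) 1 := by
  filter_upwards [eventually_pos_lt_one] with r hr using mul_exp_mem_ball hr θ

lemma HasRadialLim.norm_le {f : ℂ → ℂ} {θ : ℝ} {L : ℂ} (h : HasRadialLim f θ L) {C : ℝ}
    (hC : ∀ z ∈ ball (0:ℂ) 1, ‖f z‖ ≤ C) : ‖L‖ ≤ C := by
  refine le_of_tendsto h.norm ?_
  filter_upwards [eventually_mul_exp_mem_ball θ] with r hr using hC _ hr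

lemma HasRadialLim.congr {f g : ℂ → ℂ} {θ : ℝ} {L : ℂ} (h : HasRadialLim f θ L)
    (hfg : EqOn f g (ball 0 1)) : HasRadialLim g θ L := by
  refine Tendsto.congr' ?_ h
  filter_upwards [eventually_mul_exp_mem_ball θ] with r hr using hfg hr

namespace BddHol
variable {f g : ℂ → ℂ}

lemma bv_lim (hf : BddHol f) : ∀ᵐ θ ∂circMeas, HasRadialLim f θ (bv f θ) := by
  refine ae_restrict_of_ae ?_
  filter_upwards [hf.ae_hasRadialLim] with θ ⟨L, hL⟩
  rwa [hL.bv_eq]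

lemma const (c : ℂ) : BddHol fun _ => c :=
  ⟨differentiableOn_const _, ‖c‖, fun _ _ => le_rfl⟩

lemma add (hf : BddHol f) (hg : BddHol g) : BddHol fun z => f z + g z := by
  obtain ⟨hf, C, hC⟩ := hf
  obtain ⟨hg, D, hD⟩ := hg
  exact ⟨hf.add hg, C + D, fun z hz => (norm_add_le _ _).trans (add_le_add (hC z hz) (hD z hz))⟩

lemma mul (hf : BddHol f) (hg : BddHol g) : BddHol fun z => f z * g z := by
  obtain ⟨hf, C, hC⟩ := hf
  obtain ⟨hg, D, hD⟩ := hg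
  refine ⟨hf.mul hg, C * D, fun z hz => ?_⟩
  rw [norm_mul]
  exact mul_le_mul (hC z hz) (hD z hz) (norm_nonneg _) ((norm_nonneg _).trans (hC z hz))

lemma const_mul (c : ℂ) (hf : BddHol f) : BddHol fun z => c * f z := (const c).mul hf

lemma sub (hf : BddHol f) (hg : BddHol g) : BddHol fun z => f z - g z := by
  simpa [sub_eq_add_neg] using hf.add (hg.const_mul (-1))

lemma bv_add (hf : BddHol f) (hg : BddHol g) :
    ∀ᵐ θ ∂circMeas, bv (fun z => f z + g z) θ = bv f θ + bv g θ := by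
  filter_upwards [hf.bv_lim, hg.bv_lim] with θ h1 h2
  exact HasRadialLim.bv_eq (Tendsto.add h1 h2)

lemma bv_mul (hf : BddHol f) (hg : BddHol g) :
    ∀ᵐ θ ∂circMeas, bv (fun z => f z * g z) θ = bv f θ * bv g θ := by
  filter_upwards [hf.bv_lim, hg.bv_lim] with θ h1 h2
  exact HasRadialLim.bv_eq (Tendsto.mul h1 h2)

lemma bv_sub (hf : BddHol f) (hg : BddHol g) :
    ∀ᵐ θ ∂circMeas, bv (fun z => f z - g z) θ = bv f θ - bv g θ := by
  filter_upwards [hf.bv_lim, hg.bv_lim] with θ h1 h2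
  exact HasRadialLim.bv_eq (Tendsto.sub h1 h2)

lemma _root_.bv_const (c : ℂ) (θ : ℝ) : bv (fun _ => c) θ = c :=
  HasRadialLim.bv_eq tendsto_const_nhds

lemma bv_const_mul (c : ℂ) (hf : BddHol f) :
    ∀ᵐ θ ∂circMeas, bv (fun z => c * f z) θ = c * bv f θ := by
  filter_upwards [(const c).bv_mul hf] with θ h
  rw [h, bv_const]

lemma norm_bv_le (hf : BddHol f) {C : ℝ} (hC : ∀ z ∈ ball (0:ℂ) 1, ‖f z‖ ≤ C) :
    ∀ᵐ θ ∂circMeas, ‖bv f θ‖ ≤ C := by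
  filter_upwards [hf.bv_lim] with θ h using h.norm_le hC

end BddHol

/-- A sequence of radii increasing to one. -/
noncomputable def radiusSeq (n : ℕ) : ℝ := 1 - 1 / (n + 2)

lemma radiusSeq_mem (n : ℕ) : 0 < radiusSeq n ∧ radiusSeq n < 1 := by
  unfold radiusSeq
  have h : (0:ℝ) < n + 2 := by positivity
  constructor
  · rw [sub_pos, div_lt_one h]
    have : (0:ℝ) ≤ n := by positivity
    linarith
  · have : 0 < 1 / ((n:ℝ) + 2) := by positivity
    linarith

lemma tendsto_radiusSeq : Tendsto radiusSeq atTop (𝓝[<] 1) := by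
  refine tendsto_nhdsWithin_iff.2 ⟨?_, Eventually.of_forall fun n => (radiusSeq_mem n).2⟩
  have h : Tendsto (fun n : ℕ => 1 / ((n:ℝ) + 2)) atTop (𝓝 0) :=
    tendsto_const_nhds.div_atTop (tendsto_atTop_add_const_right _ _ tendsto_natCast_atTop_atTop)
  have h2 := h.const_sub 1
  rwa [sub_zero] at h2

lemma DifferentiableOn.comp_mul_of_lt_one {f : ℂ → ℂ} (hf : DifferentiableOn ℂ f (ball 0 1))
    {r : ℝ} (hr : 0 < r ∧ r < 1) : DiffContOnCl ℂ (fun z => f (r * z)) (ball 0 1) := by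
  apply DifferentiableOn.diffContOnCl
  rw [closure_ball _ one_ne_zero]
  refine hf.comp (by fun_prop) ?_
  intro z hz
  simp only [mem_closedBall_zero_iff, mem_ball_zero_iff, norm_mul, norm_real] at hz ⊢
  rw [Real.norm_of_nonneg hr.1.le]
  nlinarith [norm_nonneg z]

lemma DifferentiableOn.continuous_circle {f : ℂ → ℂ} (hf : DifferentiableOn ℂ f (ball 0 1))
    {r : ℝ} (hr : 0 < r ∧ r < 1) :
        Continuous fun θ : ℝ => f ((r : ℂ) * Complex.exp ((θ : ℂ) * Complex.I)) := by
  have h := (hf.comp_mul_of_lt_one hr).continuousOn_sphere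
  exact h.comp_continuous (f := fun θ : ℝ => Complex.exp (θ * I))
    (by fun_prop) (by simp)

lemma BddHol.aestronglyMeasurable_bv {f : ℂ → ℂ} (hf : BddHol f) :
    AEStronglyMeasurable (bv f) circMeas := by
  refine aestronglyMeasurable_of_tendsto_ae (u := atTop)
    (f := fun n (θ : ℝ) => f (radiusSeq n * exp (θ * I))) ?_ ?_
  · exact fun n => (hf.1.continuous_circle (radiusSeq_mem n)).aestronglyMeasurable
  · filter_upwards [hf.bv_lim] with θ h
    exact h.comp tendsto_radiusSeq

lemma circleAverage_eq_circMeas {E : Type*} [NormedAddCommGroup E] [NormedSpace ℝ E] (f : ℂ → E) :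
    Real.circleAverage f 0 1 = (2 * π)⁻¹ • ∫ θ : ℝ, f (exp (θ * I)) ∂circMeas := by
  rw [Real.circleAverage_def, intervalIntegral.integral_of_le (by positivity)]
  simp [circleMap_zero]

lemma continuous_poissonKernel_circle {w : ℂ} (hw : w ∈ ball (0:ℂ) 1) :
    Continuous fun θ : ℝ => poissonKernel 0 w (exp (θ * I)) :=
  (continuousOn_poissonKernel_sphere hw).comp_continuous (f := fun θ : ℝ => exp (θ * I))
    (by fun_prop) (by simp)

lemma integrable_circMeas_of_continuous {E : Type*} [NormedAddCommGroup E] {g : ℝ → E}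
    (hg : Continuous g) : Integrable g circMeas :=
  (hg.integrableOn_Icc (a := 0) (b := 2 * π)).mono_set Ioc_subset_Icc_self

/-- Poisson representation of a bounded holomorphic function by its boundary values. -/
lemma BddHol.poisson_bv {f : ℂ → ℂ} (hf : BddHol f) {w : ℂ} (hw : w ∈ ball (0:ℂ) 1) :
    f w = (2 * π)⁻¹ • ∫ θ : ℝ, poissonKernel 0 w (exp (θ * I)) • bv f θ ∂circMeas := by
  obtain ⟨C, hC⟩ := hf.2
  have h1 : Tendsto (fun n => ∫ θ : ℝ, poissonKernel 0 w (exp (θ * I)) •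
      f (radiusSeq n * exp (θ * I)) ∂circMeas) atTop
      (𝓝 (∫ θ : ℝ, poissonKernel 0 w (exp (θ * I)) • bv f θ ∂circMeas)) := by
    refine tendsto_integral_of_dominated_convergence
      (fun θ : ℝ => ‖poissonKernel 0 w (exp (θ * I))‖ * C) ?_ ?_ ?_ ?_
    · exact fun n => ((continuous_poissonKernel_circle hw).smul
        (hf.1.continuous_circle (radiusSeq_mem n))).aestronglyMeasurable
    · exact integrable_circMeas_of_continuous
        ((continuous_poissonKernel_circle hw).norm.mul continuous_const)
    · intro n
      refine Eventually.of_forall fun θ => ?_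
      rw [norm_smul]
      gcongr
      exact hC _ (mul_exp_mem_ball (radiusSeq_mem n) θ)
    · filter_upwards [hf.bv_lim] with θ h
      exact (h.comp tendsto_radiusSeq).const_smul _
  have h2 : Tendsto (fun n => f (radiusSeq n * w)) atTop (𝓝 (f w)) := by
    have hc : ContinuousAt f w := (hf.1.differentiableAt (isOpen_ball.mem_nhds hw)).continuousAt
    have : Tendsto (fun n => (radiusSeq n : ℂ) * w) atTop (𝓝 w) := by
      have := ((continuous_ofReal.tendsto 1).comp
        (tendsto_radiusSeq.mono_right nhdsWithin_le_nhds)).mul_const w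
      simpa using this
    exact hc.tendsto.comp this
  refine tendsto_nhds_unique h2 ((h1.const_smul (2 * π)⁻¹).congr fun n => ?_)
  rw [← circleAverage_eq_circMeas fun ζ => poissonKernel 0 w ζ • f (radiusSeq n * ζ)]
  exact (hf.1.comp_mul_of_lt_one (radiusSeq_mem n)).circleAverage_poissonKernel_smul hw

lemma integral_poissonKernel {w : ℂ} (hw : w ∈ ball (0:ℂ) 1) :
    (2 * π)⁻¹ * ∫ θ : ℝ, poissonKernel 0 w (exp (θ * I)) ∂circMeas = 1 := by
  rw [← smul_eq_mul, ← circleAverage_eq_circMeas, circleAverage_poissonKernel hw]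

/-- Maximum principle in terms of radial boundary values. -/
lemma BddHol.norm_le_of_bv {f : ℂ → ℂ} (hf : BddHol f) {M : ℝ}
    (hM : ∀ᵐ θ ∂circMeas, ‖bv f θ‖ ≤ M) {w : ℂ} (hw : w ∈ ball (0:ℂ) 1) : ‖f w‖ ≤ M := by
  rw [hf.poisson_bv hw, norm_smul, Real.norm_of_nonneg (by positivity)]
  calc _ ≤ (2 * π)⁻¹ * ∫ θ : ℝ, poissonKernel 0 w (exp (θ * I)) * M ∂circMeas := by
        gcongr
        refine norm_integral_le_of_norm_le (integrable_circMeas_of_continuous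
          ((continuous_poissonKernel_circle hw).mul continuous_const)) ?_
        filter_upwards [hM] with θ h
        have hp : 0 ≤ poissonKernel 0 w (exp (θ * I)) :=
          poissonKernel_nonneg_of_circle hw (by simp)
        rw [norm_smul, Real.norm_of_nonneg hp]
        gcongr
    _ = M := by rw [integral_mul_const, ← mul_assoc, integral_poissonKernel hw, one_mul]

namespace IsInner
variable {φ ψ : ℂ → ℂ}

lemma bddHol (h : IsInner φ) : BddHol φ := ⟨h.1, h.2.1⟩

lemma norm_bv (h : IsInner φ) : ∀ᵐ θ ∂circMeas, ‖bv φ θ‖ = 1 := by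
  filter_upwards [h.2.2] with θ ⟨L, hL, hl⟩
  rwa [HasRadialLim.bv_eq hl]

lemma _root_.BddHol.isInner (h : BddHol φ) (hb : ∀ᵐ θ ∂circMeas, ‖bv φ θ‖ = 1) : IsInner φ := by
  refine ⟨h.1, h.2, ?_⟩
  filter_upwards [hb, h.bv_lim] with θ h1 h2 using ⟨_, h1, h2⟩

lemma norm_le_one (h : IsInner φ) {z : ℂ} (hz : z ∈ ball (0:ℂ) 1) : ‖φ z‖ ≤ 1 :=
  h.bddHol.norm_le_of_bv (by filter_upwards [h.norm_bv] with θ h using h.le) hz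

lemma mul (h : IsInner φ) (h' : IsInner ψ) : IsInner fun z => φ z * ψ z := by
  refine (h.bddHol.mul h'.bddHol).isInner ?_
  filter_upwards [h.norm_bv, h'.norm_bv, h.bddHol.bv_mul h'.bddHol] with θ h1 h2 h3
  rw [h3, norm_mul, h1, h2, one_mul]

lemma const {c : ℂ} (hc : ‖c‖ = 1) : IsInner fun _ => c := by
  refine (BddHol.const c).isInner (Eventually.of_forall fun θ => ?_)
  rwa [bv_const]

end IsInner

lemma circleAverage_eq_integral_neg_pi {E : Type*} [NormedAddCommGroup E] [NormedSpace ℝ E]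
    (f : ℂ → E) (η : ℝ) :
    Real.circleAverage f 0 1 = (2 * π)⁻¹ • ∫ t in (-π)..π, f (exp ((t + η : ℝ) * I)) := by
  rw [Real.circleAverage_eq_integral_add (η - π)]
  congr 1
  have := intervalIntegral.integral_comp_add_right (a := 0) (b := 2 * π)
    (fun t : ℝ => f (exp ((t + η : ℝ) * I))) (-π)
  rw [show (0:ℝ) + -π = -π by ring, show 2 * π + -π = π by ring] at this
  rw [← this]
  congr 1
  ext t
  rw [circleMap_zero]
  congr 1
  push_cast
  ring_nf

lemma poissonKernel_exp (r t : ℝ) :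
    poissonKernel 0 r (exp (t * I)) = (1 - r ^ 2) / (1 - 2 * r * Real.cos t + r ^ 2) := by
  rw [poissonKernel_def]
  simp only [sub_zero, norm_exp_ofReal_mul_I, norm_real, Real.norm_eq_abs, sq_abs, one_pow]
  congr 1
  rw [← normSq_eq_norm_sq, normSq_apply]
  simp [exp_ofReal_mul_I_re, exp_ofReal_mul_I_im]
  linear_combination Real.sin_sq_add_cos_sq t

lemma poissonDenom_pos {r : ℝ} (hr : 0 < r ∧ r < 1) (t : ℝ) :
    0 < 1 - 2 * r * Real.cos t + r ^ 2 := by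
  have := Real.cos_le_one t
  nlinarith [hr.1, hr.2]

lemma hasDerivAt_poissonKernel_exp {r : ℝ} (hr : 0 < r ∧ r < 1) (t : ℝ) :
    HasDerivAt (fun t : ℝ => poissonKernel 0 r (exp (t * I)))
      (-(poissonKernel 0 r (exp (t * I)) *
        (2 * r * Real.sin t / (1 - 2 * r * Real.cos t + r ^ 2)))) t := by
  simp only [poissonKernel_exp]
  have hN := (poissonDenom_pos hr t).ne'
  have h := (((Real.hasDerivAt_cos t).const_mul (2 * r)).const_sub 1).add_const (r ^ 2)
  have h2 := (hasDerivAt_const t (1 - r ^ 2)).div h hN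
  refine h2.congr_deriv ?_
  field_simp
  ring

lemma abs_deriv_poissonKernel_le {r : ℝ} (hr : 0 < r ∧ r < 1) {t : ℝ} (ht : |t| ≤ π) :
    |2 * r * Real.sin t / (1 - 2 * r * Real.cos t + r ^ 2)| * |t| ≤ 5 := by
  have hN := poissonDenom_pos hr t
  have h1 := Real.cos_le_one_sub_mul_cos_sq ht
  rw [abs_div, abs_of_pos hN, div_mul_eq_mul_div, div_le_iff₀ hN, abs_mul,
    abs_of_pos (by linarith [hr.1])]
  have h2 : |Real.sin t| * |t| ≤ t ^ 2 := by
    have := mul_le_mul_of_nonneg_right (Real.abs_sin_le_abs (x := t)) (abs_nonneg t)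
    nlinarith [abs_mul_abs_self t]
  have h3 : 1 / 5 * t ^ 2 ≤ 2 / π ^ 2 * t ^ 2 := by
    have : 1 / 5 ≤ 2 / π ^ 2 := by
      rw [div_le_div_iff₀ (by norm_num) (by positivity)]
      nlinarith [Real.pi_lt_d2, Real.pi_pos]
    gcongr
  have h4 : 0 ≤ (1 - r) ^ 2 := by positivity
  have := hr.1
  nlinarith [mul_nonneg hr.1.le (sub_nonneg.2 h2), mul_nonneg hr.1.le (sub_nonneg.2 h3),
    mul_nonneg hr.1.le (sub_nonneg.2 h1)]

/-- Poisson averages tend to zero at a point where the indefinite integral has zero derivative. -/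
lemma tendsto_integral_poissonKernel_mul {k : ℝ → ℝ} {M : ℝ} (hk : Measurable k)
    (hM : ∀ t, |k t| ≤ M) (hd : HasDerivAt (fun u => ∫ t in (0:ℝ)..u, k t) 0 0) :
    Tendsto (fun r : ℝ => ∫ t in (-π)..π, poissonKernel 0 r (exp (t * I)) * k t)
      (𝓝[<] 1) (𝓝 0) := by
  have hloc : LocallyIntegrable k := by
    refine (locallyIntegrable_const M).mono hk.aestronglyMeasurable ?_
    refine Eventually.of_forall fun t => ?_
    rw [Real.norm_eq_abs, Real.norm_eq_abs]
    exact (hM t).trans (le_abs_self M)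
  have hII : ∀ a b : ℝ, IntervalIntegrable k volume a b := fun a b =>
    intervalIntegrable_iff.2 ((hloc.integrableOn_isCompact isCompact_uIcc).mono_set
      uIoc_subset_uIcc)
  set G : ℝ → ℝ := fun u => ∫ t in (0:ℝ)..u, k t with hG
  have hGle : ∀ u, |G u| ≤ M * |u| := by
    intro u
    have := intervalIntegral.norm_integral_le_of_norm_le_const (a := 0) (b := u) (f := k) (C := M)
      (fun t _ => hM t)
    simpa using this
  have hM0 : 0 ≤ M := (abs_nonneg _).trans (hM 0)
  have hGac : AbsolutelyContinuousOnInterval G (-π) π := by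
    refine (hII (-π) π).absolutelyContinuousOnInterval_intervalIntegral ?_
    rw [uIcc_of_le (by linarith [Real.pi_pos])]
    constructor <;> linarith [Real.pi_pos]
  have hGc : Continuous G := intervalIntegral.continuous_primitive (fun a b => hII a b) 0
  set h : ℂ → ℝ := fun ζ => |G (arg ζ)| / |arg ζ|
  have hh := tendsto_circleAverage_poissonKernel_mul (h := h) (M := M)
    (fun ζ _ => by positivity)
    (fun ζ _ => div_le_of_le_mul₀ (abs_nonneg _) hM0 (hGle _)) (by
      intro ε hε
      have h1 := hd.isLittleO
      have h2 : Tendsto arg (𝓝 1) (𝓝 0) := by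
        have := (continuousAt_arg (x := 1) (by simp [slitPlane])).tendsto
        rwa [arg_one] at this
      have h3 := h2.eventually (h1.def hε)
      rw [Metric.eventually_nhds_iff] at h3
      obtain ⟨η, hη, h3⟩ := h3
      refine ⟨η, hη, fun ζ hζ hd => ?_⟩
      have := h3 (by rwa [dist_eq_norm] : dist ζ 1 < η)
      have hG0 : G 0 = 0 := by simp [G]
      simp only [smul_zero, sub_zero, Real.norm_eq_abs, hG0] at this
      exact div_le_of_le_mul₀ (abs_nonneg _) hε.le this)
  have hb : Tendsto (fun r : ℝ => (1 - r) / (1 + r) * (2 * (M * π))) (𝓝[<] 1) (𝓝 0) := by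
    have : Tendsto (fun r : ℝ => (1 - r) / (1 + r) * (2 * (M * π))) (𝓝 1)
        (𝓝 ((1 - 1) / (1 + 1) * (2 * (M * π)))) := by
      apply ContinuousAt.tendsto
      apply ContinuousAt.mul _ continuousAt_const
      exact ContinuousAt.div (by fun_prop) (by fun_prop) (by norm_num)
    norm_num at this
    exact this.mono_left nhdsWithin_le_nhds
  have hsum := hb.add (hh.const_mul (5 * (2 * π)))
  rw [mul_zero, add_zero] at hsum
  refine squeeze_zero_norm' ?_ hsum
  filter_upwards [eventually_pos_lt_one] with r hr
  have hw := ofReal_mem_ball hr.1 hr.2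
  set p : ℝ → ℝ := fun t => poissonKernel 0 r (exp (t * I)) with hp
  have hpc : Continuous p := continuous_poissonKernel_circle hw
  have hp0 : ∀ t, 0 ≤ p t := fun t => poissonKernel_nonneg_of_circle hw (by simp)
  have hpd : deriv p = fun t =>
      -(p t * (2 * r * Real.sin t / (1 - 2 * r * Real.cos t + r ^ 2))) := by
    ext t
    exact (hasDerivAt_poissonKernel_exp hr t).deriv
  have hdc : Continuous (deriv p) := by
    rw [hpd]
    refine (hpc.mul (Continuous.div (by fun_prop) (by fun_prop) ?_)).neg
    exact fun t => (poissonDenom_pos hr t).ne'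
  have hpac : AbsolutelyContinuousOnInterval p (-π) π := by
    apply ContDiffOn.absolutelyContinuousOnInterval
    apply ContDiff.contDiffOn
    rw [contDiff_one_iff_deriv]
    exact ⟨fun t => (hasDerivAt_poissonKernel_exp hr t).differentiableAt, hdc⟩
  have hpi : (-π) ≤ π := by linarith [Real.pi_pos]
  have e1 : ∫ t in (-π)..π, p t * k t = ∫ t in (-π)..π, p t * deriv G t := by
    apply intervalIntegral.integral_congr_ae
    filter_upwards [LocallyIntegrable.ae_hasDerivAt_integral hloc] with t ht _
    rw [(ht 0).deriv]
  have e2 := hpac.integral_mul_deriv_eq_deriv_mul hGac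
  have pv : p π = (1 - r) / (1 + r) := by
    rw [hp]
    simp only
    rw [poissonKernel_exp, Real.cos_pi, div_eq_div_iff (by nlinarith [hr.1]) (by linarith [hr.1])]
    ring
  have pv' : p (-π) = (1 - r) / (1 + r) := by
    rw [← pv, hp]
    simp only
    rw [poissonKernel_exp, poissonKernel_exp, Real.cos_neg]
  have hr0 : 0 ≤ (1 - r) / (1 + r) := div_nonneg (by linarith [hr.2]) (by linarith [hr.1])
  have b1 : |p π * G π - p (-π) * G (-π)| ≤ (1 - r) / (1 + r) * (2 * (M * π)) := by
    rw [pv, pv', ← mul_sub, abs_mul, abs_of_nonneg hr0]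
    gcongr
    have i1 := hGle π
    have i2 := hGle (-π)
    rw [abs_neg, abs_of_pos Real.pi_pos] at i2
    rw [abs_of_pos Real.pi_pos] at i1
    calc |G π - G (-π)| ≤ |G π| + |G (-π)| := abs_sub _ _
      _ ≤ _ := by linarith
  have hhm : Measurable h := by
    apply Measurable.div
    · exact (hGc.measurable.comp measurable_arg).norm
    · exact measurable_arg.norm
  have hargI : ∀ t ∈ Ioc (-π) π, arg (exp (((t + 0 : ℝ) : ℂ) * I)) = t := by
    intro t ht
    rw [add_zero, arg_exp_mul_I, toIocMod_eq_self]
    simpa [two_mul] using ht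
  have b2 : |∫ t in (-π)..π, deriv p t * G t| ≤
      5 * (2 * π) * Real.circleAverage (fun ζ => poissonKernel 0 r ζ * h ζ) 0 1 := by
    have e3 := circleAverage_eq_integral_neg_pi (fun ζ => poissonKernel 0 r ζ * h ζ) 0
    rw [e3, smul_eq_mul, ← mul_assoc, mul_assoc 5, mul_inv_cancel₀ (by positivity), mul_one,
      ← intervalIntegral.integral_const_mul]
    refine (intervalIntegral.abs_integral_le_integral_abs hpi).trans ?_
    refine intervalIntegral.integral_mono_on_of_le_Ioo hpi ?_ ?_ ?_
    · exact (Continuous.intervalIntegrable (by fun_prop) _ _)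
    · apply IntervalIntegrable.const_mul
      rw [intervalIntegrable_iff, uIoc_of_le hpi]
      refine Integrable.of_bound (C := (1 + r) / (1 - r) * M) ?_ ?_
      · refine Measurable.aestronglyMeasurable ?_
        refine Measurable.mul ?_ ?_
        · exact (hpc.comp (continuous_id.add continuous_const)).measurable
        · exact hhm.comp (by fun_prop)
      · refine Eventually.of_forall fun t => ?_
        have hz : exp (((t + 0 : ℝ) : ℂ) * I) ∈ sphere (0:ℂ) 1 := by
          rw [mem_sphere_zero_iff_norm, norm_exp_ofReal_mul_I]
        have j1 := re_herglotzRieszKernel_le hz hw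
        have j2 := poissonKernel_nonneg_of_circle hw hz
        have j3 : h (exp (((t + 0 : ℝ) : ℂ) * I)) ≤ M :=
          div_le_of_le_mul₀ (abs_nonneg _) hM0 (hGle _)
        have j4 : 0 ≤ h (exp (((t + 0 : ℝ) : ℂ) * I)) := by positivity
        rw [Real.norm_of_nonneg (mul_nonneg j2 j4)]
        refine mul_le_mul ?_ j3 j4 (div_nonneg (by linarith [hr.1]) (by linarith [hr.2]))
        rw [poissonKernel_eq_re_herglotzRieszKernel]
        simpa [herglotzRieszKernel_def, abs_of_pos hr.1] using j1
    · intro t ht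
      have ha := hargI t ⟨ht.1, ht.2.le⟩
      simp only [h, ha]
      rw [hpd, abs_mul, abs_neg, abs_mul, abs_of_nonneg (hp0 t), add_zero]
      rcases eq_or_ne t 0 with rfl | h0
      · have : G 0 = 0 := by simp [G]
        simp [this]
      have ht0 : 0 < |t| := abs_pos.2 h0
      have hq := abs_deriv_poissonKernel_le hr (t := t) (abs_le.2 ⟨ht.1.le, ht.2.le⟩)
      calc _ = p t * (|2 * r * Real.sin t / (1 - 2 * r * Real.cos t + r ^ 2)| * |t|) *
            (|G t| / |t|) := by field_simp
        _ ≤ p t * 5 * (|G t| / |t|) := by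
            gcongr
            exact hp0 t
        _ = _ := by ring
  rw [e1, e2, Real.norm_eq_abs]
  exact (abs_sub _ _).trans (add_le_add b1 b2)

lemma poissonKernel_rotate (r : ℝ) (θ t : ℝ) :
    poissonKernel 0 (r * exp (θ * I)) (exp ((t + θ : ℝ) * I)) =
        poissonKernel 0 r (exp (t * I)) := by
  rw [poissonKernel_def, poissonKernel_def]
  have e : exp ((t + θ : ℝ) * I) = exp (t * I) * exp (θ * I) := by
    rw [← exp_add]; push_cast; ring_nf
  simp only [sub_zero]
  rw [e, ← sub_mul, norm_mul, norm_mul, norm_mul]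
  simp [norm_exp_ofReal_mul_I]

/-- Fatou's theorem for Poisson integrals of bounded measurable functions. -/
lemma ae_tendsto_poisson {g : ℂ → ℝ} {M : ℝ} (hg : Measurable g) (hM : ∀ ζ, |g ζ| ≤ M) :
    ∀ᵐ θ : ℝ, Tendsto (fun r : ℝ => Real.circleAverage
      (fun ζ => poissonKernel 0 (r * exp (θ * I)) ζ * g ζ) 0 1) (𝓝[<] 1) (𝓝 (g (exp (θ * I)))) := by
  set G : ℝ → ℝ := fun t => g (exp (t * I))
  have hGm : Measurable G := hg.comp (by fun_prop)
  have hloc : LocallyIntegrable G := by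
    refine (locallyIntegrable_const M).mono hGm.aestronglyMeasurable ?_
    refine Eventually.of_forall fun t => ?_
    rw [Real.norm_eq_abs, Real.norm_eq_abs]
    exact (hM _).trans (le_abs_self M)
  filter_upwards [LocallyIntegrable.ae_hasDerivAt_integral hloc] with θ hθ
  have hII : ∀ a b : ℝ, IntervalIntegrable G volume a b := fun a b =>
    intervalIntegrable_iff.2 ((hloc.integrableOn_isCompact isCompact_uIcc).mono_set
      uIoc_subset_uIcc)
  have hd : HasDerivAt (fun u => ∫ t in (0:ℝ)..u, (G (t + θ) - G θ)) 0 0 := by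
    have e : (fun u => ∫ t in (0:ℝ)..u, (G (t + θ) - G θ))
        = fun u => (∫ t in θ..(u + θ), G t) - u * G θ := by
      ext u
      rw [intervalIntegral.integral_sub]
      · rw [intervalIntegral.integral_comp_add_right]
        simp
      · simpa using (hII (0 + θ) (u + θ)).comp_add_right θ
      · exact intervalIntegrable_const
    rw [e]
    have h1 : HasDerivAt (fun u : ℝ => ∫ t in θ..(u + θ), G t) (G θ) 0 := by
      have := (hθ θ)
      have h0 : HasDerivAt (fun t : ℝ => t + θ) 1 0 := (hasDerivAt_id _).add_const _
      have h3 := HasDerivAt.scomp (g₁ := fun x => ∫ t in θ..x, G t) (h := fun t : ℝ => t + θ) (0:ℝ)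
        (by simpa using this) h0
      rwa [one_smul] at h3
    have h2 := h1.sub ((hasDerivAt_id (0:ℝ)).mul_const (G θ))
    have e0 : G θ - 1 * G θ = 0 := by ring
    rw [e0] at h2
    exact h2
  have hlim := tendsto_integral_poissonKernel_mul (k := fun t => G (t + θ) - G θ) (M := M + M)
    ((hGm.comp (by fun_prop)).sub_const _)
    (fun t => (abs_sub _ _).trans (add_le_add (hM _) (hM _))) hd
  have hlim2 := (hlim.const_mul (2 * π)⁻¹).add_const (G θ)
  rw [mul_zero, zero_add] at hlim2
  refine hlim2.congr' ?_
  filter_upwards [eventually_pos_lt_one] with r hr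
  have hw := mul_exp_mem_ball hr θ
  have hP := circleAverage_poissonKernel hw
  have hc := continuousOn_poissonKernel_sphere hw
  have hgi : CircleIntegrable g 0 1 := by
    refine circleIntegrable_of_bounded (C := M) ?_ fun ζ _ => hM ζ
    exact (hg.comp (continuous_circleMap 0 1).measurable).aestronglyMeasurable
  have hi : CircleIntegrable (fun ζ => poissonKernel 0 (r * exp (θ * I)) ζ * g ζ) 0 1 :=
    hgi.continuousOn_smul (by simpa using hc)
  have e1 : Real.circleAverage (fun ζ => poissonKernel 0 (r * exp (θ * I)) ζ * (g ζ - G θ)) 0 1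
      = Real.circleAverage (fun ζ => poissonKernel 0 (r * exp (θ * I)) ζ * g ζ) 0 1 - G θ := by
    have h3 := Real.circleAverage_fun_sub hi
      ((hc.circleIntegrable zero_le_one).const_smul (a := G θ))
    have h4 := Real.circleAverage_fun_smul (a := G θ) (f := poissonKernel 0 (r * exp (θ * I)))
      (c := 0) (R := 1)
    have h5 : (G θ • poissonKernel 0 (r * exp (θ * I))) =
        fun ζ => G θ • poissonKernel 0 (r * exp (θ * I)) ζ := rfl
    rw [h5, h4, hP, smul_eq_mul, mul_one] at h3
    rw [← h3]
    congr 1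
    ext ζ
    simp only [smul_eq_mul]
    ring
  have e2 := circleAverage_eq_integral_neg_pi
    (fun ζ => poissonKernel 0 (r * exp (θ * I)) ζ * (g ζ - G θ)) θ
  simp only [poissonKernel_rotate] at e2
  rw [smul_eq_mul] at e2
  change (2 * π)⁻¹ * (∫ t in (-π)..π, poissonKernel 0 r (exp (t * I)) *
    (g (exp ((t + θ : ℝ) * I)) - G θ)) + G θ = _
  rw [← e2, e1, sub_add_cancel]

/-- A holomorphic function on the disc whose exponential has a nonzero radial limit has itself a
radial limit. -/
lemma exists_tendsto_of_exp {h : ℝ → ℂ} (hc : ContinuousOn h (Ioo 0 1)) {L : ℂ} (hL : L ≠ 0)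
    (ht : Tendsto (fun r => exp (h r)) (𝓝[<] 1) (𝓝 L)) : ∃ l, Tendsto h (𝓝[<] 1) (𝓝 l) := by
  have h1 : Tendsto (fun r => exp (h r) / L) (𝓝[<] 1) (𝓝 1) := by
    simpa [hL] using ht.div_const L
  have hlog : Tendsto (fun r => log (exp (h r) / L)) (𝓝[<] 1) (𝓝 0) := by
    have := (continuousAt_clog (x := 1) (by simp [slitPlane])).tendsto.comp h1
    rwa [log_one] at this
  have hev : ∀ᶠ r in 𝓝[<] (1:ℝ), exp (h r) / L ∈ slitPlane :=
    h1.eventually (isOpen_slitPlane.mem_nhds (by simp [slitPlane]))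
  obtain ⟨a, ha, ha'⟩ := (mem_nhdsLT_iff_exists_Ioo_subset).1 hev
  set b := max a 0
  have hb1 : b < 1 := max_lt ha zero_lt_one
  have hsub : Ioo b 1 ⊆ Ioo 0 1 := Ioo_subset_Ioo_left (le_max_right _ _)
  have hsl : ∀ r ∈ Ioo b 1, exp (h r) / L ∈ slitPlane := fun r hr =>
    ha' ⟨(le_max_left _ _).trans_lt hr.1, hr.2⟩
  set d : ℝ → ℂ := fun r => h r - log (exp (h r) / L)
  have hdc : ContinuousOn d (Ioo b 1) := by
    refine (hc.mono hsub).sub (ContinuousOn.clog ?_ hsl)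
    exact (continuous_exp.comp_continuousOn (hc.mono hsub)).div_const _
  have hexp : ∀ r ∈ Ioo b 1, ∃ n : ℤ, d r = log L + n * (2 * π * I) := by
    intro r hr
    rw [← exp_eq_exp_iff_exists_int]
    rw [exp_sub, exp_log (slitPlane_ne_zero (hsl r hr)), exp_log hL]
    field_simp
  choose! n hn using hexp
  have hnc : ContinuousOn (fun r => ((n r : ℤ) : ℝ)) (Ioo b 1) := by
    have : ContinuousOn (fun r => ((d r - log L) / (2 * π * I)).re) (Ioo b 1) := by
      refine continuous_re.comp_continuousOn ?_
      exact (hdc.sub continuousOn_const).div_const _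
    refine this.congr fun r hr => ?_
    have hne : (2 * π * I : ℂ) ≠ 0 := by simp [Real.pi_ne_zero]
    simp only
    rw [hn r hr, add_sub_cancel_left, mul_div_cancel_right₀ _ hne]
    simp
  have hnc' : ContinuousOn n (Ioo b 1) := by
    rwa [Int.isClosedEmbedding_coe_real.isEmbedding.continuousOn_iff]
  obtain ⟨m, hm⟩ : ∃ m, m ∈ Ioo b 1 := ⟨(b + 1) / 2, by constructor <;> linarith⟩
  have hconst : ∀ r ∈ Ioo b 1, n r = n m := fun r hr =>
    isPreconnected_Ioo.constant hnc' hr hm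
  refine ⟨log L + n m * (2 * π * I), ?_⟩
  have h2 := hlog.const_add (log L + n m * (2 * π * I))
  rw [add_zero] at h2
  refine h2.congr' ?_
  filter_upwards [Ioo_mem_nhdsLT hb1] with r hr
  rw [← hconst r hr, ← hn r hr]
  simp [d]

/-- A Borel set of angles in `(0, 2π]`, transported to the circle. -/
lemma exists_measurableSet_exp {E : Set ℝ} (hE : MeasurableSet E) : ∃ S : Set ℂ, MeasurableSet S ∧
    ∀ θ ∈ Ioc (0:ℝ) (2 * π), exp (θ * I) ∈ S ↔ θ ∈ E := by
  have hE' : MeasurableSet (E ∩ Ioc (0:ℝ) (2 * π)) := hE.inter measurableSet_Ioc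
  refine ⟨arg ⁻¹' (E ∩ Ioc (0:ℝ) (2 * π)) ∪ (fun z => arg z + 2 * π) ⁻¹' (E ∩ Ioc (0:ℝ) (2 * π)),
    (measurable_arg hE').union ((measurable_arg.add_const _) hE'), fun θ hθ => ?_⟩
  have hpi := Real.pi_pos
  have h0 := hθ.1
  have h2 := hθ.2
  rcases le_or_gt θ π with h | h
  · have e : arg (exp (θ * I)) = θ := by
      rw [arg_exp_mul_I, toIocMod_eq_self]
      constructor <;> linarith
    simp only [mem_union, mem_preimage, mem_inter_iff, mem_Ioc, e]
    constructor
    · rintro (h | h)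
      · exact h.1
      · linarith [h.2.2]
    · exact fun h => Or.inl ⟨h, h0, h2⟩
  · have e : arg (exp (θ * I)) = θ - 2 * π := by
      rw [arg_exp_mul_I, ← toIocMod_sub, toIocMod_eq_self]
      constructor <;> linarith
    simp only [mem_union, mem_preimage, mem_inter_iff, mem_Ioc, e, sub_add_cancel]
    constructor
    · rintro (h | h)
      · linarith [h.2.1]
      · exact h.1
    · exact fun h => Or.inr ⟨h, h0, h2⟩

/-- The holomorphic function on the disc whose real part is the harmonic measure of `E`. -/
lemma exists_holomorphic_harmonicMeasure {E : Set ℝ} (hE : MeasurableSet E) :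
    ∃ H : ℂ → ℂ, DifferentiableOn ℂ H (ball 0 1) ∧
      (∀ z ∈ ball (0:ℂ) 1, 0 ≤ (H z).re ∧ (H z).re ≤ 1) ∧
      H 0 = ((2 * π)⁻¹ * circMeas.real E : ℝ) ∧
      ∀ᵐ θ ∂circMeas, ∃ L, HasRadialLim H θ L ∧ L.re = E.indicator 1 θ := by
  obtain ⟨S, hS, hSE⟩ := exists_measurableSet_exp hE
  set g : ℂ → ℝ := S.indicator 1
  have hg : Measurable g := measurable_one.indicator hS
  have hg0 : ∀ ζ, 0 ≤ g ζ := fun ζ => indicator_nonneg (fun _ _ => zero_le_one) ζ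
  have hg1 : ∀ ζ, g ζ ≤ 1 := fun ζ => indicator_le_self' (fun _ _ => zero_le_one) ζ
  have hgM : ∀ ζ, |g ζ| ≤ 1 := fun ζ => by rw [abs_of_nonneg (hg0 ζ)]; exact hg1 ζ
  have hgE : ∀ᵐ θ : ℝ ∂circMeas, g (exp (θ * I)) = E.indicator 1 θ := by
    filter_upwards [ae_restrict_mem measurableSet_Ioc] with θ hθ
    by_cases h : θ ∈ E
    · simp [g, (hSE θ hθ).2 h, h]
    · simp [g, (hSE θ hθ).not.2 h, h]
  have hgi : CircleIntegrable g 0 1 :=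
    circleIntegrable_of_bounded (C := 1)
      (hg.comp (continuous_circleMap 0 1).measurable).aestronglyMeasurable fun ζ _ => hgM ζ
  have hgi' : CircleIntegrable (fun ζ => (g ζ : ℂ)) 0 1 := by
    refine circleIntegrable_of_bounded (C := 1)
      (((measurable_ofReal.comp hg).comp
        (continuous_circleMap 0 1).measurable).aestronglyMeasurable)
      fun ζ _ => ?_
    rw [norm_real]
    exact hgM ζ
  set H : ℂ → ℂ := fun w => Real.circleAverage (fun ζ => herglotzRieszKernel 0 w ζ • (g ζ : ℂ)) 0 1
  have hHd : DifferentiableOn ℂ H (ball 0 1) :=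
    differentiableOn_circleAverage_herglotzRieszKernel_smul hgi'
  have hre : ∀ z ∈ ball (0:ℂ) 1, (H z).re = Real.circleAverage
      (fun ζ => poissonKernel 0 z ζ * g ζ) 0 1 := by
    intro z hz
    simp only [H]
    rw [re_circleAverage_herglotzRieszKernel_smul hgi hz, ← poissonKernel_eq_re_herglotzRieszKernel]
    rfl
  have hbd : ∀ z ∈ ball (0:ℂ) 1, 0 ≤ (H z).re ∧ (H z).re ≤ 1 := by
    intro z hz
    have hc := continuousOn_poissonKernel_sphere hz
    have hi : CircleIntegrable (fun ζ => poissonKernel 0 z ζ * g ζ) 0 1 :=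
      hgi.continuousOn_smul (by simpa using hc)
    rw [hre z hz]
    constructor
    · refine Real.circleAverage_nonneg_of_nonneg fun ζ hζ => ?_
      exact mul_nonneg (poissonKernel_nonneg_of_circle hz (by simpa using hζ)) (hg0 ζ)
    · refine le_of_le_of_eq ?_ (circleAverage_poissonKernel hz)
      refine Real.circleAverage_mono hi (hc.circleIntegrable zero_le_one) fun ζ hζ => ?_
      exact mul_le_of_le_one_right (poissonKernel_nonneg_of_circle hz (by simpa using hζ)) (hg1 ζ)
  refine ⟨H, hHd, hbd, ?_, ?_⟩
  · have h1 : H 0 = Real.circleAverage (fun ζ => (g ζ : ℂ)) 0 1 := by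
      refine Real.circleAverage_congr_sphere fun ζ hζ => ?_
      have : ζ ≠ 0 := by
        rintro rfl
        simp at hζ
      simp [herglotzRieszKernel_def, this]
    rw [h1, circleAverage_eq_circMeas]
    have h2 : ∫ θ : ℝ, (g (exp (θ * I)) : ℂ) ∂circMeas = ((circMeas.real E : ℝ) : ℂ) := by
      rw [integral_complex_ofReal, integral_congr_ae hgE, integral_indicator_one hE]
    rw [h2]
    simp
  · have hexp : BddHol fun z => exp (H z) := by
      refine ⟨hHd.cexp, Real.exp 1, fun z hz => ?_⟩
      rw [norm_exp]
      exact Real.exp_le_exp.2 (hbd z hz).2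
    filter_upwards [hgE, ae_restrict_of_ae (ae_tendsto_poisson hg hgM), hexp.bv_lim] with θ h1 h2 h3
    have hne : bv (fun z => exp (H z)) θ ≠ 0 := by
      have : 1 ≤ ‖bv (fun z => exp (H z)) θ‖ := by
        refine ge_of_tendsto (Tendsto.norm h3) ?_
        filter_upwards [eventually_mul_exp_mem_ball θ] with r hr
        rw [norm_exp]
        exact Real.one_le_exp (hbd _ hr).1
      exact norm_pos_iff.1 (zero_lt_one.trans_le this)
    obtain ⟨L, hL⟩ := exists_tendsto_of_exp (h := fun r : ℝ => H (r * exp (θ * I))) (by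
      refine hHd.continuousOn.comp (by fun_prop) fun r hr => mul_exp_mem_ball hr θ) hne h3
    refine ⟨L, hL, ?_⟩
    have h4 := (continuous_re.tendsto L).comp hL
    rw [← h1]
    refine tendsto_nhds_unique h4 (h2.congr' ?_)
    filter_upwards [eventually_mul_exp_mem_ball θ] with r hr
    exact (hre _ hr).symm

/-- The Blaschke-type product on the right half-plane with zeros `4 ^ k`, `k ≥ 0`. -/
noncomputable def halfPlaneProd (v : ℂ) : ℂ := ∏' k : ℕ, (1 - v / 4 ^ k) / (1 + v / 4 ^ k)

lemma hasProdLocallyUniformlyOn_halfPlaneProd (R : ℝ) :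
    HasProdLocallyUniformlyOn (fun (k : ℕ) v => (1 - v / 4 ^ k) / (1 + v / 4 ^ k)) halfPlaneProd
      ({v : ℂ | -(1 / 2) < v.re} ∩ ball 0 R) := by
  have hK : IsOpen ({v : ℂ | -(1 / 2) < v.re} ∩ ball 0 R) :=
    (isOpen_lt continuous_const continuous_re).inter isOpen_ball
  have hden : ∀ (k : ℕ) (v : ℂ), -(1 / 2) < v.re → 1 / 2 ≤ ‖1 + v / 4 ^ k‖ := by
    intro k v hv
    refine le_trans ?_ (re_le_norm _)
    have e : (1 + v / 4 ^ k).re = 1 + v.re / 4 ^ k := by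
      have : (v / 4 ^ k) = v / ((4 ^ k : ℝ) : ℂ) := by push_cast; rfl
      rw [this, add_re, div_ofReal_re, one_re]
    rw [e]
    have h4 : (1:ℝ) ≤ 4 ^ k := one_le_pow₀ (by norm_num)
    have : -(1 / 2) ≤ v.re / 4 ^ k := by
      rw [le_div_iff₀ (by positivity)]
      nlinarith
    linarith
  have h := Summable.hasProdLocallyUniformlyOn_nat_one_add
    (f := fun (k : ℕ) (v : ℂ) => -2 * (v / 4 ^ k) / (1 + v / 4 ^ k)) hK
      (u := fun k => 4 * R * (1 / 4) ^ k)
    ((summable_geometric_of_lt_one (by norm_num) (by norm_num)).mul_left _)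
    (Eventually.of_forall fun k v hv => by
      have h1 := hden k v hv.1
      have h2 : ‖v‖ < R := by simpa using hv.2
      rw [norm_div, div_le_iff₀ (by linarith), norm_mul, norm_div, norm_pow]
      simp only [norm_neg, Complex.norm_ofNat]
      have h4 : (0:ℝ) < 4 ^ k := by positivity
      rw [one_div, inv_pow]
      have : ‖v‖ / 4 ^ k ≤ R / 4 ^ k := by gcongr
      have h5 : 0 ≤ R / 4 ^ k := (by positivity : 0 ≤ ‖v‖ / 4 ^ k).trans this
      calc 2 * (‖v‖ / 4 ^ k) ≤ 2 * (R / 4 ^ k) := by gcongr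
        _ ≤ 4 * (R / 4 ^ k) * ‖1 + v / 4 ^ k‖ := by nlinarith
        _ = _ := by ring)
    (fun k => by
      refine ContinuousOn.div (by fun_prop) (by fun_prop) fun v hv h0 => ?_
      have h1 := hden k v hv.1
      rw [h0, norm_zero] at h1
      linarith)
  have e : ∀ (k : ℕ), ∀ v ∈ ({v : ℂ | -(1 / 2) < v.re} ∩ ball 0 R),
      1 + -2 * (v / 4 ^ k) / (1 + v / 4 ^ k) = (1 - v / 4 ^ k) / (1 + v / 4 ^ k) := by
    intro k v hv
    have h1 := hden k v hv.1
    have h0 : 1 + v / 4 ^ k ≠ 0 := by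
      rw [← norm_pos_iff]
      linarith
    rw [eq_div_iff h0, add_mul, div_mul_cancel₀ _ h0]
    ring
  rw [hasProdLocallyUniformlyOn_iff_tendstoLocallyUniformlyOn] at h ⊢
  refine (h.congr fun s v hv => ?_).congr_right fun v hv => ?_
  · exact Finset.prod_congr rfl fun k _ => e k v hv
  · exact tprod_congr fun k => e k v hv

lemma differentiableAt_halfPlaneProd {v : ℂ} (hv : -(1 / 2) < v.re) :
    DifferentiableAt ℂ halfPlaneProd v := by
  have hK : IsOpen ({v : ℂ | -(1 / 2) < v.re} ∩ ball 0 (‖v‖ + 1)) :=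
    (isOpen_lt continuous_const continuous_re).inter isOpen_ball
  have h := hasProdLocallyUniformlyOn_halfPlaneProd (‖v‖ + 1)
  rw [hasProdLocallyUniformlyOn_iff_tendstoLocallyUniformlyOn] at h
  have hmem : v ∈ ({v : ℂ | -(1 / 2) < v.re} ∩ ball 0 (‖v‖ + 1)) := ⟨hv, by simp⟩
  refine (h.differentiableOn (Eventually.of_forall fun s => ?_) hK).differentiableAt
    (hK.mem_nhds hmem)
  refine DifferentiableOn.fun_finsetProd fun k _ => ?_
  refine DifferentiableOn.div (by fun_prop) (by fun_prop) fun w hw h0 => ?_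
  have e : (1 + w / 4 ^ k).re = 1 + w.re / 4 ^ k := by
    have : (w / 4 ^ k) = w / ((4 ^ k : ℝ) : ℂ) := by push_cast; rfl
    rw [this, add_re, div_ofReal_re, one_re]
  rw [h0, zero_re] at e
  have h4 : (1:ℝ) ≤ 4 ^ k := one_le_pow₀ (by norm_num)
  have : w.re / 4 ^ k = -1 := by linarith
  rw [div_eq_iff (by positivity)] at this
  have := hw.1
  change -(1 / 2) < w.re at this
  linarith

lemma hasProd_halfPlaneProd {v : ℂ} (hv : -(1 / 2) < v.re) :
    HasProd (fun k : ℕ => (1 - v / 4 ^ k) / (1 + v / 4 ^ k)) (halfPlaneProd v) := by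
  refine (hasProdLocallyUniformlyOn_halfPlaneProd (‖v‖ + 1)).hasProd (x := v) ?_
  exact ⟨hv, by simp⟩

lemma norm_halfPlaneProd_le {v : ℂ} (hv : 0 ≤ v.re) : ‖halfPlaneProd v‖ ≤ 1 := by
  refine le_of_tendsto (hasProd_halfPlaneProd (by linarith)).norm
    (Eventually.of_forall fun s => Finset.prod_le_one (fun _ _ => norm_nonneg _) fun k _ => ?_)
  have e : (v / 4 ^ k) = v / ((4 ^ k : ℝ) : ℂ) := by push_cast; rfl
  rw [e]
  set w := v / ((4 ^ k : ℝ) : ℂ) with hw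
  have hw0 : 0 ≤ w.re := by
    rw [hw, div_ofReal_re]
    positivity
  rw [norm_div]
  refine div_le_one_of_le₀ ?_ (norm_nonneg _)
  rw [← sq_le_sq₀ (norm_nonneg _) (norm_nonneg _), ← normSq_eq_norm_sq, ← normSq_eq_norm_sq,
    normSq_apply, normSq_apply]
  simp only [sub_re, one_re, sub_im, one_im, add_re, add_im]
  nlinarith

lemma arctan_sub_arctan_half_nonneg {x : ℝ} (hx : 0 ≤ x) :
    0 ≤ Real.arctan x - Real.arctan (x / 2) := by
  rw [sub_nonneg]
  exact Real.arctan_mono (by linarith)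

lemma arctan_sub_arctan_half_ge {x : ℝ} (hx : 1 / 4 ≤ x) (hx1 : x ≤ 1) :
    1 / 16 ≤ Real.arctan x - Real.arctan (x / 2) := by
  have h := (convex_Icc (0:ℝ) 1).mul_sub_le_image_sub_of_le_deriv (f := Real.arctan) (C := 1 / 2)
    Real.continuous_arctan.continuousOn Real.differentiable_arctan.differentiableOn (fun y hy => by
      rw [interior_Icc] at hy
      rw [Real.deriv_arctan]
      refine one_div_le_one_div_of_le (by positivity) ?_
      nlinarith [hy.1, hy.2]) (x / 2) ⟨by linarith, by linarith⟩ x ⟨by linarith, hx1⟩ (by linarith)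
  linarith

lemma summable_arctan_div (y : ℝ) : Summable fun k : ℕ => Real.arctan (y / 4 ^ k) := by
  refine Summable.of_norm_bounded (g := fun k : ℕ => |y| * (1 / 4) ^ k)
    ((summable_geometric_of_lt_one (by norm_num) (by norm_num)).mul_left _) fun k => ?_
  have h := (convex_univ (𝕜 := ℝ) (E := ℝ)).norm_image_sub_le_of_norm_deriv_le (f := Real.arctan)
    (C := 1) (fun x _ => Real.differentiable_arctan x) (fun x _ => by
      rw [Real.deriv_arctan, Real.norm_of_nonneg (by positivity)]
      exact div_le_one_of_le₀ (by nlinarith) (by positivity)) (mem_univ 0) (mem_univ (y / 4 ^ k))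
  simpa [abs_div, div_eq_mul_inv] using h

/-- Half the phase of `halfPlaneProd` on the imaginary axis. -/
noncomputable def arctanSum (y : ℝ) : ℝ := ∑' k : ℕ, Real.arctan (y / 4 ^ k)

lemma arctanSum_neg (y : ℝ) : arctanSum (-y) = - arctanSum y := by
  unfold arctanSum
  rw [← tsum_neg]
  simp [neg_div, Real.arctan_neg]

lemma arctanSum_eq (y : ℝ) : arctanSum y = Real.arctan y + arctanSum (y / 4) := by
  unfold arctanSum
  rw [(summable_arctan_div y).tsum_eq_zero_add]
  simp [pow_succ', div_div]

lemma one_sub_mul_I_div (x : ℝ) :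
    (1 - I * x) / (1 + I * x) = exp (-2 * Real.arctan x * I) := by
  have hs : (0:ℝ) < √(1 + x ^ 2) := by positivity
  have h : exp (Real.arctan x * I) = (1 + I * x) / (√(1 + x ^ 2) : ℝ) := by
    rw [exp_mul_I, ← ofReal_cos, ← ofReal_sin, Real.cos_arctan, Real.sin_arctan]
    push_cast
    ring
  have h' : exp (-(Real.arctan x * I)) = (1 - I * x) / (√(1 + x ^ 2) : ℝ) := by
    have := h
    rw [← neg_mul, ← ofReal_neg, ← Real.arctan_neg, exp_mul_I, ← ofReal_cos, ← ofReal_sin,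
      Real.cos_arctan, Real.sin_arctan]
    push_cast
    rw [neg_sq]
    ring
  have e : (-2 * Real.arctan x * I : ℂ) = -(Real.arctan x * I) - Real.arctan x * I := by ring
  have hs' : ((√(1 + x ^ 2) : ℝ) : ℂ) ≠ 0 := by exact_mod_cast hs.ne'
  rw [e, exp_sub, h', h, div_div_div_cancel_right₀ hs']

lemma halfPlaneProd_I_mul (y : ℝ) : halfPlaneProd (I * y) = exp (-2 * arctanSum y * I) := by
  have h1 := hasProd_halfPlaneProd (v := I * y) (by simp)
  have h2 : HasSum (fun k : ℕ => (-2 * (Real.arctan (y / 4 ^ k) : ℂ) * I)) (-2 * arctanSum y * I) :=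
    ((Complex.hasSum_ofReal.2 (summable_arctan_div y).hasSum).mul_left (-2)).mul_right I
  refine h1.unique ?_
  convert! h2.cexp using 2 with k
  simp only [Function.comp_apply]
  rw [← one_sub_mul_I_div]
  push_cast
  rw [mul_div_assoc]

/-- The phase difference used to separate the two sides of the strip. -/
noncomputable def phaseGap (y : ℝ) : ℝ :=
  (arctanSum y - arctanSum (y / 2)) + (arctanSum (1 / (2 * y)) - arctanSum (1 / (4 * y)))

lemma phaseGap_neg (y : ℝ) : phaseGap (-y) = - phaseGap y := by
  unfold phaseGap
  have e1 : -y / 2 = -(y / 2) := by ring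
  have e2 : 1 / (2 * -y) = -(1 / (2 * y)) := by rw [mul_neg, div_neg]
  have e3 : 1 / (4 * -y) = -(1 / (4 * y)) := by rw [mul_neg, div_neg]
  rw [e1, e2, e3]
  simp only [arctanSum_neg]
  ring

lemma arctanSum_sub_half (y : ℝ) : arctanSum y - arctanSum (y / 2) =
    ∑' k : ℕ, (Real.arctan (y / 4 ^ k) - Real.arctan (y / 4 ^ k / 2)) := by
  unfold arctanSum
  rw [← (summable_arctan_div y).tsum_sub (summable_arctan_div (y / 2))]
  refine tsum_congr fun k => ?_
  rw [div_right_comm]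

lemma summable_arctan_sub_half (y : ℝ) : Summable fun k : ℕ =>
    (Real.arctan (y / 4 ^ k) - Real.arctan (y / 4 ^ k / 2)) := by
  refine ((summable_arctan_div y).sub (summable_arctan_div (y / 2))).congr fun k => ?_
  rw [div_right_comm]

lemma arctanSum_sub_half_nonneg {y : ℝ} (hy : 0 ≤ y) : 0 ≤ arctanSum y - arctanSum (y / 2) := by
  rw [arctanSum_sub_half]
  exact tsum_nonneg fun k => arctan_sub_arctan_half_nonneg (by positivity)

lemma arctanSum_sub_half_ge {y : ℝ} (hy : 1 / 4 ≤ y) :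
    1 / 16 ≤ arctanSum y - arctanSum (y / 2) := by
  obtain ⟨k, hk1, hk2⟩ := exists_nat_pow_near (x := 4 * y) (by linarith) (y := 4) (by norm_num)
  have h4 : (0:ℝ) < 4 ^ k := by positivity
  rw [arctanSum_sub_half]
  refine le_trans (arctan_sub_arctan_half_ge (x := y / 4 ^ k) ?_ ?_)
    ((summable_arctan_sub_half y).le_tsum k fun j _ => arctan_sub_arctan_half_nonneg
      (by positivity))
  · rw [le_div_iff₀ h4]
    linarith
  · rw [div_le_one h4]
    rw [pow_succ] at hk2
    linarith

lemma phaseGap_ge {y : ℝ} (hy : 0 < y) : 1 / 16 ≤ phaseGap y := by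
  have e : 1 / (4 * y) = 1 / (2 * y) / 2 := by field_simp; norm_num
  unfold phaseGap
  rw [e]
  rcases le_or_gt (1 / 4) y with h | h
  · have := arctanSum_sub_half_ge h
    have := arctanSum_sub_half_nonneg (y := 1 / (2 * y)) (by positivity)
    linarith
  · have := arctanSum_sub_half_nonneg hy.le
    have := arctanSum_sub_half_ge (y := 1 / (2 * y)) (by
      rw [le_div_iff₀ (by positivity)]
      linarith)
    linarith

lemma phaseGap_add_half {y : ℝ} (hy : 0 < y) : phaseGap y + phaseGap (y / 2) = π / 2 := by
  unfold phaseGap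
  have e1 : 1 / (2 * (y / 2)) = y⁻¹ := by field_simp
  have e2 : 1 / (4 * (y / 2)) = 1 / (2 * y) := by field_simp; norm_num
  have e3 : 1 / (4 * y) = y⁻¹ / 4 := by field_simp
  have e4 : y / 2 / 2 = y / 4 := by ring
  rw [e1, e2, e3, e4]
  have h1 := arctanSum_eq y
  have h2 := arctanSum_eq y⁻¹
  rw [Real.arctan_inv_of_pos hy] at h2
  linarith

lemma sin_two_phaseGap_ge {y : ℝ} (hy : 0 < y) : Real.sin (1 / 8) ≤ Real.sin (2 * phaseGap y) := by
  have h1 := phaseGap_ge hy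
  have h2 := phaseGap_ge (y := y / 2) (by positivity)
  have h3 := phaseGap_add_half hy
  have hpi := Real.pi_gt_three
  rcases le_or_gt (2 * phaseGap y) (π / 2) with h | h
  · exact Real.sin_le_sin_of_le_of_le_pi_div_two (by linarith) h (by linarith)
  · rw [← Real.sin_pi_sub (2 * phaseGap y)]
    exact Real.sin_le_sin_of_le_of_le_pi_div_two (by linarith) (by linarith) (by linarith)

noncomputable def halfPlaneInner (v : ℂ) : ℂ := halfPlaneProd v * halfPlaneProd (1 / (4 * v))

lemma re_one_div_four_mul_nonneg {v : ℂ} (hv : 0 ≤ v.re) : 0 ≤ (1 / (4 * v)).re := by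
  rw [one_div, inv_re]
  refine div_nonneg ?_ (normSq_nonneg _)
  simpa using hv

lemma differentiableAt_halfPlaneInner {v : ℂ} (hv : 0 ≤ v.re) (h0 : v ≠ 0) :
    DifferentiableAt ℂ halfPlaneInner v := by
  refine (differentiableAt_halfPlaneProd (by linarith)).mul ?_
  refine DifferentiableAt.comp (f := fun v : ℂ => 1 / (4 * v)) v
    (differentiableAt_halfPlaneProd ?_) ?_
  · linarith [re_one_div_four_mul_nonneg hv]
  · exact (differentiableAt_const _).div (by fun_prop) (by simpa using h0)

lemma norm_halfPlaneInner_le {v : ℂ} (hv : 0 ≤ v.re) : ‖halfPlaneInner v‖ ≤ 1 := by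
  rw [halfPlaneInner, norm_mul]
  exact mul_le_one₀ (norm_halfPlaneProd_le hv) (norm_nonneg _)
    (norm_halfPlaneProd_le (re_one_div_four_mul_nonneg hv))

lemma halfPlaneInner_I_mul (y : ℝ) :
    halfPlaneInner (I * y) = exp ((-2 * (arctanSum y - arctanSum (1 / (4 * y))) : ℝ) * I) := by
  have e : 1 / (4 * (I * y)) = I * ((-(1 / (4 * y)) : ℝ) : ℂ) := by
    push_cast
    rw [show (4 * (I * y) : ℂ) = I * (4 * y) by ring, ← div_div, one_div I, inv_I]
    ring
  rw [halfPlaneInner, e, halfPlaneProd_I_mul, halfPlaneProd_I_mul, ← exp_add, arctanSum_neg]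
  push_cast
  ring_nf

lemma norm_halfPlaneInner_I_mul (y : ℝ) : ‖halfPlaneInner (I * y)‖ = 1 := by
  rw [halfPlaneInner_I_mul, norm_exp_ofReal_mul_I]

lemma im_halfPlaneInner_mul_conj (y : ℝ) :
    (halfPlaneInner (I * (y / 2 : ℝ)) * (starRingEnd ℂ) (halfPlaneInner (I * y))).im
      = Real.sin (2 * phaseGap y) := by
  rw [halfPlaneInner_I_mul, halfPlaneInner_I_mul, ← exp_conj, map_mul, conj_I, conj_ofReal,
    ← exp_add]
  have e1 : 1 / (4 * (y / 2)) = 1 / (2 * y) := by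
    rw [show 4 * (y / 2) = 2 * y by ring]
  have e : ((-2 * (arctanSum (y / 2) - arctanSum (1 / (4 * (y / 2)))) : ℝ) : ℂ) * I +
      ((-2 * (arctanSum y - arctanSum (1 / (4 * y))) : ℝ) : ℂ) * -I = (2 * phaseGap y : ℝ) * I := by
    rw [e1, phaseGap]
    push_cast
    ring
  rw [e, exp_ofReal_mul_I_im]

lemma re_exp_strip_nonneg {h : ℂ} (h0 : 0 ≤ h.re) (h1 : h.re ≤ 1) :
    0 ≤ (exp (I * π * (h - 1 / 2))).re := by
  rw [exp_re]
  refine mul_nonneg (Real.exp_pos _).le (Real.cos_nonneg_of_mem_Icc ?_)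
  have e : (I * π * (h - 1 / 2)).im = π * (h.re - 1 / 2) := by simp
  rw [e]
  constructor <;> nlinarith [Real.pi_pos]

lemma exp_strip_one {L : ℂ} (h : L.re = 1) :
    exp (I * π * (L - 1 / 2)) = I * (Real.exp (-π * L.im) : ℝ) := by
  have e : I * π * (L - 1 / 2) = π / 2 * I + ((-π * L.im : ℝ) : ℂ) := by
    apply Complex.ext
    · simp
    · simp [h]; ring
  rw [e, exp_add, exp_pi_div_two_mul_I, ofReal_exp]

lemma exp_strip_zero {L : ℂ} (h : L.re = 0) :
    exp (I * π * (L - 1 / 2)) = I * (-Real.exp (-π * L.im) : ℝ) := by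
  have e : I * π * (L - 1 / 2) = -(π / 2 * I) + ((-π * L.im : ℝ) : ℂ) := by
    apply Complex.ext
    · simp
    · simp [h]; ring
  rw [e, exp_add, exp_neg, exp_pi_div_two_mul_I, inv_I, ofReal_neg, ofReal_exp]
  ring

/-- Two inner functions whose quotient has boundary values in the upper half plane exactly on `E`,
uniformly away from the real line. -/
lemma exists_inner_pair {E : Set ℝ} (hE : MeasurableSet E) :
    ∃ I₁ I₂ : ℂ → ℂ, IsInner I₁ ∧ IsInner I₂ ∧
    ∀ᵐ θ ∂circMeas, (θ ∈ E → Real.sin (1 / 8) ≤ (bv I₂ θ * (starRingEnd ℂ) (bv I₁ θ)).im) ∧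
      (θ ∉ E → (bv I₂ θ * (starRingEnd ℂ) (bv I₁ θ)).im ≤ -Real.sin (1 / 8)) := by
  obtain ⟨H, hHd, hH, -, hHl⟩ := exists_holomorphic_harmonicMeasure hE
  set v : ℂ → ℂ := fun h => exp (I * π * (h - 1 / 2))
  have hvd : Differentiable ℂ v := by fun_prop
  have hv0 : ∀ h, v h ≠ 0 := fun h => exp_ne_zero _
  have key : ∀ c : ℝ, 0 < c → (BddHol fun z => halfPlaneInner (c * v (H z))) ∧
      ∀ θ L, HasRadialLim H θ L → 0 ≤ L.re → L.re ≤ 1 →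
        HasRadialLim (fun z => halfPlaneInner (c * v (H z))) θ (halfPlaneInner (c * v L)) := by
    intro c hc
    have hre : ∀ h : ℂ, 0 ≤ h.re → h.re ≤ 1 → 0 ≤ (c * v h).re := fun h h0 h1 => by
      rw [re_ofReal_mul]
      exact mul_nonneg hc.le (re_exp_strip_nonneg h0 h1)
    have hne : ∀ h : ℂ, (c * v h) ≠ 0 := fun h => mul_ne_zero (by exact_mod_cast hc.ne') (hv0 h)
    refine ⟨⟨fun z hz => ?_, 1, fun z hz => ?_⟩, fun θ L hL h0 h1 => ?_⟩
    · have h1 : DifferentiableAt ℂ (fun z => c * v (H z)) z :=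
        ((hvd _).comp z (hHd.differentiableAt (isOpen_ball.mem_nhds hz))).const_mul _
      exact (DifferentiableAt.comp (f := fun z => c * v (H z)) z (differentiableAt_halfPlaneInner
        (hre _ (hH z hz).1 (hH z hz).2) (hne _)) h1).differentiableWithinAt
    · exact norm_halfPlaneInner_le (hre _ (hH z hz).1 (hH z hz).2)
    · have h2 : ContinuousAt (fun h => halfPlaneInner (c * v h)) L :=
        ContinuousAt.comp (f := fun h => c * v h)
          (differentiableAt_halfPlaneInner (hre _ h0 h1) (hne _)).continuousAt
          (continuousAt_const.mul (hvd L).continuousAt)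
      exact h2.tendsto.comp hL
  obtain ⟨hb1, hl1⟩ := key 1 one_pos
  obtain ⟨hb2, hl2⟩ := key (1 / 2) (by norm_num)
  have hval : ∀ᵐ θ ∂circMeas, ∃ y : ℝ,
      bv (fun z => halfPlaneInner ((1:ℝ) * v (H z))) θ = halfPlaneInner (I * y) ∧
      bv (fun z => halfPlaneInner ((1 / 2 : ℝ) * v (H z))) θ = halfPlaneInner (I * (y / 2 : ℝ)) ∧
      (θ ∈ E → 0 < y) ∧ (θ ∉ E → y < 0) := by
    filter_upwards [hHl] with θ ⟨L, hL, hLE⟩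
    have gen : ∀ y : ℝ, 0 ≤ L.re → L.re ≤ 1 → v L = I * y →
        bv (fun z => halfPlaneInner ((1:ℝ) * v (H z))) θ = halfPlaneInner (I * y) ∧
        bv (fun z => halfPlaneInner ((1 / 2 : ℝ) * v (H z))) θ =
            halfPlaneInner (I * (y / 2 : ℝ)) := by
      intro y h0 h1 hy
      rw [(hl1 θ L hL h0 h1).bv_eq, (hl2 θ L hL h0 h1).bv_eq, hy]
      constructor <;> congr 1 <;> push_cast <;> ring
    by_cases h : θ ∈ E
    · have hr : L.re = 1 := by simpa [h] using hLE
      have := gen _ (by simp [hr]) (by simp [hr]) (exp_strip_one hr)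
      exact ⟨_, this.1, this.2, fun _ => Real.exp_pos _, fun h' => absurd h h'⟩
    · have hr : L.re = 0 := by simpa [h] using hLE
      have := gen _ (by simp [hr]) (by simp [hr]) (exp_strip_zero hr)
      exact ⟨_, this.1, this.2, fun h' => absurd h' h, fun _ => by
        have := Real.exp_pos (-π * L.im)
        linarith⟩
  refine ⟨_, _, hb1.isInner ?_, hb2.isInner ?_, ?_⟩
  · filter_upwards [hval] with θ ⟨y, h1, h2, _⟩
    rw [h1, norm_halfPlaneInner_I_mul]
  · filter_upwards [hval] with θ ⟨y, h1, h2, _⟩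
    rw [h2, norm_halfPlaneInner_I_mul]
  · filter_upwards [hval] with θ ⟨y, h1, h2, h3, h4⟩
    rw [h1, h2, im_halfPlaneInner_mul_conj]
    refine ⟨fun h => sin_two_phaseGap_ge (h3 h), fun h => ?_⟩
    have := sin_two_phaseGap_ge (y := -y) (by linarith [h4 h])
    rw [phaseGap_neg, mul_neg, Real.sin_neg] at this
    linarith

/-- Bounded holomorphic functions `g` for which `Ω * conj g` is, on the circle, again the boundary
function of a bounded holomorphic function, for some inner `Ω`. -/
def IsPseudocont (g : ℂ → ℂ) : Prop :=
  BddHol g ∧ ∃ Ω g' : ℂ → ℂ, IsInner Ω ∧ BddHol g' ∧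
    ∀ᵐ θ ∂circMeas, bv g' θ = bv Ω θ * (starRingEnd ℂ) (bv g θ)

lemma IsInner.ae_mul_conj {φ : ℂ → ℂ} (h : IsInner φ) :
    ∀ᵐ θ ∂circMeas, bv φ θ * (starRingEnd ℂ) (bv φ θ) = 1 := by
  filter_upwards [h.norm_bv] with θ hθ
  rw [mul_conj, normSq_eq_norm_sq, hθ]
  simp

namespace IsPseudocont
variable {f g : ℂ → ℂ}

lemma const (c : ℂ) : IsPseudocont fun _ => c := by
  refine ⟨BddHol.const c, fun _ => 1, fun _ => (starRingEnd ℂ) c, IsInner.const (by simp),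
    BddHol.const _, Eventually.of_forall fun θ => ?_⟩
  simp only [bv_const, one_mul]

lemma _root_.IsInner.isPseudocont (h : IsInner f) : IsPseudocont f := by
  refine ⟨h.bddHol, f, fun _ => 1, h, BddHol.const _, ?_⟩
  filter_upwards [h.ae_mul_conj] with θ hθ
  rw [bv_const, hθ]

lemma add (hf : IsPseudocont f) (hg : IsPseudocont g) : IsPseudocont fun z => f z + g z := by
  obtain ⟨hf, Ω, f', hΩ, hf', hff⟩ := hf
  obtain ⟨hg, Ψ, g', hΨ, hg', hgg⟩ := hg
  refine ⟨hf.add hg, fun z => Ω z * Ψ z, fun z => f' z * Ψ z + Ω z * g' z, hΩ.mul hΨ,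
    (hf'.mul hΨ.bddHol).add (hΩ.bddHol.mul hg'), ?_⟩
  filter_upwards [hff, hgg, hf.bv_add hg, hΩ.bddHol.bv_mul hΨ.bddHol,
    (hf'.mul hΨ.bddHol).bv_add (hΩ.bddHol.mul hg'), hf'.bv_mul hΨ.bddHol,
    hΩ.bddHol.bv_mul hg'] with θ h1 h2 h3 h4 h5 h6 h7
  rw [h5, h6, h7, h4, h3, h1, h2, map_add]
  ring

lemma mul (hf : IsPseudocont f) (hg : IsPseudocont g) : IsPseudocont fun z => f z * g z := by
  obtain ⟨hf, Ω, f', hΩ, hf', hff⟩ := hf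
  obtain ⟨hg, Ψ, g', hΨ, hg', hgg⟩ := hg
  refine ⟨hf.mul hg, fun z => Ω z * Ψ z, fun z => f' z * g' z, hΩ.mul hΨ, hf'.mul hg', ?_⟩
  filter_upwards [hff, hgg, hf.bv_mul hg, hΩ.bddHol.bv_mul hΨ.bddHol,
    hf'.bv_mul hg'] with θ h1 h2 h3 h4 h5
  rw [h5, h4, h3, h1, h2, map_mul]
  ring

end IsPseudocont

/-- Boundary functions `h` such that `B * h` is uniformly close to a function in `IsPseudocont`,
for some inner `B`. -/
def InnerApprox (h : ℝ → ℂ) : Prop :=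
  ∀ ε > (0:ℝ), ∃ B g : ℂ → ℂ, IsInner B ∧ IsPseudocont g ∧
    ∀ᵐ θ ∂circMeas, ‖bv B θ * h θ - bv g θ‖ ≤ ε

namespace InnerApprox
variable {h k : ℝ → ℂ}

lemma exists_bound (hh : InnerApprox h) : ∃ M : ℝ, 0 < M ∧ ∀ᵐ θ ∂circMeas, ‖h θ‖ ≤ M := by
  obtain ⟨B, g, hB, hg, H⟩ := hh 1 one_pos
  obtain ⟨C, hC⟩ := hg.1.2
  refine ⟨|C| + 1, by positivity, ?_⟩
  filter_upwards [H, hB.norm_bv, hg.1.norm_bv_le hC] with θ h1 h2 h3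
  have : ‖h θ‖ = ‖bv B θ * h θ‖ := by rw [norm_mul, h2, one_mul]
  rw [this]
  have := norm_sub_norm_le (bv B θ * h θ) (bv g θ)
  linarith [le_abs_self C]

lemma const (c : ℂ) : InnerApprox fun _ => c := by
  intro ε hε
  refine ⟨fun _ => 1, fun _ => c, IsInner.const (by simp), IsPseudocont.const c,
    Eventually.of_forall fun θ => ?_⟩
  simp only [bv_const, one_mul, sub_self, norm_zero]
  exact hε.le

lemma congr (hh : InnerApprox h) (hk : ∀ᵐ θ ∂circMeas, h θ = k θ) : InnerApprox k := by
  intro ε hε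
  obtain ⟨B, g, hB, hg, H⟩ := hh ε hε
  refine ⟨B, g, hB, hg, ?_⟩
  filter_upwards [H, hk] with θ h1 h2
  rwa [← h2]

lemma of_forall_approx (hh : ∀ ε > (0:ℝ), ∃ k, InnerApprox k ∧ ∀ᵐ θ ∂circMeas, ‖h θ - k θ‖ ≤ ε) :
    InnerApprox h := by
  intro ε hε
  obtain ⟨k, hk, hkh⟩ := hh (ε / 2) (by positivity)
  obtain ⟨B, g, hB, hg, H⟩ := hk (ε / 2) (by positivity)
  refine ⟨B, g, hB, hg, ?_⟩
  filter_upwards [H, hkh, hB.norm_bv] with θ h1 h2 h3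
  have e : bv B θ * h θ - bv g θ = bv B θ * (h θ - k θ) + (bv B θ * k θ - bv g θ) := by ring
  rw [e]
  refine (norm_add_le _ _).trans ?_
  rw [norm_mul, h3, one_mul]
  linarith

lemma add (hh : InnerApprox h) (hk : InnerApprox k) : InnerApprox fun θ => h θ + k θ := by
  intro ε hε
  obtain ⟨B, f, hB, hf, H⟩ := hh (ε / 2) (by positivity)
  obtain ⟨D, g, hD, hg, K⟩ := hk (ε / 2) (by positivity)
  refine ⟨_, _, hB.mul hD, (hf.mul hD.isPseudocont).add (hB.isPseudocont.mul hg), ?_⟩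
  filter_upwards [H, K, hB.norm_bv, hD.norm_bv, hB.bddHol.bv_mul hD.bddHol,
    (hf.1.mul hD.bddHol).bv_add (hB.bddHol.mul hg.1), hf.1.bv_mul hD.bddHol,
    hB.bddHol.bv_mul hg.1] with θ h1 h2 h3 h4 h5 h6 h7 h8
  rw [h6, h5, h7, h8]
  have e : bv B θ * bv D θ * (h θ + k θ) - (bv f θ * bv D θ + bv B θ * bv g θ) =
    (bv B θ * h θ - bv f θ) * bv D θ + bv B θ * (bv D θ * k θ - bv g θ) := by ring
  rw [e]
  refine (norm_add_le _ _).trans ?_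
  rw [norm_mul, norm_mul, h3, h4]
  linarith

lemma mul (hh : InnerApprox h) (hk : InnerApprox k) : InnerApprox fun θ => h θ * k θ := by
  intro ε hε
  obtain ⟨M, hM0, hM⟩ := hk.exists_bound
  obtain ⟨B, f, hB, hf, H⟩ := hh (ε / (2 * M)) (by positivity)
  obtain ⟨C, hC⟩ := hf.1.2
  obtain ⟨D, g, hD, hg, K⟩ := hk (ε / (2 * (|C| + 1))) (by positivity)
  refine ⟨_, _, hB.mul hD, hf.mul hg, ?_⟩
  filter_upwards [H, K, hB.norm_bv, hD.norm_bv, hB.bddHol.bv_mul hD.bddHol,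
    hf.1.bv_mul hg.1, hM, hf.1.norm_bv_le hC] with θ h1 h2 h3 h4 h5 h6 h7 h8
  rw [h6, h5]
  have e : bv B θ * bv D θ * (h θ * k θ) - bv f θ * bv g θ =
    (bv B θ * h θ - bv f θ) * (bv D θ * k θ) + bv f θ * (bv D θ * k θ - bv g θ) := by ring
  rw [e]
  refine (norm_add_le _ _).trans ?_
  rw [norm_mul, norm_mul, norm_mul, h4, one_mul]
  have e1 : ‖bv B θ * h θ - bv f θ‖ * ‖k θ‖ ≤ ε / (2 * M) * M := by gcongr
  have e2 : ‖bv f θ‖ * ‖bv D θ * k θ - bv g θ‖ ≤ (|C| + 1) * (ε / (2 * (|C| + 1))) := by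
    gcongr
    linarith [le_abs_self C]
  have e3 : ε / (2 * M) * M = ε / 2 := by field_simp
  have e4 : (|C| + 1) * (ε / (2 * (|C| + 1))) = ε / 2 := by
    have : |C| + 1 ≠ 0 := by positivity
    field_simp
  linarith

lemma eval {m : ℝ → ℝ} (hm : InnerApprox fun θ => (m θ : ℂ)) (p : Polynomial ℝ) :
    InnerApprox fun θ => ((p.eval (m θ) : ℝ) : ℂ) := by
  induction p using Polynomial.induction_on' with
  | add p q hp hq => simpa using hp.add hq
  | monomial n a =>
    have hpow : InnerApprox fun θ => (m θ : ℂ) ^ n := by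
      induction n with
      | zero => simpa using const 1
      | succ n ih => simpa [pow_succ] using ih.mul hm
    simpa using (const (a : ℂ)).mul hpow

lemma im_mul_conj {I₁ I₂ : ℂ → ℂ} (h₁ : IsInner I₁) (h₂ : IsInner I₂) :
    InnerApprox fun θ => (((bv I₂ θ * (starRingEnd ℂ) (bv I₁ θ)).im : ℝ) : ℂ) := by
  intro ε hε
  have hq := ((h₂.mul h₂).isPseudocont.add
    ((IsPseudocont.const (-1)).mul (h₁.mul h₁).isPseudocont))
  refine ⟨_, _, h₁.mul h₂, (IsPseudocont.const (1 / (2 * I))).mul hq, ?_⟩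
  filter_upwards [h₁.ae_mul_conj, h₂.ae_mul_conj, h₁.bddHol.bv_mul h₂.bddHol,
    h₁.bddHol.bv_mul h₁.bddHol, h₂.bddHol.bv_mul h₂.bddHol, hq.1.bv_const_mul (1 / (2 * I)),
    (h₂.mul h₂).bddHol.bv_add ((h₁.mul h₁).bddHol.const_mul (-1)),
    (h₁.mul h₁).bddHol.bv_const_mul (-1)] with θ a1 a2 a3 a4 a5 a6 a7 a8
  rw [a3, a6, a7, a8, a4, a5]
  have e := im_eq_sub_conj (bv I₂ θ * (starRingEnd ℂ) (bv I₁ θ))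
  rw [e, map_mul, conj_conj]
  have : bv I₁ θ * bv I₂ θ * ((bv I₂ θ * (starRingEnd ℂ) (bv I₁ θ)
      - (starRingEnd ℂ) (bv I₂ θ) * bv I₁ θ)
      / (2 * I)) - 1 / (2 * I) * (bv I₂ θ * bv I₂ θ + -1 * (bv I₁ θ * bv I₁ θ)) = 0 := by
    linear_combination (bv I₂ θ ^ 2 / (2 * I)) * a1 - (bv I₁ θ ^ 2 / (2 * I)) * a2
  rw [this, norm_zero]
  exact hε.le

lemma indicator {E : Set ℝ} (hE : MeasurableSet E) : InnerApprox (E.indicator 1) := by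
  obtain ⟨I₁, I₂, h₁, h₂, hI⟩ := exists_inner_pair hE
  set c := Real.sin (1 / 8)
  have hc : 0 < c := Real.sin_pos_of_pos_of_lt_pi (by norm_num) (by linarith [Real.pi_gt_three])
  refine of_forall_approx fun ε hε => ?_
  set ψ : ℝ → ℝ := fun x => max 0 (min 1 (1 / 2 + x / (2 * c)))
  have hψ : Continuous ψ := by fun_prop
  obtain ⟨p, hp⟩ := exists_polynomial_near_of_continuousOn (-1) 1 ψ hψ.continuousOn ε hε
  refine ⟨_, (im_mul_conj h₁ h₂).eval p, ?_⟩
  filter_upwards [hI, h₁.norm_bv, h₂.norm_bv] with θ hθ n1 n2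
  set m := (bv I₂ θ * (starRingEnd ℂ) (bv I₁ θ)).im
  have hm : |m| ≤ 1 := by
    refine (abs_im_le_norm _).trans ?_
    rw [norm_mul, norm_conj, n1, n2, one_mul]
  have hpm := hp m (abs_le.1 hm)
  have key : E.indicator (1 : ℝ → ℂ) θ = ((ψ m : ℝ) : ℂ) := by
    by_cases h : θ ∈ E
    · have h3 : 1 / 2 ≤ m / (2 * c) := by
        rw [le_div_iff₀ (by positivity)]
        linarith [hθ.1 h]
      have : ψ m = 1 := by
        simp only [ψ]
        rw [min_eq_left (by linarith), max_eq_right zero_le_one]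
      rw [this]
      simp [h]
    · have h3 : m / (2 * c) ≤ -(1 / 2) := by
        rw [div_le_iff₀ (by positivity)]
        linarith [hθ.2 h]
      have : ψ m = 0 := by
        simp only [ψ]
        rw [min_eq_right (by linarith), max_eq_left (by linarith)]
      rw [this]
      simp [h]
  rw [key, ← ofReal_sub, norm_real, Real.norm_eq_abs, abs_sub_comm]
  exact hpm.le

lemma simpleFunc (s : SimpleFunc ℝ ℂ) : InnerApprox s := by
  induction s using SimpleFunc.induction with
  | @const c E hE =>
    refine ((const c).mul (indicator hE)).congr (Eventually.of_forall fun θ => ?_)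
    by_cases h : θ ∈ E <;> simp [h]
  | add _ hf hg => exact hf.add hg

lemma of_bounded (hm : AEStronglyMeasurable h circMeas) {M : ℝ}
    (hM : ∀ᵐ θ ∂circMeas, ‖h θ‖ ≤ M) : InnerApprox h := by
  refine of_forall_approx fun ε hε => ?_
  set e := TopologicalSpace.denseSeq ℂ
  obtain ⟨t, ht⟩ := (isCompact_closedBall (0:ℂ) M).elim_finite_subcover (fun n => ball (e n) ε)
    (fun n => isOpen_ball) (fun x _ => by
      obtain ⟨n, hn⟩ := (TopologicalSpace.denseRange_denseSeq ℂ).exists_dist_lt x hε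
      exact mem_iUnion.2 ⟨n, hn⟩)
  set N := t.sup id
  refine ⟨_, simpleFunc ((SimpleFunc.nearestPt e N).comp (hm.mk h)
    hm.stronglyMeasurable_mk.measurable), ?_⟩
  filter_upwards [hm.ae_eq_mk, hM] with θ h1 h2
  obtain ⟨n, hn, hn'⟩ := mem_iUnion₂.1 (ht (by simpa using h2 : h θ ∈ closedBall (0:ℂ) M))
  have h3 := SimpleFunc.edist_nearestPt_le e (h θ) (k := n) (N := N) (Finset.le_sup (f := id) hn)
  rw [edist_dist, edist_dist, ENNReal.ofReal_le_ofReal_iff dist_nonneg] at h3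
  rw [SimpleFunc.coe_comp, Function.comp_apply, ← h1, ← dist_eq_norm, dist_comm]
  rw [mem_ball, dist_comm] at hn'
  exact h3.trans hn'.le

end InnerApprox

/-- Up to an inner factor, bounded holomorphic functions are uniform limits of functions in
`IsPseudocont`. -/
lemma BddHol.exists_isInner_isPseudocont {f : ℂ → ℂ} (hf : BddHol f) {ε : ℝ} (hε : 0 < ε) :
    ∃ B g : ℂ → ℂ, IsInner B ∧ IsPseudocont g ∧ ∀ z ∈ ball (0:ℂ) 1, ‖g z - B z * f z‖ ≤ ε := by
  obtain ⟨C, hC⟩ := hf.2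
  obtain ⟨B, g, hB, hg, H⟩ := InnerApprox.of_bounded hf.aestronglyMeasurable_bv
    (hf.norm_bv_le hC) ε hε
  refine ⟨B, g, hB, hg, fun z hz => (hg.1.sub (hB.bddHol.mul hf)).norm_le_of_bv ?_ hz⟩
  filter_upwards [H, hg.1.bv_sub (hB.bddHol.mul hf), hB.bddHol.bv_mul hf] with θ h1 h2 h3
  rwa [h2, h3, norm_sub_rev]

lemma norm_taylorCoeff_le {f : ℂ → ℂ} (hf : DifferentiableOn ℂ f (ball 0 1)) {C : ℝ}
    (hC : ∀ z ∈ ball (0:ℂ) 1, ‖f z‖ ≤ C) (n : ℕ) :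
    ‖((n.factorial : ℂ))⁻¹ * iteratedDeriv n f 0‖ ≤ C := by
  have h : ∀ᶠ r : ℝ in 𝓝[<] 1, ‖((n.factorial : ℂ))⁻¹ * iteratedDeriv n f 0‖ ≤ C / r ^ n := by
    filter_upwards [eventually_pos_lt_one] with r hr
    have hsub : closedBall (0:ℂ) r ⊆ ball 0 1 := closedBall_subset_ball hr.2
    have h1 := Complex.norm_iteratedDeriv_le_of_forall_mem_sphere_norm_le n hr.1
      ((hf.mono hsub).diffContOnCl_ball Subset.rfl) fun z hz =>
        hC z (hsub (sphere_subset_closedBall hz))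
    rw [norm_mul, norm_inv, norm_natCast, inv_mul_le_iff₀ (by positivity), ← mul_div_assoc]
    exact h1
  have h2 : Tendsto (fun r : ℝ => C / r ^ n) (𝓝[<] 1) (𝓝 (C / 1 ^ n)) := by
    refine Tendsto.mono_left ?_ nhdsWithin_le_nhds
    exact tendsto_const_nhds.div (tendsto_id.pow n) (by simp)
  rw [one_pow, div_one] at h2
  exact ge_of_tendsto h2 h

/-- Montel's theorem on the disc, with pointwise convergence. -/
lemma exists_subseq_tendsto_holomorphic {F : ℕ → ℂ → ℂ} {C : ℝ}
    (hF : ∀ n, DifferentiableOn ℂ (F n) (ball 0 1)) (hC : ∀ n, ∀ z ∈ ball (0:ℂ) 1, ‖F n z‖ ≤ C) :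
    ∃ (g : ℂ → ℂ) (φ : ℕ → ℕ), DifferentiableOn ℂ g (ball 0 1) ∧ StrictMono φ ∧
      ∀ z ∈ ball (0:ℂ) 1, Tendsto (fun n => F (φ n) z) atTop (𝓝 (g z)) := by
  set a : ℕ → ℕ → ℂ := fun n k => ((k.factorial : ℂ))⁻¹ * iteratedDeriv k (F n) 0
  have ha : ∀ n k, ‖a n k‖ ≤ C := fun n k => norm_taylorCoeff_le (hF n) (hC n) k
  have hcomp : IsCompact (Set.pi univ fun _ : ℕ => closedBall (0:ℂ) C) :=
    isCompact_univ_pi fun _ => isCompact_closedBall _ _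
  obtain ⟨b, hb, φ, hφ, hlim⟩ := hcomp.tendsto_subseq (x := a) fun n k _ => by simpa using ha n k
  have hb' : ∀ k, ‖b k‖ ≤ C := fun k => by simpa using hb k (mem_univ k)
  have hlim' : ∀ k, Tendsto (fun n => a (φ n) k) atTop (𝓝 (b k)) := fun k =>
    (tendsto_pi_nhds.1 hlim k)
  have hsum : ∀ n, ∀ z ∈ ball (0:ℂ) 1, F n z = ∑' k, a n k * z ^ k := by
    intro n z hz
    have := Complex.taylorSeries_eq_on_ball (hF n) hz
    rw [← this]
    refine tsum_congr fun k => ?_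
    simp only [a, smul_eq_mul, sub_zero]
    ring
  have hdom : ∀ c : ℕ → ℂ, (∀ k, ‖c k‖ ≤ C) → ∀ r : ℝ, ∀ z ∈ ball (0:ℂ) r, ∀ k,
      ‖c k * z ^ k‖ ≤ C * r ^ k := by
    intro c hc r z hz k
    rw [norm_mul, norm_pow]
    have : ‖z‖ ≤ r := by simpa using (mem_ball.1 hz).le
    have hC0 := (norm_nonneg _).trans (hc k)
    gcongr
    exact hc k
  have hrz : ∀ z ∈ ball (0:ℂ) 1, ∃ r : ℝ, 0 ≤ r ∧ r < 1 ∧ z ∈ ball (0:ℂ) r := by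
    intro z hz
    obtain ⟨r, h1, h2⟩ := exists_between (by simpa using hz : ‖z‖ < 1)
    exact ⟨r, (norm_nonneg z).trans h1.le, h2, by simpa using h1⟩
  refine ⟨fun z => ∑' k, b k * z ^ k, φ, fun z hz => ?_, hφ, fun z hz => ?_⟩
  · obtain ⟨r, hr0, hr1, hzr⟩ := hrz z hz
    refine (DifferentiableOn.differentiableAt (s := ball 0 r) ?_
      (isOpen_ball.mem_nhds hzr)).differentiableWithinAt
    exact differentiableOn_tsum_of_summable_norm ((summable_geometric_of_lt_one hr0 hr1).mul_left C)
      (fun k => by fun_prop) isOpen_ball fun k w hw => hdom b hb' r w hw k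
  · obtain ⟨r, hr0, hr1, hzr⟩ := hrz z hz
    simp_rw [hsum _ z hz]
    refine tendsto_tsum_of_dominated_convergence
      ((summable_geometric_of_lt_one hr0 hr1).mul_left C) (fun k => (hlim' k).mul_const _)
      (Eventually.of_forall fun n k => hdom _ (ha (φ n)) r z hzr k)

/-- An outer function with two-valued modulus on the circle. -/
lemma exists_outer {E : Set ℝ} (hE : MeasurableSet E) (c₀ c₁ : ℝ) : ∃ p : ℂ → ℂ, BddHol p ∧
    (p 0).re = Real.exp (c₀ + c₁ * ((2 * π)⁻¹ * circMeas.real E)) ∧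
    ∀ᵐ θ ∂circMeas, ‖bv p θ‖ = Real.exp (c₀ + c₁ * E.indicator 1 θ) := by
  obtain ⟨H, hHd, hH, hH0, hHl⟩ := exists_holomorphic_harmonicMeasure hE
  have hcont : Continuous fun h : ℂ => exp (c₀ + c₁ * h) := by fun_prop
  refine ⟨fun z => exp (c₀ + c₁ * H z), ⟨?_, Real.exp (c₀ + |c₁|), fun z hz => ?_⟩, ?_, ?_⟩
  · exact ((differentiableOn_const _).add (hHd.const_mul _)).cexp
  · rw [norm_exp]
    refine Real.exp_le_exp.2 ?_
    rw [add_re, re_ofReal_mul, ofReal_re]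
    have h1 := hH z hz
    have h2 : c₁ * (H z).re ≤ |c₁| * 1 :=
      mul_le_mul (le_abs_self _) h1.2 h1.1 (abs_nonneg _)
    linarith
  · change (exp (c₀ + c₁ * H 0)).re = _
    rw [hH0, ← ofReal_mul, ← ofReal_add, ← ofReal_exp, ofReal_re]
  · filter_upwards [hHl] with θ ⟨L, hL, hLE⟩
    have : HasRadialLim (fun z => exp (c₀ + c₁ * H z)) θ (exp (c₀ + c₁ * L)) :=
      (hcont.tendsto L).comp hL
    rw [this.bv_eq, norm_exp, add_re, re_ofReal_mul, ofReal_re, hLE]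

/-- Among the solutions `q` of `‖k₀ + B q‖ ≤ 1`, one maximizing `re (q 0)`. -/
lemma exists_extremal {k₀ B : ℂ → ℂ} (hk : BddHol k₀)
    (hk1 : ∀ z ∈ ball (0:ℂ) 1, ‖k₀ z‖ ≤ 1) (hB : IsInner B) :
    ∃ q : ℂ → ℂ, BddHol q ∧ (∀ z ∈ ball (0:ℂ) 1, ‖q z‖ ≤ 2) ∧
      (∀ z ∈ ball (0:ℂ) 1, ‖k₀ z + B z * q z‖ ≤ 1) ∧
      ∀ p, BddHol p → (∀ z ∈ ball (0:ℂ) 1, ‖k₀ z + B z * p z‖ ≤ 1) → (p 0).re ≤ (q 0).re := by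
  have h0 : (0:ℂ) ∈ ball (0:ℂ) 1 := by simp
  have hnorm : ∀ p, BddHol p → (∀ z ∈ ball (0:ℂ) 1, ‖k₀ z + B z * p z‖ ≤ 1) →
      ∀ z ∈ ball (0:ℂ) 1, ‖p z‖ ≤ 2 := by
    intro p hp h z hz
    refine hp.norm_le_of_bv ?_ hz
    filter_upwards [hB.norm_bv, hk.norm_bv_le hk1, (hk.add (hB.bddHol.mul hp)).norm_bv_le h,
      hk.bv_add (hB.bddHol.mul hp), hB.bddHol.bv_mul hp] with θ h1 h2 h3 h4 h5
    rw [h4, h5] at h3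
    have e : ‖bv p θ‖ = ‖bv B θ * bv p θ‖ := by rw [norm_mul, h1, one_mul]
    have := norm_sub_le (bv k₀ θ + bv B θ * bv p θ) (bv k₀ θ)
    rw [add_sub_cancel_left] at this
    rw [e]
    linarith
  set S : Set ℝ := {x | ∃ p, BddHol p ∧ (∀ z ∈ ball (0:ℂ) 1, ‖k₀ z + B z * p z‖ ≤ 1) ∧ (p 0).re = x}
  have hS : S.Nonempty := ⟨0, fun _ => 0, BddHol.const 0, by simpa using hk1, by simp⟩
  have hSb : BddAbove S := by
    refine ⟨2, ?_⟩
    rintro x ⟨p, hp, h, rfl⟩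
    exact (re_le_norm _).trans (hnorm p hp h 0 h0)
  obtain ⟨u, -, hu, huS⟩ := exists_seq_tendsto_sSup hS hSb
  choose F hF hF1 hF0 using huS
  obtain ⟨q, φ, hq, hφ, hlim⟩ := exists_subseq_tendsto_holomorphic (fun n => (hF n).1)
    (fun n => hnorm _ (hF n) (hF1 n))
  have hq2 : ∀ z ∈ ball (0:ℂ) 1, ‖q z‖ ≤ 2 := fun z hz =>
    le_of_tendsto (hlim z hz).norm (Eventually.of_forall fun n => hnorm _ (hF _) (hF1 _) z hz)
  refine ⟨q, ⟨hq, 2, hq2⟩, hq2, fun z hz => ?_, fun p hp h => ?_⟩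
  · exact le_of_tendsto (((hlim z hz).const_mul (B z)).const_add (k₀ z)).norm
      (Eventually.of_forall fun n => hF1 _ z hz)
  · have e : (q 0).re = sSup S := by
      refine tendsto_nhds_unique ((continuous_re.tendsto _).comp (hlim 0 h0)) ?_
      refine (hu.comp hφ.tendsto_atTop).congr fun n => ?_
      simp [hF0]
    rw [e]
    exact le_csSup hSb ⟨p, hp, h, rfl⟩

/-- If `‖k₀‖ ≤ 1 - δ` on the disc, some translate of `k₀` by a multiple of the inner function `B` is
inner. -/
lemma exists_isInner_add_mul {k₀ B : ℂ → ℂ} (hk : BddHol k₀) {δ : ℝ} (hδ : 0 < δ)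
    (hk1 : ∀ z ∈ ball (0:ℂ) 1, ‖k₀ z‖ ≤ 1 - δ) (hB : IsInner B) :
    ∃ q : ℂ → ℂ, BddHol q ∧ (∀ z ∈ ball (0:ℂ) 1, ‖q z‖ ≤ 2) ∧
      IsInner fun z => k₀ z + B z * q z := by
  have h0 : (0:ℂ) ∈ ball (0:ℂ) 1 := by simp
  have hδ1 : δ ≤ 1 := by linarith [(norm_nonneg _).trans (hk1 0 h0)]
  obtain ⟨q, hq, hq2, hq1, hmax⟩ :=
    exists_extremal hk (fun z hz => (hk1 z hz).trans (by linarith)) hB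
  refine ⟨q, hq, hq2, ?_⟩
  set k : ℂ → ℂ := fun z => k₀ z + B z * q z with hkdef
  have hkb : BddHol k := hk.add (hB.bddHol.mul hq)
  refine hkb.isInner ?_
  by_contra hcon
  have hmeas := hkb.aestronglyMeasurable_bv
  set b := hmeas.mk (bv k)
  have hbm : Measurable b := hmeas.stronglyMeasurable_mk.measurable
  have hbe : bv k =ᵐ[circMeas] b := hmeas.ae_eq_mk
  have hle : ∀ᵐ θ ∂circMeas, ‖bv k θ‖ ≤ 1 := hkb.norm_bv_le hq1
  obtain ⟨η, hη, hEpos⟩ : ∃ η > (0:ℝ), circMeas {θ | ‖b θ‖ ≤ 1 - η} ≠ 0 := by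
    by_contra! hall
    apply hcon
    have : ∀ᵐ θ ∂circMeas, ∀ n : ℕ, ¬ ‖b θ‖ ≤ 1 - 1 / ((n:ℝ) + 1) := by
      rw [ae_all_iff]
      intro n
      have := hall (1 / ((n:ℝ) + 1)) (by positivity)
      rw [ae_iff]
      simpa using this
    filter_upwards [this, hbe, hle] with θ h1 h2 h3
    refine le_antisymm h3 ?_
    rw [h2]
    refine le_of_tendsto (x := atTop) (f := fun n : ℕ => 1 - 1 / ((n:ℝ) + 1)) ?_
      (Eventually.of_forall fun n => (not_le.1 (h1 n)).le)
    simpa using tendsto_one_div_add_atTop_nhds_zero_nat.const_sub (1:ℝ)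
  set E : Set ℝ := {θ | ‖b θ‖ ≤ 1 - η}
  have hE : MeasurableSet E := measurableSet_le hbm.norm measurable_const
  have hEr : 0 < circMeas.real E := by
    rw [measureReal_def]
    exact ENNReal.toReal_pos hEpos (measure_ne_top _ _)
  set a := (2 * π)⁻¹ * circMeas.real E
  have ha : 0 < a := by positivity
  set η' := min η δ
  have hη' : 0 < η' := lt_min hη hδ
  set X := (3 / δ) ^ (1 / a)
  have h3δ : 1 ≤ 3 / δ := by rw [le_div_iff₀ hδ]; linarith
  have hX1 : 1 ≤ X := Real.one_le_rpow h3δ (by positivity)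
  have hX0 : 0 < X := by linarith
  have hXa : X ^ a = 3 / δ := by
    rw [← Real.rpow_mul (by positivity), one_div_mul_cancel ha.ne', Real.rpow_one]
  set t := η' / (δ * X)
  have ht0 : 0 < t := by positivity
  have ht1 : t ≤ 1 := by
    rw [div_le_one (by positivity)]
    calc η' ≤ δ * 1 := by rw [mul_one]; exact min_le_right _ _
      _ ≤ δ * X := by gcongr
  have htX : η' = t * δ * X := by simp only [t]; field_simp
  obtain ⟨p, hp, hp0, hpb⟩ := exists_outer hE (Real.log (t * δ)) (Real.log X)
  have hp0' : (p 0).re = 3 * t := by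
    rw [hp0, Real.exp_add, Real.exp_log (by positivity), ← Real.rpow_def_of_pos hX0, hXa]
    field_simp
  have hq' : BddHol fun z => ((1 - t : ℝ) : ℂ) * q z + p z := (hq.const_mul _).add hp
  have hfin := hmax _ hq' (fun z hz => by
    refine (hk.add (hB.bddHol.mul hq')).norm_le_of_bv ?_ hz
    have e : EqOn (fun z => k₀ z + B z * (((1 - t : ℝ) : ℂ) * q z + p z))
        (fun z => ((1 - t : ℝ) : ℂ) * k z + ((t : ℂ) * k₀ z + B z * p z)) (ball 0 1) := by
      intro z _
      simp only [hkdef]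
      push_cast
      ring
    have hE1 : ∀ᵐ θ ∂circMeas, bv (fun z => k₀ z + B z * (((1 - t : ℝ) : ℂ) * q z + p z)) θ =
        bv (fun z => ((1 - t : ℝ) : ℂ) * k z + ((t : ℂ) * k₀ z + B z * p z)) θ := by
      have hb2 := (hkb.const_mul (1 - t : ℝ)).add ((hk.const_mul t).add (hB.bddHol.mul hp))
      filter_upwards [hb2.bv_lim] with θ h
      exact (HasRadialLim.congr h e.symm).bv_eq
    filter_upwards [hE1, (hkb.const_mul (1 - t : ℝ)).bv_add
      ((hk.const_mul t).add (hB.bddHol.mul hp)),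
      (hk.const_mul t).bv_add (hB.bddHol.mul hp), hkb.bv_const_mul (1 - t : ℝ), hk.bv_const_mul t,
      hB.bddHol.bv_mul hp, hpb, hB.norm_bv, hle, hbe, hk.norm_bv_le hk1]
      with θ e1 e2 e3 e4 e5 e6 e7 e8 e9 e10 e11
    rw [e1, e2, e3, e4, e5, e6]
    have n1 : ‖((1 - t : ℝ) : ℂ) * bv k θ‖ = (1 - t) * ‖bv k θ‖ := by
      rw [norm_mul, norm_real, Real.norm_of_nonneg (by linarith)]
    have n2 : ‖(t : ℂ) * bv k₀ θ‖ = t * ‖bv k₀ θ‖ := by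
      rw [norm_mul, norm_real, Real.norm_of_nonneg ht0.le]
    have n3 : ‖bv B θ * bv p θ‖ = ‖bv p θ‖ := by rw [norm_mul, e8, one_mul]
    have tri : ‖((1 - t : ℝ) : ℂ) * bv k θ + ((t : ℂ) * bv k₀ θ + bv B θ * bv p θ)‖ ≤
        (1 - t) * ‖bv k θ‖ + (t * ‖bv k₀ θ‖ + ‖bv p θ‖) := by
      refine (norm_add_le _ _).trans ?_
      rw [n1]
      gcongr
      refine (norm_add_le _ _).trans ?_
      rw [n2, n3]
    refine tri.trans ?_
    have m2 : t * ‖bv k₀ θ‖ ≤ t * (1 - δ) := by gcongr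
    by_cases hθ : θ ∈ E
    · have hθ' : ‖bv k θ‖ ≤ 1 - η := by rw [e10]; exact hθ
      have m1 : (1 - t) * ‖bv k θ‖ ≤ (1 - t) * (1 - η) :=
        mul_le_mul_of_nonneg_left hθ' (by linarith)
      have m3 : ‖bv p θ‖ = η' := by
        rw [e7, indicator_of_mem hθ, Pi.one_apply, mul_one, Real.exp_add,
          Real.exp_log (by positivity), Real.exp_log hX0, htX]
      have m4 : η' ≤ η := min_le_left _ _
      have m5 : η' ≤ δ := min_le_right _ _
      nlinarith
    · have m1 : (1 - t) * ‖bv k θ‖ ≤ (1 - t) * 1 :=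
        mul_le_mul_of_nonneg_left e9 (by linarith)
      have m3 : ‖bv p θ‖ = t * δ := by
        rw [e7, indicator_of_notMem hθ, mul_zero, add_zero, Real.exp_log (by positivity)]
      nlinarith)
  have e : ((((1 - t : ℝ) : ℂ) * q 0 + p 0)).re = (1 - t) * (q 0).re + 3 * t := by
    rw [add_re, re_ofReal_mul, hp0']
  rw [e] at hfin
  have hq0 := (re_le_norm _).trans (hq2 0 h0)
  nlinarith

/-! ### Density of pseudocontinuable functions and Bernard's averaging -/

lemma IsPseudocont.of_inner_mul {F B : ℂ → ℂ} (hF : BddHol F) (hB : IsInner B)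
    (h : IsPseudocont fun z => B z * F z) : IsPseudocont F := by
  obtain ⟨-, Ω, g', hΩ, hg', hgg⟩ := h
  refine ⟨hF, Ω, fun z => B z * g' z, hΩ, hB.bddHol.mul hg', ?_⟩
  filter_upwards [hgg, hB.ae_mul_conj, hB.bddHol.bv_mul hF, hB.bddHol.bv_mul hg']
    with θ h1 h2 h3 h4
  rw [h4, h1, h3, map_mul]
  linear_combination bv Ω θ * (starRingEnd ℂ) (bv F θ) * h2

lemma BddHol.exists_isPseudocont_approx {f : ℂ → ℂ} (hf : BddHol f) {ε : ℝ} (hε : 0 < ε) :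
    ∃ F, IsPseudocont F ∧ ∀ z ∈ ball (0:ℂ) 1, ‖F z - f z‖ ≤ ε := by
  obtain ⟨δ, rfl⟩ : ∃ δ, ε = 2 * δ := ⟨ε / 2, by ring⟩
  have hδ : 0 < δ := by linarith
  have hδ' : (δ : ℂ) ≠ 0 := by exact_mod_cast hδ.ne'
  obtain ⟨B, g, hB, hg, H⟩ := hf.exists_isInner_isPseudocont (half_pos hδ)
  obtain ⟨q, hq, hq2, hu⟩ := exists_isInner_add_mul (k₀ := fun z => (δ : ℂ)⁻¹ * (g z - B z * f z))
    ((hg.1.sub (hB.bddHol.mul hf)).const_mul _) (δ := 1 / 2) (by norm_num) (fun z hz => by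
      rw [norm_mul, norm_inv, norm_real, Real.norm_of_nonneg hδ.le, inv_mul_le_iff₀ hδ]
      linarith [H z hz]) hB
  refine ⟨fun z => f z - δ * q z, ?_, fun z hz => ?_⟩
  · refine IsPseudocont.of_inner_mul (hf.sub (hq.const_mul _)) hB ?_
    have := hg.add ((IsPseudocont.const (-(δ : ℂ))).mul hu.isPseudocont)
    convert this using 2 with z
    field_simp
    ring
  · rw [sub_sub_cancel_left, norm_neg, norm_mul, norm_real, Real.norm_of_nonneg hδ.le]
    nlinarith [hq2 z hz]

lemma IsPrimitiveRoot.sum_pow_mul {ζ : ℂ} {N : ℕ} (hζ : IsPrimitiveRoot ζ N) (k : ℕ) :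
    ∑ j ∈ Finset.range N, (ζ ^ j) ^ k = if N ∣ k then (N : ℂ) else 0 := by
  have e : ∀ j, (ζ ^ j) ^ k = (ζ ^ k) ^ j := fun j => by rw [← pow_mul, ← pow_mul, mul_comm]
  simp_rw [e]
  split_ifs with h
  · simp [(hζ.pow_eq_one_iff_dvd k).2 h]
  · have h1 : ζ ^ k ≠ 1 := fun h' => h ((hζ.pow_eq_one_iff_dvd k).1 h')
    rw [geom_sum_eq h1, ← pow_mul, mul_comm, pow_mul, hζ.pow_eq_one, one_pow, sub_self, zero_div]

lemma IsPrimitiveRoot.sum_moebius {ζ : ℂ} {N : ℕ} (hζ : IsPrimitiveRoot ζ N) (hN : N ≠ 0)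
    (a b : ℂ) {c : ℂ} (hc : ‖c‖ < 1) :
    ∑ j ∈ Finset.range N, (a + ζ ^ j * b) / (1 + ζ ^ j * c) =
      N * (a + b * (-c) ^ (N - 1)) / (1 - (-c) ^ N) := by
  have hζ1 : ‖ζ‖ = 1 := hζ.norm'_eq_one hN
  have hne : ∀ j : ℕ, 1 + ζ ^ j * c ≠ 0 := by
    intro j h
    have h1 : ζ ^ j * c = -1 := by linear_combination h
    have := congrArg norm h1
    rw [norm_mul, norm_pow, hζ1, one_pow, one_mul, norm_neg, norm_one] at this
    linarith
  have hD : 1 - (-c) ^ N ≠ 0 := by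
    intro h
    have := congrArg norm (sub_eq_zero.1 h)
    rw [norm_one, norm_pow, norm_neg] at this
    linarith [pow_lt_one₀ (norm_nonneg c) hc hN]
  rw [eq_div_iff hD, Finset.sum_mul]
  have e : ∀ j, (a + ζ ^ j * b) / (1 + ζ ^ j * c) * (1 - (-c) ^ N) =
      ∑ k ∈ Finset.range N, (a * (-c) ^ k * (ζ ^ j) ^ k + b * (-c) ^ k * (ζ ^ j) ^ (k + 1)) := by
    intro j
    have h1 := mul_neg_geom_sum (-c * ζ ^ j) N
    rw [mul_pow _ _ N, ← pow_mul, mul_comm j N, pow_mul, hζ.pow_eq_one, one_pow, mul_one] at h1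
    rw [← h1, div_mul_eq_mul_div, div_eq_iff (hne j)]
    have h2 : ∑ k ∈ Finset.range N, (a * (-c) ^ k * (ζ ^ j) ^ k + b * (-c) ^ k * (ζ ^ j) ^ (k + 1))
        = (a + ζ ^ j * b) * ∑ k ∈ Finset.range N, (-c * ζ ^ j) ^ k := by
      rw [Finset.mul_sum]
      refine Finset.sum_congr rfl fun k _ => ?_
      rw [mul_pow]; ring
    rw [h2]; ring
  simp_rw [e]
  rw [Finset.sum_comm]
  simp_rw [Finset.sum_add_distrib, ← Finset.mul_sum, hζ.sum_pow_mul]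
  have s1 : ∑ k ∈ Finset.range N, a * (-c) ^ k * (if N ∣ k then (N : ℂ) else 0) = a * N := by
    rw [Finset.sum_eq_single_of_mem 0 (by simpa using Nat.pos_of_ne_zero hN)]
    · simp
    · intro k hk hk0
      rw [if_neg fun h => hk0 (Nat.eq_zero_of_dvd_of_lt h (Finset.mem_range.1 hk)), mul_zero]
  have s2 : ∑ k ∈ Finset.range N, b * (-c) ^ k * (if N ∣ k + 1 then (N : ℂ) else 0) =
      b * (-c) ^ (N - 1) * N := by
    rw [Finset.sum_eq_single_of_mem (N - 1) (by simp; omega)]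
    · rw [if_pos (by rw [Nat.sub_add_cancel (Nat.pos_of_ne_zero hN)])]
    · intro k hk hk0
      have := Finset.mem_range.1 hk
      rw [if_neg fun h => hk0 (by have := Nat.le_of_dvd (by omega) h; omega), mul_zero]
  rw [s1, s2]; ring

lemma norm_add_mul_eq {F Ω w : ℂ} (hΩ : ‖Ω‖ = 1) (hw : ‖w‖ = 1) :
    ‖F + w * Ω‖ = ‖1 + w * (Ω * (starRingEnd ℂ) F)‖ := by
  have h : ∀ x : ℂ, ‖x‖ = 1 → x * (starRingEnd ℂ) x = 1 := fun x hx => by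
    rw [mul_conj, normSq_eq_norm_sq, hx]; simp
  have e : 1 + w * (Ω * (starRingEnd ℂ) F) = w * Ω * (starRingEnd ℂ) (F + w * Ω) := by
    rw [map_add, map_mul]
    linear_combination (-(1:ℂ)) * h w hw - w * (starRingEnd ℂ) w * h Ω hΩ
  rw [e, norm_mul, norm_mul, hΩ, hw, RCLike.norm_conj]
  ring

lemma isInner_moebius {F Ω F' : ℂ → ℂ} (hF : BddHol F) (hΩ : IsInner Ω) (hF' : BddHol F')
    (hbv : ∀ᵐ θ ∂circMeas, bv F' θ = bv Ω θ * (starRingEnd ℂ) (bv F θ)) {ρ : ℝ} (hρ : ρ < 1)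
    (hFρ : ∀ z ∈ ball (0:ℂ) 1, ‖F' z‖ ≤ ρ) {w : ℂ} (hw : ‖w‖ = 1) :
    IsInner fun z => (F z + w * Ω z) / (1 + w * F' z) := by
  have hlow : ∀ z ∈ ball (0:ℂ) 1, 1 - ρ ≤ ‖1 + w * F' z‖ := fun z hz => by
    have h1 := norm_sub_norm_le (1:ℂ) (-(w * F' z))
    rw [norm_neg, norm_mul, hw, one_mul, norm_one, sub_neg_eq_add] at h1
    linarith [hFρ z hz]
  have hne : ∀ z ∈ ball (0:ℂ) 1, 1 + w * F' z ≠ 0 := fun z hz =>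
    norm_pos_iff.1 (lt_of_lt_of_le (by linarith) (hlow z hz))
  have hden : BddHol fun z => 1 + w * F' z := (BddHol.const 1).add (hF'.const_mul w)
  have hnum : BddHol fun z => F z + w * Ω z := hF.add (hΩ.bddHol.const_mul w)
  have hinv : BddHol fun z => (1 + w * F' z)⁻¹ := by
    refine ⟨hden.1.inv hne, (1 - ρ)⁻¹, fun z hz => ?_⟩
    rw [norm_inv]
    exact inv_anti₀ (by linarith) (hlow z hz)
  have hφ : BddHol fun z => (F z + w * Ω z) / (1 + w * F' z) := hnum.mul hinv
  refine hφ.isInner ?_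
  have hprod : ∀ᵐ θ ∂circMeas, bv (fun z => F z + w * Ω z) θ =
      bv (fun z => (F z + w * Ω z) / (1 + w * F' z)) θ * bv (fun z => 1 + w * F' z) θ := by
    filter_upwards [hφ.bv_mul hden, (hφ.mul hden).bv_lim] with θ h1 h2
    rw [← h1]
    exact (h2.congr fun z hz => div_mul_cancel₀ _ (hne z hz)).bv_eq
  filter_upwards [hprod, hF.bv_add (hΩ.bddHol.const_mul w), hΩ.bddHol.bv_const_mul w,
    (BddHol.const 1).bv_add (hF'.const_mul w), hF'.bv_const_mul w, hbv, hΩ.norm_bv,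
    hF'.norm_bv_le hFρ] with θ h1 h2 h3 h4 h5 h6 h7 h8
  rw [h2, h3, h4, h5, bv_const] at h1
  have h9 := congrArg norm h1
  rw [norm_mul, norm_add_mul_eq h7 hw, ← h6] at h9
  have h10 := norm_sub_norm_le (1:ℂ) (-(w * bv F' θ))
  rw [norm_neg, norm_mul, hw, one_mul, norm_one, sub_neg_eq_add] at h10
  have h11 : 0 < ‖1 + w * bv F' θ‖ := by linarith
  exact (mul_eq_right₀ h11.ne').1 h9.symm

lemma IsPseudocont.exists_average_isInner {F : ℂ → ℂ} (hF : IsPseudocont F) {ρ : ℝ} (hρ : ρ < 1)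
    (hFρ : ∀ z ∈ ball (0:ℂ) 1, ‖F z‖ ≤ ρ) {ε : ℝ} (hε : 0 < ε) :
    ∃ (N : ℕ) (φ : Fin N → ℂ → ℂ), N ≠ 0 ∧ (∀ j, IsInner (φ j)) ∧
      ∀ z ∈ ball (0:ℂ) 1, ‖(∑ j, ((N:ℝ)⁻¹ : ℝ) * φ j z) - F z‖ ≤ ε := by
  obtain ⟨hF, Ω, F', hΩ, hF', hbv⟩ := hF
  have hρ0 : 0 ≤ ρ := (norm_nonneg _).trans (hFρ 0 (by simp))
  have hF'ρ : ∀ z ∈ ball (0:ℂ) 1, ‖F' z‖ ≤ ρ := fun z hz => by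
    refine hF'.norm_le_of_bv ?_ hz
    filter_upwards [hbv, hF.norm_bv_le hFρ, hΩ.norm_bv] with θ h1 h2 h3
    rw [h1, norm_mul, h3, one_mul, RCLike.norm_conj]
    exact h2
  obtain ⟨M, hM⟩ := exists_pow_lt_of_lt_one (show 0 < ε * (1 - ρ) / 2 by
    have : 0 < 1 - ρ := by linarith
    positivity) hρ
  have hζ := Complex.isPrimitiveRoot_exp (M + 1) (Nat.succ_ne_zero M)
  set ζ := Complex.exp (2 * π * I / ((M + 1 : ℕ) : ℂ))
  have hζ1 : ‖ζ‖ = 1 := hζ.norm'_eq_one (Nat.succ_ne_zero M)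
  refine ⟨M + 1, fun j z => (F z + ζ ^ (j : ℕ) * Ω z) / (1 + ζ ^ (j : ℕ) * F' z),
    Nat.succ_ne_zero M,
    fun j => isInner_moebius hF hΩ hF' hbv hρ hF'ρ (by rw [norm_pow, hζ1, one_pow]), ?_⟩
  intro z hz
  have hc := (hF'ρ z hz).trans_lt hρ
  rw [← Finset.mul_sum, Fin.sum_univ_eq_sum_range
    (fun j => (F z + ζ ^ j * Ω z) / (1 + ζ ^ j * F' z)),
    hζ.sum_moebius (Nat.succ_ne_zero M) _ _ hc]
  have hx : ‖(-F' z) ^ (M + 1)‖ ≤ ρ ^ (M + 1) := by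
    rw [norm_pow, norm_neg]; exact pow_le_pow_left₀ (norm_nonneg _) (hF'ρ z hz) _
  have hx' : ‖(-F' z) ^ M‖ ≤ ρ ^ M := by
    rw [norm_pow, norm_neg]; exact pow_le_pow_left₀ (norm_nonneg _) (hF'ρ z hz) _
  have hρM : ρ ^ (M + 1) ≤ ρ ^ M := pow_le_pow_of_le_one hρ0 hρ.le (Nat.le_succ M)
  have hρM1 : ρ ^ (M + 1) ≤ ρ := pow_le_of_le_one hρ0 hρ.le (Nat.succ_ne_zero M)
  have hD : 1 - ρ ≤ ‖1 - (-F' z) ^ (M + 1)‖ := by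
    have := norm_sub_norm_le (1:ℂ) ((-F' z) ^ (M + 1))
    rw [norm_one] at this
    linarith
  have hD0 : 1 - (-F' z) ^ (M + 1) ≠ 0 := norm_pos_iff.1 (lt_of_lt_of_le (by linarith) hD)
  have hN0 : ((M + 1 : ℕ) : ℂ) ≠ 0 := Nat.cast_ne_zero.2 (Nat.succ_ne_zero M)
  have e : (((((M + 1 : ℕ):ℝ)⁻¹ : ℝ) : ℂ)) * (((M + 1 : ℕ) : ℂ) *
      (F z + Ω z * (-F' z) ^ (M + 1 - 1)) / (1 - (-F' z) ^ (M + 1))) - F z =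
      (Ω z * (-F' z) ^ M + F z * (-F' z) ^ (M + 1)) / (1 - (-F' z) ^ (M + 1)) := by
    rw [ofReal_inv, ofReal_natCast, Nat.add_sub_cancel]
    field_simp
    ring
  rw [e, norm_div, div_le_iff₀ (lt_of_lt_of_le (by linarith) hD)]
  have b1 : ‖Ω z * (-F' z) ^ M + F z * (-F' z) ^ (M + 1)‖ ≤ 1 * ρ ^ M + 1 * ρ ^ M := by
    refine (norm_add_le _ _).trans (add_le_add ?_ ?_)
    · rw [norm_mul]
      exact mul_le_mul (hΩ.norm_le_one hz) hx' (norm_nonneg _) zero_le_one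
    · rw [norm_mul]
      exact mul_le_mul ((hFρ z hz).trans hρ.le) (hx.trans hρM) (norm_nonneg _) zero_le_one
  have b2 : ε * (1 - ρ) ≤ ε * ‖1 - (-F' z) ^ (M + 1)‖ := mul_le_mul_of_nonneg_left hD hε.le
  linarith

/-! ### Dividing out zeros -/

/-- A Möbius automorphism of the disc exchanging `a` and `0`. -/
noncomputable def discMoebius (a z : ℂ) : ℂ := (a - z) / (1 - (starRingEnd ℂ) a * z)

lemma one_sub_conj_mul_ne_zero {a z : ℂ} (ha : ‖a‖ < 1) (hz : z ∈ ball (0:ℂ) 1) :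
    1 - (starRingEnd ℂ) a * z ≠ 0 := by
  intro h
  have h1 := congrArg norm (sub_eq_zero.1 h)
  rw [norm_one, norm_mul, RCLike.norm_conj] at h1
  have h2 := mem_ball_zero_iff.1 hz
  nlinarith [norm_nonneg a, norm_nonneg z]

lemma isInner_id : IsInner fun z => z := by
  have h : BddHol fun z => z := ⟨differentiableOn_id, 1, fun z hz => (mem_ball_zero_iff.1 hz).le⟩
  refine h.isInner (Eventually.of_forall fun θ => ?_)
  have h1 : HasRadialLim (fun z => z) θ (Complex.exp (θ * I)) := by
    have h2 : Continuous fun r : ℝ => (r : ℂ) * Complex.exp (θ * I) := by fun_prop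
    have h3 := (h2.tendsto 1).mono_left (nhdsWithin_le_nhds (s := Iio 1))
    rw [ofReal_one, one_mul] at h3
    exact h3
  rw [h1.bv_eq, norm_exp_ofReal_mul_I]

lemma isInner_discMoebius {a : ℂ} (ha : ‖a‖ < 1) : IsInner (discMoebius a) := by
  have h := isInner_moebius (F := fun _ => a) (Ω := fun z => z)
    (F' := fun z => (starRingEnd ℂ) a * z) (BddHol.const a) isInner_id
    (isInner_id.bddHol.const_mul _) (by
      filter_upwards [isInner_id.bddHol.bv_const_mul ((starRingEnd ℂ) a)] with θ h
      rw [h, bv_const, mul_comm]) ha (fun z hz => by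
      rw [norm_mul, RCLike.norm_conj]
      exact mul_le_of_le_one_right (norm_nonneg a) (mem_ball_zero_iff.1 hz).le)
    (w := -1) (by simp)
  convert h using 2 with z
  simp only [discMoebius]
  ring

lemma exists_eq_discMoebius_mul {ψ : ℂ → ℂ} (hψ : DifferentiableOn ℂ ψ (ball 0 1))
    (h1 : ∀ z ∈ ball (0:ℂ) 1, ‖ψ z‖ ≤ 1) {a : ℂ} (ha : ‖a‖ < 1) (h0 : ψ a = 0) :
    ∃ g, DifferentiableOn ℂ g (ball 0 1) ∧ (∀ z ∈ ball (0:ℂ) 1, ‖g z‖ ≤ 1) ∧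
      ∀ z ∈ ball (0:ℂ) 1, ψ z = discMoebius a z * g z := by
  have ha' : a ∈ ball (0:ℂ) 1 := mem_ball_zero_iff.2 ha
  have hd : 0 < 1 - ‖a‖ := by linarith
  have hsub : ball a (1 - ‖a‖) ⊆ ball 0 1 := ball_subset_ball' (by rw [dist_zero_right]; linarith)
  have hds : DifferentiableOn ℂ (dslope ψ a) (ball 0 1) :=
    (Complex.differentiableOn_dslope (isOpen_ball.mem_nhds ha')).2 hψ
  have hds' : BddHol (dslope ψ a) := by
    refine ⟨hds, 1 / (1 - ‖a‖), fun z hz => ?_⟩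
    by_cases hz' : z ∈ ball a (1 - ‖a‖)
    · exact Complex.norm_dslope_le_div_of_mapsTo_ball (hψ.mono hsub) (fun w hw => by
        rw [h0, mem_closedBall_zero_iff]; exact h1 w (hsub hw)) hz'
    · have h2 : 1 - ‖a‖ ≤ ‖z - a‖ := by rw [← dist_eq_norm]; simpa using hz'
      have h3 := congrArg norm (sub_smul_dslope ψ a z)
      rw [h0, sub_zero, norm_smul] at h3
      rw [le_div_iff₀ hd]
      nlinarith [norm_nonneg (dslope ψ a z), h1 z hz]
  set g : ℂ → ℂ := fun z => ((-1) + (starRingEnd ℂ) a * z) * dslope ψ a z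
  have hg : BddHol g :=
    ((BddHol.const (-1)).add (isInner_id.bddHol.const_mul _)).mul hds'
  have heq : ∀ z ∈ ball (0:ℂ) 1, ψ z = discMoebius a z * g z := by
    intro z hz
    have h3 := sub_smul_dslope ψ a z
    rw [h0, sub_zero, smul_eq_mul] at h3
    have := one_sub_conj_mul_ne_zero ha hz
    simp only [discMoebius, g]
    rw [← h3, div_mul_eq_mul_div, eq_div_iff this]
    ring
  refine ⟨g, hg.1, fun z hz => hg.norm_le_of_bv ?_ hz, heq⟩
  have hM := isInner_discMoebius ha
  have hψb : BddHol ψ := ⟨hψ, 1, h1⟩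
  filter_upwards [hM.norm_bv, hM.bddHol.bv_mul hg, hψb.norm_bv_le h1, hψb.bv_lim] with θ e1 e2 e3 e4
  rw [(e4.congr heq).bv_eq] at e2
  rwa [e2, norm_mul, e1, one_mul] at e3

lemma differentiableOn_discMoebius {a : ℂ} (ha : ‖a‖ < 1) :
    DifferentiableOn ℂ (discMoebius a) (ball 0 1) := (isInner_discMoebius ha).1

lemma analyticOrderAt_discMoebius {a w : ℂ} (ha : ‖a‖ < 1) (hw : w ∈ ball (0:ℂ) 1) :
    analyticOrderAt (discMoebius a) w = if a = w then 1 else 0 := by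
  have han : AnalyticAt ℂ (discMoebius a) w :=
    (differentiableOn_discMoebius ha).analyticAt (isOpen_ball.mem_nhds hw)
  have hne := one_sub_conj_mul_ne_zero ha hw
  split_ifs with h
  · subst h
    rw [← Nat.cast_one, han.analyticOrderAt_eq_natCast]
    refine ⟨fun z => -(1 - (starRingEnd ℂ) a * z)⁻¹, ?_, neg_ne_zero.2 (inv_ne_zero hne), ?_⟩
    · have : AnalyticAt ℂ (fun z => 1 - (starRingEnd ℂ) a * z) a := by fun_prop
      exact (this.inv hne).neg
    · refine Eventually.of_forall fun z => ?_
      simp only [discMoebius, smul_eq_mul, pow_one]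
      ring
  · rw [han.analyticOrderAt_eq_zero]
    exact div_ne_zero (sub_ne_zero.2 h) hne

lemma exists_eq_prod_discMoebius_mul {φ : ℂ → ℂ} (hφ : DifferentiableOn ℂ φ (ball 0 1))
    (h1 : ∀ z ∈ ball (0:ℂ) 1, ‖φ z‖ ≤ 1) {ι : Type} [DecidableEq ι] {a : ι → ℂ}
    (ha : ∀ i, ‖a i‖ < 1)
    (hcount : ∀ w ∈ ball (0:ℂ) 1, ∀ s : Finset ι,
      ((s.filter (a · = w)).card : ℕ∞) ≤ analyticOrderAt φ w) (s : Finset ι) :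
    ∃ ψ, DifferentiableOn ℂ ψ (ball 0 1) ∧ (∀ z ∈ ball (0:ℂ) 1, ‖ψ z‖ ≤ 1) ∧
      (∀ z ∈ ball (0:ℂ) 1, φ z = (∏ i ∈ s, discMoebius (a i) z) * ψ z) ∧
      ∀ w ∈ ball (0:ℂ) 1,
        analyticOrderAt φ w = (s.filter (a · = w)).card + analyticOrderAt ψ w := by
  induction s using Finset.induction_on with
  | empty => exact ⟨φ, hφ, h1, by simp, by simp⟩
  | insert i s hi ih =>
    obtain ⟨ψ, hψ, hψ1, heq, hord⟩ := ih
    have hai : a i ∈ ball (0:ℂ) 1 := mem_ball_zero_iff.2 (ha i)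
    have hψ0 : ψ (a i) = 0 := by
      by_contra hne
      have e1 := hord _ hai
      have e2 := hcount _ hai (insert i s)
      rw [Finset.filter_insert, if_pos rfl, Finset.card_insert_of_notMem (by simp [hi]), e1,
        (hψ.analyticAt (isOpen_ball.mem_nhds hai)).analyticOrderAt_eq_zero.2 hne, add_zero,
        Nat.cast_le] at e2
      omega
    obtain ⟨g, hg, hg1, hgeq⟩ := exists_eq_discMoebius_mul hψ hψ1 (ha i) hψ0
    refine ⟨g, hg, hg1, fun z hz => ?_, fun w hw => ?_⟩
    · rw [Finset.prod_insert hi, heq z hz, hgeq z hz]; ring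
    · have hnhds := isOpen_ball.mem_nhds hw
      have e3 : ψ =ᶠ[𝓝 w] discMoebius (a i) * g := by
        filter_upwards [hnhds] with z hz using hgeq z hz
      rw [hord w hw, analyticOrderAt_congr e3,
        analyticOrderAt_mul ((differentiableOn_discMoebius (ha i)).analyticAt hnhds)
          (hg.analyticAt hnhds), analyticOrderAt_discMoebius (ha i) hw, Finset.filter_insert]
      split_ifs with h
      · rw [Finset.card_insert_of_notMem (by simp [hi])]
        push_cast
        ring
      · rw [zero_add]

lemma exists_eq_pow_mul {φ : ℂ → ℂ} (hφ : DifferentiableOn ℂ φ (ball 0 1))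
    (h1 : ∀ z ∈ ball (0:ℂ) 1, ‖φ z‖ ≤ 1) {m : ℕ} (hm : analyticOrderAt φ 0 = m) :
    ∃ ψ, DifferentiableOn ℂ ψ (ball 0 1) ∧ (∀ z ∈ ball (0:ℂ) 1, ‖ψ z‖ ≤ 1) ∧
      (∀ z ∈ ball (0:ℂ) 1, φ z = z ^ m * ψ z) ∧ ψ 0 ≠ 0 := by
  have h0 : (0:ℂ) ∈ ball (0:ℂ) 1 := by simp
  obtain ⟨ψ, hψ, hψ1, heq, hord⟩ := exists_eq_prod_discMoebius_mul hφ h1 (ι := Fin m)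
    (a := fun _ => 0) (by simp) (fun w hw s => by
      by_cases hw0 : (0:ℂ) = w
      · subst hw0
        rw [hm]
        simpa using s.card_le_univ
      · simp [hw0]) Finset.univ
  refine ⟨fun z => (-1) ^ m * ψ z, hψ.const_mul _, fun z hz => by simpa using hψ1 z hz,
    fun z hz => ?_, ?_⟩
  · rw [heq z hz]
    simp [discMoebius, neg_pow z m]
    ring
  · have := hord 0 h0
    rw [hm] at this
    simp only [Finset.filter_true, Finset.card_univ, Fintype.card_fin] at this
    have h2 : analyticOrderAt ψ 0 = 0 := by
      have h3 : analyticOrderAt ψ 0 ≠ ⊤ := by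
        intro h; rw [h] at this; simp at this
      obtain ⟨k, hk⟩ := ENat.ne_top_iff_exists.1 h3
      rw [← hk] at this ⊢
      norm_cast at this ⊢
      omega
    have h3 := (hψ.analyticAt (isOpen_ball.mem_nhds h0)).analyticOrderAt_eq_zero.1 h2
    exact mul_ne_zero (pow_ne_zero _ (by norm_num)) h3

/-! ### A criterion for being a Blaschke product -/

lemma circleAverage_mono_of_countable {u v : ℂ → ℝ} {r : ℝ} (hr : 0 < r)
    (hu : CircleIntegrable u 0 r) (hv : CircleIntegrable v 0 r) {S : Set ℂ} (hS : S.Countable)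
    (h : ∀ z ∈ sphere (0:ℂ) r, z ∉ S → u z ≤ v z) :
    Real.circleAverage u 0 r ≤ Real.circleAverage v 0 r := by
  rw [Real.circleAverage_def, Real.circleAverage_def]
  refine smul_le_smul_of_nonneg_left ?_ (by positivity)
  refine intervalIntegral.integral_mono_ae (by positivity) hu hv ?_
  have hnull := (hS.preimage_circleMap 0 hr.ne').ae_notMem volume
  filter_upwards [hnull] with θ hθ
  exact h _ (circleMap_mem_sphere 0 hr.le θ) hθ

lemma DifferentiableOn.circleIntegrable_log_norm {φ : ℂ → ℂ}
    (hφ : DifferentiableOn ℂ φ (ball 0 1)) {r : ℝ} (hr : 0 < r ∧ r < 1) :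
    CircleIntegrable (fun z => Real.log ‖φ z‖) 0 r := by
  refine MeromorphicOn.circleIntegrable_log_norm fun z hz => ?_
  rw [abs_of_pos hr.1] at hz
  exact (hφ.analyticAt (isOpen_ball.mem_nhds
    (sphere_subset_closedBall.trans (closedBall_subset_ball hr.2) hz))).meromorphicAt

/-- The averages of `log ‖φ‖` over circles of radius tending to one accumulate at zero. -/
def LogMeansVanish (φ : ℂ → ℂ) : Prop :=
  ∀ δ > (0:ℝ), ∀ r₀ < (1:ℝ), ∃ r, (0 < r ∧ r < 1) ∧ r₀ < r ∧
    -δ ≤ Real.circleAverage (fun z => Real.log ‖φ z‖) 0 r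

lemma norm_discMoebius_le_one {a z : ℂ} (ha : ‖a‖ < 1) (hz : z ∈ ball (0:ℂ) 1) :
    ‖discMoebius a z‖ ≤ 1 := (isInner_discMoebius ha).norm_le_one hz

lemma norm_blaschkeFactor_sub_one_le {a z : ℂ} (ha0 : a ≠ 0) (ha : ‖a‖ < 1)
    (hz : z ∈ ball (0:ℂ) 1) :
    ‖((‖a‖ : ℂ) / a) * discMoebius a z - 1‖ ≤ (1 - ‖a‖) * (2 / (1 - ‖z‖)) := by
  have hz1 := mem_ball_zero_iff.1 hz
  have hne := one_sub_conj_mul_ne_zero ha hz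
  have hn : (starRingEnd ℂ) a * a = (‖a‖ : ℂ) ^ 2 := by
    rw [mul_comm, mul_conj, normSq_eq_norm_sq]; push_cast; ring
  have e : ((‖a‖ : ℂ) / a) * discMoebius a z - 1 =
      -((1 - ‖a‖ : ℝ) : ℂ) * ((1 + ((‖a‖ : ℂ) / a) * z) / (1 - (starRingEnd ℂ) a * z)) := by
    have hc : (starRingEnd ℂ) a = (‖a‖ : ℂ) ^ 2 / a := by rw [← hn]; field_simp
    rw [discMoebius, ← mul_div_assoc, ← mul_div_assoc, div_sub_one hne]
    congr 1
    rw [hc]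
    push_cast
    field_simp
    ring
  rw [e, norm_mul, norm_neg, norm_real, Real.norm_of_nonneg (by linarith)]
  refine mul_le_mul_of_nonneg_left ?_ (by linarith)
  rw [norm_div]
  have hu : ‖((‖a‖ : ℂ) / a)‖ = 1 := by
    rw [norm_div, norm_real, norm_norm, div_self (norm_ne_zero_iff.2 ha0)]
  refine div_le_div₀ (by norm_num) ?_ (by linarith) ?_
  · refine (norm_add_le _ _).trans ?_
    rw [norm_one, norm_mul, hu]; linarith
  · have := norm_sub_norm_le (1:ℂ) ((starRingEnd ℂ) a * z)
    rw [norm_one, norm_mul, RCLike.norm_conj] at this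
    nlinarith [norm_nonneg z]

lemma summable_one_sub_norm_of_finset {ι : Type} {a : ι → ℂ} {p : ℝ} (hp : 0 < p)
    (ha : ∀ i, ‖a i‖ < 1) (ha0 : ∀ i, a i ≠ 0) (h : ∀ s : Finset ι, p ≤ ∏ i ∈ s, ‖a i‖) :
    Summable fun i => 1 - ‖a i‖ := by
  refine summable_of_sum_le (c := -Real.log p) (fun i => by simpa using (ha i).le) fun s => ?_
  have h1 := Real.log_le_log hp (h s)
  rw [Real.log_prod (fun i _ => norm_ne_zero_iff.2 (ha0 i))] at h1
  have h2 : ∑ i ∈ s, (1 - ‖a i‖) ≤ ∑ i ∈ s, -Real.log ‖a i‖ := Finset.sum_le_sum fun i _ => by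
    linarith [Real.log_le_sub_one_of_pos (norm_pos_iff.2 (ha0 i))]
  rw [Finset.sum_neg_distrib] at h2
  linarith

lemma isBlaschkeProductOn_of_apply_zero_ne_zero {φ : ℂ → ℂ}
    (hφ : DifferentiableOn ℂ φ (ball 0 1)) (h1 : ∀ z ∈ ball (0:ℂ) 1, ‖φ z‖ ≤ 1) (h0 : φ 0 ≠ 0)
    (hlog : LogMeansVanish φ) :
    ∃ (c : ℂ) (ι : Type) (_ : Countable ι) (a : ι → ℂ), ‖c‖ = 1 ∧ (∀ i, a i ≠ 0 ∧ ‖a i‖ < 1) ∧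
      Summable (fun i => 1 - ‖a i‖) ∧ EqOn φ (blaschkeProd 0 c a) (ball 0 1) := by
  classical
  have h0b : (0:ℂ) ∈ ball (0:ℂ) 1 := by simp
  have han : ∀ z ∈ ball (0:ℂ) 1, AnalyticAt ℂ φ z := fun z hz =>
    hφ.analyticAt (isOpen_ball.mem_nhds hz)
  have htop : ∀ z ∈ ball (0:ℂ) 1, analyticOrderAt φ z ≠ ⊤ := fun z hz =>
    AnalyticOnNhd.analyticOrderAt_ne_top_of_isPreconnected (U := ball 0 1) (fun z hz => han z hz)
      (convex_ball 0 1).isPreconnected h0b hz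
      (by rw [(han 0 h0b).analyticOrderAt_eq_zero.2 h0]; simp)
  let ι : Type := {p : ℂ × ℕ // p.1 ∈ ball (0:ℂ) 1 ∧ p.1 ≠ 0 ∧ p.2 < analyticOrderNatAt φ p.1}
  let a : ι → ℂ := fun i => i.1.1
  have ha : ∀ i, ‖a i‖ < 1 := fun i => mem_ball_zero_iff.1 i.2.1
  have ha0 : ∀ i, a i ≠ 0 := fun i => i.2.2.1
  have hcount : ∀ w ∈ ball (0:ℂ) 1, ∀ s : Finset ι,
      ((s.filter (a · = w)).card : ℕ∞) ≤ analyticOrderAt φ w := by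
    intro w hw s
    rw [← Nat.cast_analyticOrderNatAt (htop w hw), Nat.cast_le]
    calc (s.filter (a · = w)).card ≤ (Finset.range (analyticOrderNatAt φ w)).card := by
          refine Finset.card_le_card_of_injOn (fun i => i.1.2) ?_ ?_
          · intro i hi
            have h2 : a i = w := (Finset.mem_filter.1 hi).2
            have h3 : i.1.2 < analyticOrderNatAt φ (a i) := i.2.2.2
            simpa [h2] using h3
          · intro i hi j hj hij
            have h2 : a i = w := (Finset.mem_filter.1 hi).2
            have h3 : a j = w := (Finset.mem_filter.1 hj).2
            exact Subtype.ext (Prod.ext (h2.trans h3.symm) hij)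
      _ = _ := Finset.card_range _
  choose ψ hψ hψ1 heq hord using exists_eq_prod_discMoebius_mul hφ h1 ha hcount
  have hsum : Summable fun i => 1 - ‖a i‖ := by
    refine summable_one_sub_norm_of_finset (norm_pos_iff.2 h0) ha ha0 fun s => ?_
    rw [heq s 0 h0b, norm_mul, norm_prod]
    simp only [discMoebius, mul_zero, sub_zero, div_one]
    exact mul_le_of_le_one_right (Finset.prod_nonneg fun _ _ => norm_nonneg _) (hψ1 s 0 h0b)
  have hctb : Countable ι := by
    have := hsum.countable_support
    have e : Function.support (fun i => 1 - ‖a i‖) = univ := by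
      ext i; simpa using (sub_pos.2 (ha i)).ne'
    rw [e] at this
    exact countable_univ_iff.1 this
  -- the zeros in a smaller disc
  have hfin : ∀ r < (1:ℝ), {i | ‖a i‖ ≤ r}.Finite := by
    intro r hr
    have := hsum.tendsto_cofinite_zero.eventually_lt_const (sub_pos.2 hr)
    rw [eventually_cofinite] at this
    refine this.subset fun i hi => ?_
    have hi' : ‖a i‖ ≤ r := hi
    change ¬ (1 - ‖a i‖ < 1 - r)
    linarith
  have hmean : ∀ r : ℝ, 0 < r ∧ r < 1 → ∀ s : Finset ι, (∀ i, ‖a i‖ ≤ r → i ∈ s) →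
      Real.circleAverage (fun z => Real.log ‖φ z‖) 0 r ≤ Real.log ‖ψ s 0‖ ∧ ψ s 0 ≠ 0 := by
    intro r hr s hs
    have hsub : closedBall (0:ℂ) |r| ⊆ ball 0 1 := by
      rw [abs_of_pos hr.1]; exact closedBall_subset_ball hr.2
    have hne : ∀ z ∈ closedBall (0:ℂ) |r|, ψ s z ≠ 0 := by
      intro z hz hz0
      have hzb := hsub hz
      by_cases hzz : z = 0
      · subst hzz
        apply h0; rw [heq s 0 h0b, hz0, mul_zero]
      have e1 := hord s z hzb
      have e2 : analyticOrderAt (ψ s) z ≠ 0 :=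
        ((hψ s).analyticAt (isOpen_ball.mem_nhds hzb)).analyticOrderAt_ne_zero.2 hz0
      have e3 : analyticOrderNatAt φ z ≤ (s.filter (a · = z)).card := by
        rw [← Fintype.card_fin (analyticOrderNatAt φ z), ← Finset.card_univ]
        refine Finset.card_le_card_of_injOn
          (fun k => (⟨(z, k), hzb, hzz, k.2⟩ : ι)) ?_ ?_
        · intro k _
          refine Finset.mem_coe.2 (Finset.mem_filter.2 ⟨hs _ ?_, rfl⟩)
          have := mem_closedBall_zero_iff.1 hz
          rwa [abs_of_pos hr.1] at this
        · intro k _ l _ hkl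
          have h3 := congrArg (fun i : ι => i.1.2) hkl
          exact Fin.ext h3
      rw [← Nat.cast_analyticOrderNatAt (htop z hzb)] at e1
      have e4 : analyticOrderAt (ψ s) z ≠ ⊤ := by
        intro h
        rw [h, add_top] at e1
        exact ENat.natCast_ne_top _ e1
      obtain ⟨k, hk⟩ := ENat.ne_top_iff_exists.1 e4
      rw [← hk] at e1 e2
      norm_cast at e1 e2
      omega
    refine ⟨?_, hne 0 (by simp)⟩
    rw [← AnalyticOnNhd.circleAverage_log_norm_of_ne_zero (fun z hz =>
      (hψ s).analyticAt (isOpen_ball.mem_nhds (hsub hz))) hne]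
    refine circleAverage_mono_of_countable hr.1 (hφ.circleIntegrable_log_norm hr)
      ((hψ s).circleIntegrable_log_norm hr) (S := range a) (countable_range a) ?_
    intro z hz hza
    have hzb : z ∈ ball (0:ℂ) 1 := closedBall_subset_ball hr.2 (sphere_subset_closedBall hz)
    have hzne : φ z ≠ 0 := by
      rw [heq s z hzb]
      refine mul_ne_zero (Finset.prod_ne_zero_iff.2 fun i _ => ?_)
        (hne z (by rw [abs_of_pos hr.1]; exact sphere_subset_closedBall hz))
      refine div_ne_zero (sub_ne_zero.2 fun h => hza ⟨i, h⟩)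
        (one_sub_conj_mul_ne_zero (ha i) hzb)
    refine Real.log_le_log (norm_pos_iff.2 hzne) ?_
    rw [heq s z hzb, norm_mul, norm_prod]
    exact mul_le_of_le_one_left (norm_nonneg _)
      (Finset.prod_le_one (fun _ _ => norm_nonneg _) fun i _ => norm_discMoebius_le_one (ha i) hzb)
  -- a sequence of radii
  have hseq : ∀ n : ℕ, ∃ r, (0 < r ∧ r < 1) ∧ radiusSeq n < r ∧
      -(1 / ((n:ℝ) + 1)) ≤ Real.circleAverage (fun z => Real.log ‖φ z‖) 0 r := fun n =>
    hlog _ (by positivity) _ (radiusSeq_mem n).2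
  choose r hr hr0 hrlog using hseq
  let S : ℕ → Finset ι := fun n => (hfin (r n) (hr n).2).toFinset
  have hS : ∀ n i, i ∈ S n ↔ ‖a i‖ ≤ r n := fun n i => by simp [S]
  have hSlim : Tendsto S atTop atTop := by
    refine tendsto_atTop.2 fun s => ?_
    have : ∀ i ∈ s, ∀ᶠ n in atTop, i ∈ S n := fun i _ => by
      have h2 := (tendsto_nhdsWithin_iff.1 tendsto_radiusSeq).1.eventually_const_lt (ha i)
      filter_upwards [h2] with n hn
      exact (hS n i).2 (hn.le.trans (hr0 n).le)
    exact ((Finset.eventually_all s).2 this).mono fun n hn i hi => hn i hi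
  let u : ι → ℂ := fun i => (‖a i‖ : ℂ) / a i
  have hu : ∀ i, ‖u i‖ = 1 := fun i => by
    rw [norm_div, norm_real, norm_norm, div_self (norm_ne_zero_iff.2 (ha0 i))]
  have hu0 : ∀ i, u i ≠ 0 := fun i => norm_ne_zero_iff.1 (by rw [hu i]; exact one_ne_zero)
  -- renormalised quotients
  let Ψ : ℕ → ℂ → ℂ := fun n z => (∏ i ∈ S n, u i)⁻¹ * ψ (S n) z
  have hΨn : ∀ n z, ‖Ψ n z‖ = ‖ψ (S n) z‖ := fun n z => by
    simp only [Ψ]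
    rw [norm_mul, norm_inv, norm_prod, Finset.prod_congr rfl fun i _ => hu i,
      Finset.prod_const_one, inv_one, one_mul]
  have hΨeq : ∀ n, ∀ z ∈ ball (0:ℂ) 1, φ z = (∏ i ∈ S n, u i * discMoebius (a i) z) * Ψ n z := by
    intro n z hz
    have hp : ∏ i ∈ S n, u i ≠ 0 := Finset.prod_ne_zero_iff.2 fun i _ => hu0 i
    rw [heq (S n) z hz, Finset.prod_mul_distrib]
    simp only [Ψ]
    field_simp
  have hΨ1 : ∀ n, ∀ z ∈ ball (0:ℂ) 1, ‖Ψ n z‖ ≤ 1 := fun n z hz => by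
    rw [hΨn]; exact hψ1 _ z hz
  obtain ⟨g, k, hg, hk, hlim⟩ := exists_subseq_tendsto_holomorphic (F := Ψ)
    (fun n => (hψ _).const_mul _) hΨ1
  have hg1 : ∀ z ∈ ball (0:ℂ) 1, ‖g z‖ ≤ 1 := fun z hz =>
    le_of_tendsto (hlim z hz).norm (Eventually.of_forall fun n => hΨ1 _ z hz)
  have hlow : ∀ n : ℕ, Real.exp (-(1 / ((n:ℝ) + 1))) ≤ ‖Ψ n 0‖ := fun n => by
    obtain ⟨m1, m2⟩ := hmean (r n) (hr n) (S n) fun i hi => (hS n i).2 hi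
    rw [hΨn, ← Real.le_log_iff_exp_le (norm_pos_iff.2 m2)]
    exact (hrlog n).trans m1
  have hg0 : ‖g 0‖ = 1 := by
    refine le_antisymm (hg1 0 h0b) ?_
    have h2 : Tendsto (fun n : ℕ => Real.exp (-(1 / ((n:ℝ) + 1)))) atTop (𝓝 1) := by
      have h3 := tendsto_one_div_add_atTop_nhds_zero_nat (𝕜 := ℝ)
      have h4 := (Real.continuous_exp.tendsto _).comp h3.neg
      simpa [Function.comp_def] using h4
    exact le_of_tendsto_of_tendsto (h2.comp hk.tendsto_atTop) (hlim 0 h0b).norm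
      (Eventually.of_forall fun n => hlow (k n))
  have hgc : EqOn g (Function.const ℂ (g 0)) (ball 0 1) :=
    Complex.eqOn_of_isPreconnected_of_isMaxOn_norm (convex_ball 0 1).isPreconnected isOpen_ball
      hg h0b fun z hz => by simpa [hg0] using hg1 z hz
  refine ⟨g 0, ι, hctb, a, hg0, fun i => ⟨ha0 i, ha i⟩, hsum, fun z hz => ?_⟩
  have hmul : Multipliable fun i => u i * discMoebius (a i) z := by
    have h2 : Summable fun i => u i * discMoebius (a i) z - 1 :=
      Summable.of_norm_bounded (hsum.mul_right (2 / (1 - ‖z‖)))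
        fun i => norm_blaschkeFactor_sub_one_le (ha0 i) (ha i) hz
    have h3 := Complex.multipliable_one_add_of_summable h2
    simpa using h3
  have h4 := (hmul.hasProd.comp (hSlim.comp hk.tendsto_atTop)).mul (hlim z hz)
  have h5 : Tendsto (fun _ : ℕ => φ z) atTop (𝓝 ((∏' i, u i * discMoebius (a i) z) * g z)) :=
    h4.congr fun n => (hΨeq (k n) z hz).symm
  rw [tendsto_nhds_unique tendsto_const_nhds h5, hgc hz]
  simp only [blaschkeProd, pow_zero, mul_one, Function.const_apply]
  rw [mul_comm]
  rfl

lemma LogMeansVanish.isBlaschkeProductOn {φ : ℂ → ℂ}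
    (hφ : DifferentiableOn ℂ φ (ball 0 1)) (h1 : ∀ z ∈ ball (0:ℂ) 1, ‖φ z‖ ≤ 1)
    (hne : ∃ z ∈ ball (0:ℂ) 1, φ z ≠ 0) (hlog : LogMeansVanish φ) :
    IsBlaschkeProductOn φ (ball 0 1) := by
  obtain ⟨w, hw, hw0⟩ := hne
  have han : ∀ z ∈ ball (0:ℂ) 1, AnalyticAt ℂ φ z := fun z hz =>
    hφ.analyticAt (isOpen_ball.mem_nhds hz)
  have htop : analyticOrderAt φ 0 ≠ ⊤ :=
    AnalyticOnNhd.analyticOrderAt_ne_top_of_isPreconnected (U := ball 0 1) (fun z hz => han z hz)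
      (convex_ball 0 1).isPreconnected hw (by simp)
      (by rw [(han w hw).analyticOrderAt_eq_zero.2 hw0]; simp)
  obtain ⟨m, hm⟩ := ENat.ne_top_iff_exists.1 htop
  obtain ⟨ψ, hψ, hψ1, heq, hψ0⟩ := exists_eq_pow_mul hφ h1 hm.symm
  have hlog' : LogMeansVanish ψ := by
    intro δ hδ r₀ hr₀
    obtain ⟨r, hr, hr0, hrl⟩ := hlog δ hδ r₀ hr₀
    refine ⟨r, hr, hr0, hrl.trans ?_⟩
    refine circleAverage_mono_of_countable hr.1 (hφ.circleIntegrable_log_norm hr)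
      (hψ.circleIntegrable_log_norm hr) countable_empty ?_
    intro z hz _
    have hzb : z ∈ ball (0:ℂ) 1 := closedBall_subset_ball hr.2 (sphere_subset_closedBall hz)
    by_cases hz0 : ψ z = 0
    · rw [heq z hzb, hz0, mul_zero]
    · have hzn : ‖z‖ = r := mem_sphere_zero_iff_norm.1 hz
      have hz' : z ≠ 0 := norm_pos_iff.1 (hzn ▸ hr.1)
      refine Real.log_le_log (norm_pos_iff.2 ?_) ?_
      · rw [heq z hzb]; exact mul_ne_zero (pow_ne_zero _ hz') hz0
      · rw [heq z hzb, norm_mul, norm_pow, hzn]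
        exact mul_le_of_le_one_left (norm_nonneg _) (pow_le_one₀ hr.1.le hr.2.le)
  obtain ⟨c, ι, hι, a, hc, ha, hsum, he⟩ :=
    isBlaschkeProductOn_of_apply_zero_ne_zero hψ hψ1 hψ0 hlog'
  refine ⟨m, c, ι, hι, a, hc, ha, hsum, fun z hz => ?_⟩
  rw [heq z hz, he hz]
  simp only [blaschkeProd, pow_zero, mul_one]
  ring

/-! ### Frostman shifts -/

section

open scoped ENNReal

instance neBot_ae_circMeas : NeBot (ae circMeas) := by
  rw [ae_neBot]
  intro h0
  have := congrArg (fun μ : Measure ℝ => μ univ) h0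
  simp at this
  linarith [Real.pi_pos]

lemma norm_sub_le_norm_one_sub {α w : ℂ} (hα : ‖α‖ ≤ 1) (hw : ‖w‖ ≤ 1) :
    ‖α - w‖ ≤ ‖1 - (starRingEnd ℂ) α * w‖ := by
  have e : normSq (1 - (starRingEnd ℂ) α * w) - normSq (α - w) =
      (1 - normSq α) * (1 - normSq w) := by
    simp only [normSq_apply, sub_re, sub_im, mul_re, mul_im, conj_re, conj_im, one_re, one_im]
    ring
  rw [normSq_eq_norm_sq, normSq_eq_norm_sq, normSq_eq_norm_sq, normSq_eq_norm_sq] at e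
  have : 0 ≤ (1 - ‖α‖ ^ 2) * (1 - ‖w‖ ^ 2) := by
    have := pow_le_one₀ (n := 2) (norm_nonneg α) hα
    have := pow_le_one₀ (n := 2) (norm_nonneg w) hw
    exact mul_nonneg (by linarith) (by linarith)
  exact le_of_sq_le_sq (by linarith) (norm_nonneg _)

lemma neg_log_discMoebius_nonneg {α w : ℂ} (hα : ‖α‖ ≤ 1) (hw : ‖w‖ ≤ 1) :
    0 ≤ -Real.log ‖discMoebius α w‖ := by
  rw [neg_nonneg, discMoebius, norm_div]
  exact Real.log_nonpos (by positivity)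
    (div_le_one_of_le₀ (norm_sub_le_norm_one_sub hα hw) (norm_nonneg _))

lemma lintegral_neg_log_discMoebius {ρ : ℝ} (hρ : 0 < ρ ∧ ρ < 1) {w : ℂ} (hw : ‖w‖ ≤ 1) :
    ∫⁻ t : ℝ, ENNReal.ofReal (-Real.log ‖discMoebius (circleMap 0 ρ t) w‖) ∂circMeas =
      ENNReal.ofReal (2 * π * -(Real.log ρ + Real.posLog (ρ⁻¹ * ‖w‖))) := by
  have hne : ∀ z : ℂ, ‖z‖ ≤ ρ → 1 - (starRingEnd ℂ) w * z ≠ 0 := by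
    intro z hz h
    have h1 := congrArg norm (sub_eq_zero.1 h)
    rw [norm_one, norm_mul, RCLike.norm_conj] at h1
    nlinarith [norm_nonneg z, norm_nonneg w]
  have hconj : ∀ z : ℂ, ‖1 - (starRingEnd ℂ) z * w‖ = ‖1 - (starRingEnd ℂ) w * z‖ := by
    intro z
    rw [← RCLike.norm_conj (1 - (starRingEnd ℂ) z * w)]
    simp [mul_comm]
  have i1 : CircleIntegrable (fun z => Real.log ‖1 - (starRingEnd ℂ) w * z‖) 0 ρ :=
    MeromorphicOn.circleIntegrable_log_norm fun z _ =>
      (show AnalyticAt ℂ (fun z => 1 - (starRingEnd ℂ) w * z) z by fun_prop).meromorphicAt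
  have i2 : CircleIntegrable (fun z => Real.log ‖z - w‖) 0 ρ :=
    MeromorphicOn.circleIntegrable_log_norm fun z _ =>
      (show AnalyticAt ℂ (fun z => z - w) z by fun_prop).meromorphicAt
  have a1 : Real.circleAverage (fun z => Real.log ‖1 - (starRingEnd ℂ) w * z‖) 0 ρ = 0 := by
    rw [AnalyticOnNhd.circleAverage_log_norm_of_ne_zero
      (g := fun z => 1 - (starRingEnd ℂ) w * z) (fun z _ => by fun_prop)
      (fun z hz => hne z (by simpa [abs_of_pos hρ.1] using hz))]
    simp
  have a2 : Real.circleAverage (fun z => Real.log ‖z - w‖) 0 ρ =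
      Real.log ρ + Real.posLog (ρ⁻¹ * ‖w‖) := by
    rw [circleAverage_log_norm_sub_const_eq_log_radius_add_posLog hρ.1.ne']
    simp
  rw [Real.circleAverage_def, intervalIntegral.integral_of_le (by positivity), smul_eq_mul,
    inv_mul_eq_iff_eq_mul₀ (by positivity)] at a1 a2
  have hae : ∀ᵐ t : ℝ ∂circMeas, Real.log ‖1 - (starRingEnd ℂ) w * circleMap 0 ρ t‖ -
      Real.log ‖circleMap 0 ρ t - w‖ = -Real.log ‖discMoebius (circleMap 0 ρ t) w‖ := by
    refine ae_restrict_of_ae ?_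
    filter_upwards [((countable_singleton w).preimage_circleMap 0 hρ.1.ne').ae_notMem volume]
      with t ht
    have h1 : circleMap 0 ρ t - w ≠ 0 := sub_ne_zero.2 ht
    have h2 := hne (circleMap 0 ρ t) (by simp [abs_of_pos hρ.1])
    rw [discMoebius, norm_div, hconj, Real.log_div (norm_ne_zero_iff.2 h1) (norm_ne_zero_iff.2 h2)]
    ring
  have j1 : Integrable (fun t => Real.log ‖1 - (starRingEnd ℂ) w * circleMap 0 ρ t‖) circMeas :=
    i1.1
  have j2 : Integrable (fun t => Real.log ‖circleMap 0 ρ t - w‖) circMeas := i2.1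
  rw [← ofReal_integral_eq_lintegral_ofReal ((j1.sub j2).congr hae)
    (Eventually.of_forall fun t => neg_log_discMoebius_nonneg (by simp [abs_of_pos hρ.1, hρ.2.le])
      hw), ← integral_congr_ae hae, integral_sub j1 j2, a1, a2]
  congr 1
  ring

lemma IsInner.exists_logMeansVanish {φ : ℂ → ℂ} (hφ : IsInner φ) {ρ : ℝ} (hρ : 0 < ρ ∧ ρ < 1) :
    ∃ α : ℂ, ‖α‖ = ρ ∧ LogMeansVanish fun z => discMoebius α (φ z) := by
  set h : ℕ → ℝ → ℂ := fun n θ => φ (radiusSeq n * Complex.exp (θ * I))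
  have hh : ∀ n, Continuous (h n) := fun n => hφ.1.continuous_circle (radiusSeq_mem n)
  have hh1 : ∀ n θ, ‖h n θ‖ ≤ 1 := fun n θ =>
    hφ.norm_le_one (mul_exp_mem_ball (radiusSeq_mem n) θ)
  set K : ℕ → ℝ → ℝ → ℝ := fun n t θ => -Real.log ‖discMoebius (circleMap 0 ρ t) (h n θ)‖
  have hαn : ∀ t, ‖circleMap 0 ρ t‖ = ρ := fun t => by simp [abs_of_pos hρ.1]
  have hK0 : ∀ n t θ, 0 ≤ K n t θ := fun n t θ =>
    neg_log_discMoebius_nonneg ((hαn t).trans_le hρ.2.le) (hh1 n θ)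
  have hKm : ∀ n, Measurable fun p : ℝ × ℝ => K n p.1 p.2 := by
    intro n
    have c1 : Continuous fun p : ℝ × ℝ => circleMap 0 ρ p.1 := (continuous_circleMap 0 ρ).comp
      continuous_fst
    have c2 : Continuous fun p : ℝ × ℝ => h n p.2 := (hh n).comp continuous_snd
    have c3 := (c1.sub c2).measurable.div
      (continuous_const (y := (1:ℂ)).sub ((continuous_conj.comp c1).mul c2)).measurable
    exact (Real.measurable_log.comp c3.norm).neg
  have hKm' : ∀ n, Measurable fun p : ℝ × ℝ => ENNReal.ofReal (K n p.1 p.2) := fun n =>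
    (hKm n).ennreal_ofReal
  set J : ℕ → ℝ → ℝ≥0∞ := fun n t => ∫⁻ θ, ENNReal.ofReal (K n t θ) ∂circMeas
  have hJm : ∀ n, Measurable (J n) := fun n => (hKm' n).lintegral_prod_right'
  set G : ℂ → ℝ := fun w => 2 * π * -(Real.log ρ + Real.posLog (ρ⁻¹ * ‖w‖))
  have hG : Continuous G := by
    have : Continuous fun w : ℂ => Real.posLog (ρ⁻¹ * ‖w‖) :=
      Real.continuous_posLog.comp (by fun_prop)
    fun_prop
  have hJint : ∀ n, ∫⁻ t, J n t ∂circMeas = ∫⁻ θ, ENNReal.ofReal (G (h n θ)) ∂circMeas := by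
    intro n
    rw [lintegral_lintegral_swap (hKm' n).aemeasurable]
    exact lintegral_congr fun θ => lintegral_neg_log_discMoebius hρ (hh1 n θ)
  have hlim : Tendsto (fun n => ∫⁻ t, J n t ∂circMeas) atTop (𝓝 0) := by
    simp_rw [hJint]
    have h0 : ∫⁻ _ : ℝ, (0:ℝ≥0∞) ∂circMeas = 0 := lintegral_zero
    rw [← h0]
    refine tendsto_lintegral_of_dominated_convergence
      (fun _ => ENNReal.ofReal (2 * π * -Real.log ρ))
      (fun n => (hG.comp (hh n)).measurable.ennreal_ofReal) (fun n => Eventually.of_forall fun θ =>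
        ENNReal.ofReal_le_ofReal ?_) ?_ ?_
    · have := Real.posLog_nonneg (x := ρ⁻¹ * ‖h n θ‖)
      simp only [G]
      gcongr
      linarith
    · rw [lintegral_const]
      exact (ENNReal.mul_lt_top ENNReal.ofReal_lt_top (measure_lt_top _ _)).ne
    · filter_upwards [hφ.bddHol.bv_lim, hφ.norm_bv] with θ h1 h2
      have h3 : Tendsto (fun n => h n θ) atTop (𝓝 (bv φ θ)) := h1.comp tendsto_radiusSeq
      have h4 : G (bv φ θ) = 0 := by
        simp only [G]
        rw [h2, mul_one, Real.posLog_eq_log, Real.log_inv]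
        · ring
        · rw [abs_of_pos (inv_pos.2 hρ.1)]
          exact (one_le_inv₀ hρ.1).2 hρ.2.le
      have h5 := ENNReal.tendsto_ofReal ((hG.tendsto _).comp h3)
      rwa [h4, ENNReal.ofReal_zero] at h5
  have hfatou : ∫⁻ t, liminf (fun n => J n t) atTop ∂circMeas = 0 := by
    refine le_antisymm ((lintegral_liminf_le hJm).trans ?_) bot_le
    rw [hlim.liminf_eq]
  rw [lintegral_eq_zero_iff (Measurable.liminf hJm)] at hfatou
  obtain ⟨t, ht⟩ := hfatou.exists
  refine ⟨circleMap 0 ρ t, hαn t, fun δ hδ r₀ hr₀ => ?_⟩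
  have hfreq : ∃ᶠ n in atTop, J n t < ENNReal.ofReal δ :=
    frequently_lt_of_liminf_lt (by isBoundedDefault) (by
      change liminf (fun n => J n t) atTop = 0 at ht
      rw [ht]; exact ENNReal.ofReal_pos.2 hδ)
  obtain ⟨n, hn, hn0⟩ := (hfreq.and_eventually
    ((tendsto_nhdsWithin_iff.1 tendsto_radiusSeq).1.eventually_const_lt hr₀)).exists
  refine ⟨radiusSeq n, radiusSeq_mem n, hn0, ?_⟩
  have hFint : ∫ θ, K n t θ ∂circMeas ≤ δ := by
    rw [integral_eq_lintegral_of_nonneg_ae (Eventually.of_forall fun θ => hK0 n t θ)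
      ((hKm n).comp (measurable_const.prodMk measurable_id)).aestronglyMeasurable]
    exact ENNReal.toReal_le_of_le_ofReal hδ.le hn.le
  have havg : Real.circleAverage (fun z => Real.log ‖discMoebius (circleMap 0 ρ t) (φ z)‖) 0
      (radiusSeq n) = -((2 * π)⁻¹ * ∫ θ, K n t θ ∂circMeas) := by
    rw [Real.circleAverage_def, intervalIntegral.integral_of_le (by positivity), smul_eq_mul]
    simp only [K, h, integral_neg, circleMap_zero, mul_neg, neg_neg]
  rw [havg, neg_le_neg_iff]
  have hpi : (2 * π)⁻¹ ≤ 1 := inv_le_one_of_one_le₀ (by linarith [Real.pi_gt_three])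
  have hI0 : 0 ≤ ∫ θ, K n t θ ∂circMeas := integral_nonneg fun θ => hK0 n t θ
  exact (mul_le_of_le_one_left hI0 hpi).trans hFint

lemma IsInner.exists_isBlaschkeProductOn_approx {φ : ℂ → ℂ} (hφ : IsInner φ) {η : ℝ} (hη : 0 < η) :
    ∃ ψ, IsInner ψ ∧ IsBlaschkeProductOn ψ (ball 0 1) ∧
      ∀ z ∈ ball (0:ℂ) 1, ‖ψ z - φ z‖ ≤ η := by
  set ρ := min (1 / 2) (η / 4)
  have hρ0 : 0 < ρ := lt_min (by norm_num) (by positivity)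
  have hρ2 : ρ ≤ 1 / 2 := min_le_left _ _
  have hρη : ρ ≤ η / 4 := min_le_right _ _
  obtain ⟨α, hα, hlog⟩ := hφ.exists_logMeansVanish (ρ := ρ) ⟨hρ0, by linarith⟩
  have hα1 : ‖α‖ < 1 := by linarith
  have hinner : IsInner fun z => -discMoebius α (φ z) := by
    have h := isInner_moebius (F := fun _ => -α) (Ω := φ)
      (F' := fun z => -(starRingEnd ℂ) α * φ z) (BddHol.const _) hφ
      (hφ.bddHol.const_mul _) (by
        filter_upwards [hφ.bddHol.bv_const_mul (-(starRingEnd ℂ) α)] with θ h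
        rw [h, bv_const, map_neg, mul_comm]) hα1 (fun z hz => by
        rw [norm_mul, norm_neg, RCLike.norm_conj]
        exact mul_le_of_le_one_right (norm_nonneg α) (hφ.norm_le_one hz))
      (w := 1) (by simp)
    convert h using 2 with z
    simp only [discMoebius]
    ring
  have hlog' : LogMeansVanish fun z => -discMoebius α (φ z) := by
    simpa only [LogMeansVanish, norm_neg] using hlog
  refine ⟨_, hinner, hlog'.isBlaschkeProductOn hinner.1 (fun z hz => hinner.norm_le_one hz) ?_,
    fun z hz => ?_⟩
  · by_contra! hall
    have h0 := hinner.bddHol.norm_bv_le (C := 0) (fun z hz => by rw [hall z hz, norm_zero])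
    obtain ⟨θ, h1, h2⟩ := (h0.and hinner.norm_bv).exists
    rw [h2] at h1
    linarith
  · have hw := hφ.norm_le_one hz
    have hD : 1 / 2 ≤ ‖1 - (starRingEnd ℂ) α * φ z‖ := by
      have := norm_sub_norm_le (1:ℂ) ((starRingEnd ℂ) α * φ z)
      rw [norm_one, norm_mul, RCLike.norm_conj] at this
      nlinarith [norm_nonneg (φ z)]
    have hD0 : 1 - (starRingEnd ℂ) α * φ z ≠ 0 := norm_pos_iff.1 (by linarith)
    have e : -discMoebius α (φ z) - φ z =
        ((starRingEnd ℂ) α * φ z ^ 2 - α) / (1 - (starRingEnd ℂ) α * φ z) := by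
      rw [discMoebius, eq_div_iff hD0, sub_mul, ← neg_div, div_mul_cancel₀ _ hD0]
      ring
    rw [e, norm_div, div_le_iff₀ (by linarith)]
    have h1 : ‖(starRingEnd ℂ) α * φ z ^ 2 - α‖ ≤ ρ * 1 + ρ := by
      refine (norm_sub_le _ _).trans (add_le_add ?_ hα.le)
      rw [norm_mul, RCLike.norm_conj, norm_pow, hα]
      exact mul_le_mul_of_nonneg_left (pow_le_one₀ (norm_nonneg _) hw) hρ0.le
    nlinarith

end

/-- **Marshall's theorem.** Every function in the closed unit ball of `H^∞` can be uniformly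
approximated on the open unit disc by convex combinations of inner functions, which may
moreover be taken to be Blaschke products. -/
theorem marshall (f : ℂ → ℂ)
    (hd : DifferentiableOn ℂ f (ball (0:ℂ) 1))
    (hb : ∀ z ∈ ball (0:ℂ) 1, ‖f z‖ ≤ 1)
    (ε : ℝ) (hε : 0 < ε) :
    ∃ (n : ℕ) (l : Fin n → ℝ) (ω : Fin n → ℂ → ℂ),
      (∀ i, 0 ≤ l i) ∧ (∑ i, l i = 1) ∧
      (∀ i, IsInner (ω i) ∧ IsBlaschkeProductOn (ω i) (ball (0:ℂ) 1)) ∧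
      ∀ z ∈ ball (0:ℂ) 1, ‖(∑ i, (l i : ℂ) * ω i z) - f z‖ < ε := by
  set δ := min ε 1 / 5 with hδdef
  have hδ : 0 < δ := by positivity
  have hδε : 5 * δ ≤ ε := by rw [hδdef]; linarith [min_le_left ε 1]
  have hδ1 : 5 * δ ≤ 1 := by rw [hδdef]; linarith [min_le_right ε 1]
  have hf : BddHol f := ⟨hd, 1, hb⟩
  obtain ⟨F, hF, hFf⟩ := (hf.const_mul ((1 - δ : ℝ) : ℂ)).exists_isPseudocont_approx
    (half_pos hδ)
  have hFρ : ∀ z ∈ ball (0:ℂ) 1, ‖F z‖ ≤ 1 - δ / 2 := fun z hz => by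
    have h1 := norm_le_norm_add_norm_sub' (F z) (((1 - δ : ℝ) : ℂ) * f z)
    have h2 : ‖((1 - δ : ℝ) : ℂ) * f z‖ ≤ 1 - δ := by
      rw [norm_mul, norm_real, Real.norm_of_nonneg (by linarith)]
      exact mul_le_of_le_one_right (by linarith) (hb z hz)
    linarith [hFf z hz]
  obtain ⟨N, φ, hN, hφ, hav⟩ := hF.exists_average_isInner (by linarith) hFρ hδ
  choose ψ hψ hψB hψφ using fun j => (hφ j).exists_isBlaschkeProductOn_approx hδ
  have hN0 : (N : ℝ) ≠ 0 := Nat.cast_ne_zero.2 hN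
  refine ⟨N, fun _ => (N : ℝ)⁻¹, ψ, fun _ => by positivity, by simp [hN0],
    fun j => ⟨hψ j, hψB j⟩, fun z hz => ?_⟩
  have h1 : ‖(∑ j, (((N : ℝ)⁻¹ : ℝ) : ℂ) * ψ j z) - ∑ j, (((N : ℝ)⁻¹ : ℝ) : ℂ) * φ j z‖ ≤ δ := by
    rw [← Finset.sum_sub_distrib]
    refine (norm_sum_le_of_le (n := fun _ => (N : ℝ)⁻¹ * δ) _ fun j _ => ?_).trans_eq ?_
    · rw [← mul_sub, norm_mul, norm_real, Real.norm_of_nonneg (by positivity)]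
      exact mul_le_mul_of_nonneg_left (hψφ j z hz) (by positivity)
    · simp [hN0]
  have h2 : ‖((1 - δ : ℝ) : ℂ) * f z - f z‖ ≤ δ := by
    have e : ((1 - δ : ℝ) : ℂ) * f z - f z = -((δ : ℂ) * f z) := by push_cast; ring
    rw [e, norm_neg, norm_mul, norm_real, Real.norm_of_nonneg hδ.le]
    exact mul_le_of_le_one_right hδ.le (hb z hz)
  have h3 := hav z hz
  have h4 := hFf z hz
  have t1 := norm_sub_le_norm_sub_add_norm_sub (∑ j, (((N : ℝ)⁻¹ : ℝ) : ℂ) * ψ j z)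
    (∑ j, (((N : ℝ)⁻¹ : ℝ) : ℂ) * φ j z) (f z)
  have t2 := norm_sub_le_norm_sub_add_norm_sub (∑ j, (((N : ℝ)⁻¹ : ℝ) : ℂ) * φ j z) (F z) (f z)
  have t3 := norm_sub_le_norm_sub_add_norm_sub (F z) (((1 - δ : ℝ) : ℂ) * f z) (f z)
  linarith
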